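/- Let ω ∈ A₁ and f ∈ BMO(ω). If G(f)(x₀) < +∞ for at least one point x₀ ∈ ℝⁿ, then G(f)(x) < +∞ for almost every x ∈ ℝⁿ, and there exists a constant C > 0, independent of f, such that ‖G(f)‖_{BLO(ω)} ≤ C · ‖f‖_{BMO(ω)}. -/

import Mathlib

open MeasureTheory Metric Set ENNReal

noncomputable section

namespace LPW

variable {n : ℕ}

/-- n-dimensional Euclidean space. -/
abbrev Rn (n : ℕ) := EuclideanSpace ℝ (Fin n)

/-- Axis-parallel open cube with center `c` and half-side `h`. -/
def cube (c : Rn n) (h : ℝ) : Set (Rn n) := {y : Rn n | ∀ i, |y i - c i| < h}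

/-- The ω-measure `ω(E) = ∫_E ω`. -/
def wInt (ω : Rn n → ℝ) (E : Set (Rn n)) : ℝ := ∫ x in E, ω x

/-- The Lebesgue mean value `f_E = (1/m(E)) ∫_E f`. -/
def avg (f : Rn n → ℝ) (E : Set (Rn n)) : ℝ := ((volume E).toReal)⁻¹ * ∫ x in E, f x

/-- Weighted mean oscillation `(1/ω(E)) ∫_E |f - f_E|`. -/
def bmoAvg (ω f : Rn n → ℝ) (E : Set (Rn n)) : ℝ :=
  (wInt ω E)⁻¹ * ∫ x in E, |f x - avg f E|

/-- Weighted lower oscillation `(1/ω(E)) ∫_E (f - essinf_E f)`. -/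
def bloAvg (ω f : Rn n → ℝ) (E : Set (Rn n)) : ℝ :=
  (wInt ω E)⁻¹ * ∫ x in E, (f x - essInf f (volume.restrict E))

/-- `‖f‖_{BMO(ω)}`, supremum over all balls, valued in `[0,∞]`. -/
def bmoNorm (ω f : Rn n → ℝ) : ℝ≥0∞ :=
  ⨆ (c : Rn n) (ρ : ℝ) (_ : 0 < ρ), ENNReal.ofReal (bmoAvg ω f (Metric.ball c ρ))

/-- `‖f‖_{BLO(ω)}`, supremum over all balls, valued in `[0,∞]`. -/
def bloNorm (ω f : Rn n → ℝ) : ℝ≥0∞ :=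
  ⨆ (c : Rn n) (ρ : ℝ) (_ : 0 < ρ), ENNReal.ofReal (bloAvg ω f (Metric.ball c ρ))

/-- `‖f‖_{L^∞(ω)}`, supremum over all balls of `(essinf_B ω)⁻¹ · esssup_B |f|`. -/
def linfNorm (ω f : Rn n → ℝ) : ℝ≥0∞ :=
  ⨆ (c : Rn n) (ρ : ℝ) (_ : 0 < ρ),
    ENNReal.ofReal ((essInf ω (volume.restrict (Metric.ball c ρ)))⁻¹ *
      essSup (fun x => |f x|) (volume.restrict (Metric.ball c ρ)))

/-- `‖f‖_{BMO(ω)}` taken over cubes. -/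
def bmoNormC (ω f : Rn n → ℝ) : ℝ≥0∞ :=
  ⨆ (c : Rn n) (h : ℝ) (_ : 0 < h), ENNReal.ofReal (bmoAvg ω f (cube c h))

/-- `‖f‖_{BLO(ω)}` taken over cubes. -/
def bloNormC (ω f : Rn n → ℝ) : ℝ≥0∞ :=
  ⨆ (c : Rn n) (h : ℝ) (_ : 0 < h), ENNReal.ofReal (bloAvg ω f (cube c h))

/-- `‖f‖_{BMO^p(ω)}` taken over cubes (extended-valued). -/
def bmoPNorm (p : ℝ) (ω f : Rn n → ℝ) : ℝ≥0∞ :=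
  ⨆ (c : Rn n) (h : ℝ) (_ : 0 < h),
    ((ENNReal.ofReal (wInt ω (cube c h)))⁻¹ *
      ∫⁻ x in cube c h,
        ENNReal.ofReal (|f x - avg f (cube c h)| ^ p * (ω x) ^ (1 - p))) ^ (1/p)

/-- `‖f‖_{BLO^p(ω)}` taken over cubes (extended-valued). -/
def bloPNorm (p : ℝ) (ω f : Rn n → ℝ) : ℝ≥0∞ :=
  ⨆ (c : Rn n) (h : ℝ) (_ : 0 < h),
    ((ENNReal.ofReal (wInt ω (cube c h)))⁻¹ *
      ∫⁻ x in cube c h,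
        ENNReal.ofReal ((f x - essInf f (volume.restrict (cube c h))) ^ p * (ω x) ^ (1 - p))) ^ (1/p)

/-- A weight: nonnegative, locally integrable, positive a.e. -/
def IsWeight (ω : Rn n → ℝ) : Prop :=
  (∀ x, 0 ≤ ω x) ∧ LocallyIntegrable ω volume ∧
    ∀ᵐ x ∂(volume : Measure (Rn n)), 0 < ω x

/-- `C` is an `A₁` bound for `ω` (over balls). -/
def A1ballBound (ω : Rn n → ℝ) (C : ℝ) : Prop :=
  0 < C ∧ ∀ (c : Rn n) (ρ : ℝ), 0 < ρ →
    avg ω (Metric.ball c ρ) ≤ C * essInf ω (volume.restrict (Metric.ball c ρ))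

/-- `ω ∈ A₁` (over balls). -/
def IsA1ball (ω : Rn n → ℝ) : Prop := ∃ C, A1ballBound ω C

/-- `[ω]_{A₁}` (over balls), the least `A₁` bound. -/
def A1ballConst (ω : Rn n → ℝ) : ℝ := sInf {C | A1ballBound ω C}

/-- `C` is an `A₁` bound for `ω` (over cubes). -/
def A1cubeBound (ω : Rn n → ℝ) (C : ℝ) : Prop :=
  0 < C ∧ ∀ (c : Rn n) (h : ℝ), 0 < h →
    avg ω (cube c h) ≤ C * essInf ω (volume.restrict (cube c h))

/-- `ω ∈ A₁` (over cubes). -/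
def IsA1cube (ω : Rn n → ℝ) : Prop := ∃ C, A1cubeBound ω C

/-- `[ω]_{A₁}` (over cubes), the least `A₁` bound. -/
def A1cubeConst (ω : Rn n → ℝ) : ℝ := sInf {C | A1cubeBound ω C}

/-- `C` is an `A₂` bound for `ω` (over balls). -/
def A2ballBound (ω : Rn n → ℝ) (C : ℝ) : Prop :=
  0 < C ∧ ∀ (c : Rn n) (ρ : ℝ), 0 < ρ →
    avg ω (Metric.ball c ρ) * avg (fun x => (ω x)⁻¹) (Metric.ball c ρ) ≤ C

/-- `ω ∈ A₂` (over balls). -/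
def IsA2ball (ω : Rn n → ℝ) : Prop := ∃ C, A2ballBound ω C

/-- `[ω]_{A₂}` (over balls), the least `A₂` bound. -/
def A2ballConst (ω : Rn n → ℝ) : ℝ := sInf {C | A2ballBound ω C}

/-- Conditions (P1), (P2), (P3) on the kernel ψ. -/
def PsiKernel (n : ℕ) (C₁ C₂ δ γ : ℝ) (ψ : Rn n → ℝ) : Prop :=
  Integrable ψ volume ∧ (∫ x, ψ x) = 0 ∧
  (∀ x : Rn n, |ψ x| ≤ C₁ * (1 + ‖x‖) ^ (-((n : ℝ) + δ))) ∧
  (∀ x h : Rn n, 2 * ‖h‖ ≤ ‖x‖ →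
    |ψ (x + h) - ψ x| ≤ C₂ * ‖h‖ ^ γ * (1 + ‖x‖) ^ (-((n : ℝ) + δ + γ)))

/-- The convolution `(ψ_t * f)(x)` where `ψ_t(x) = t^{-n} ψ(x/t)`. -/
def cvl (ψ : Rn n → ℝ) (t : ℝ) (f : Rn n → ℝ) (x : Rn n) : ℝ :=
  ∫ y, (t ^ n)⁻¹ * ψ (t⁻¹ • (x - y)) * f y

/-- The generalized Littlewood–Paley g-function `G(f)(x)`, valued in `[0,∞]`. -/
def Gfun (ψ f : Rn n → ℝ) (x : Rn n) : ℝ≥0∞ :=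
  (∫⁻ t in Ioi (0:ℝ), ENNReal.ofReal ((cvl ψ t f x) ^ 2 / t)) ^ (1/2 : ℝ)

/-- The dilated Lusin area integral `S_a(f)(x)` (aperture `a`), valued in `[0,∞]`. -/
def Sdil (ψ : Rn n → ℝ) (a : ℝ) (f : Rn n → ℝ) (x : Rn n) : ℝ≥0∞ :=
  (∫⁻ t in Ioi (0:ℝ), ∫⁻ y in Metric.ball x (a * t),
      ENNReal.ofReal ((cvl ψ t f y) ^ 2 / t ^ (n + 1))) ^ (1/2 : ℝ)

/-- The generalized Lusin area integral `S(f)(x)`, valued in `[0,∞]`. -/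
def Sfun (ψ f : Rn n → ℝ) (x : Rn n) : ℝ≥0∞ := Sdil ψ 1 f x

/-- Stein's function `G*_λ(f)(x)`, valued in `[0,∞]`. -/
def Gstar (ψ : Rn n → ℝ) (lam : ℝ) (f : Rn n → ℝ) (x : Rn n) : ℝ≥0∞ :=
  (∫⁻ t in Ioi (0:ℝ), ∫⁻ y,
      ENNReal.ofReal ((t / (t + dist x y)) ^ (lam * (n : ℝ)) *
        (cvl ψ t f y) ^ 2 / t ^ (n + 1))) ^ (1/2 : ℝ)


/-- The measure `dt/t` on `(0,∞)`. -/
def nu : Measure ℝ := (volume.restrict (Ioi (0:ℝ))).withDensity (fun t => ENNReal.ofReal t⁻¹)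

lemma lintegral_nu (F : ℝ → ℝ≥0∞) : ∫⁻ t, F t ∂nu = ∫⁻ t in Ioi (0:ℝ), ENNReal.ofReal t⁻¹ * F t := by
  unfold nu
  rw [lintegral_withDensity_eq_lintegral_mul_non_measurable _ (by fun_prop)
    (Filter.Eventually.of_forall fun t => by simp)]
  rfl

lemma lintegral_nu_restrict {S : Set ℝ} (hS : MeasurableSet S) (F : ℝ → ℝ≥0∞) :
    ∫⁻ t in S, F t ∂nu = ∫⁻ t in (Ioi (0:ℝ) ∩ S), ENNReal.ofReal t⁻¹ * F t := by
  rw [← lintegral_indicator hS, lintegral_nu, ← Set.inter_comm, ← Measure.restrict_restrict hS,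
    ← lintegral_indicator hS]
  congr 1; ext t
  by_cases h : t ∈ S <;> simp [h]

lemma eLpNorm_two_sq {α E : Type*} [MeasurableSpace α] [NormedAddCommGroup E] (μ : Measure α)
    (F : α → E) : eLpNorm F 2 μ ^ 2 = ∫⁻ t, ‖F t‖ₑ ^ 2 ∂μ := by
  have := eLpNorm_nnreal_pow_eq_lintegral (μ := μ) (f := F) (p := 2) (by norm_num)
  simpa using this

lemma eLpNorm_two' {α E : Type*} [MeasurableSpace α] [NormedAddCommGroup E] (μ : Measure α)
    (F : α → E) : eLpNorm F 2 μ = (∫⁻ t, ‖F t‖ₑ ^ 2 ∂μ) ^ (1/2 : ℝ) := by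
  rw [← eLpNorm_two_sq, ← ENNReal.rpow_natCast, ← ENNReal.rpow_mul]; norm_num

/-- The `g`-function with `t` restricted to `S`. -/
def Gs (ψ : Rn n → ℝ) (S : Set ℝ) (h : Rn n → ℝ) (x : Rn n) : ℝ≥0∞ :=
  eLpNorm (fun t => cvl ψ t h x) 2 (nu.restrict S)

lemma Gfun_eq (ψ f : Rn n → ℝ) (x : Rn n) : Gfun ψ f x = Gs ψ univ f x := by
  unfold Gfun Gs
  rw [eLpNorm_two', Measure.restrict_univ, lintegral_nu]
  congr 1
  apply setLIntegral_congr_fun measurableSet_Ioi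
  intro t ht
  have ht : 0 < t := ht
  simp only [div_eq_mul_inv]
  rw [mul_comm, ENNReal.ofReal_mul (by positivity), ← enorm_pow, Real.enorm_eq_ofReal (by positivity)]

lemma lint_low {α d : ℝ} (hα : 0 < α) (hd : 0 < d) :
    ∫⁻ t in Ioc 0 d, ENNReal.ofReal (t⁻¹ * ((t / d) ^ α) ^ 2) = ENNReal.ofReal (1 / (2*α)) := by
  have e : ∀ t ∈ Ioc 0 d, t⁻¹ * ((t / d) ^ α) ^ 2 = (d ^ (2*α))⁻¹ * t ^ (2*α - 1) := by
    intro t ht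
    have ht0 : 0 < t := ht.1
    rw [Real.div_rpow ht0.le hd.le, Real.rpow_sub_one ht0.ne', mul_comm 2 α, Real.rpow_mul ht0.le,
      Real.rpow_mul hd.le]
    norm_num
    field_simp
  rw [setLIntegral_congr_fun measurableSet_Ioc (fun t ht => by rw [e t ht])]
  have hi : IntegrableOn (fun t : ℝ => t ^ (2*α - 1)) (Ioc 0 d) := by
    have := (intervalIntegral.intervalIntegrable_rpow' (a := 0) (b := d) (r := 2*α-1) (by linarith))
    rwa [intervalIntegrable_iff_integrableOn_Ioc_of_le hd.le] at this
  rw [← ofReal_integral_eq_lintegral_ofReal (hi.const_mul _)]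
  · rw [integral_const_mul, ← intervalIntegral.integral_of_le hd.le, integral_rpow (by left; linarith)]
    congr 1
    rw [Real.zero_rpow (by linarith)]
    have : 2 * α - 1 + 1 = 2 * α := by ring
    rw [this]
    have : d ^ (2*α) ≠ 0 := (Real.rpow_pos_of_pos hd _).ne'
    field_simp
    simp
  · filter_upwards [ae_restrict_mem measurableSet_Ioc] with t ht
    have ht0 : 0 < t := ht.1
    simp only [Pi.zero_apply]
    positivity

lemma lint_high {β d : ℝ} (hβ : 0 < β) (hd : 0 < d) :
    ∫⁻ t in Ioi d, ENNReal.ofReal (t⁻¹ * ((d / t) ^ β) ^ 2) = ENNReal.ofReal (1 / (2*β)) := by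
  have e : ∀ t ∈ Ioi d, t⁻¹ * ((d / t) ^ β) ^ 2 = (d ^ (2*β)) * t ^ (-(2*β) - 1) := by
    intro t ht
    have ht0 : 0 < t := hd.trans ht
    rw [Real.div_rpow hd.le ht0.le, Real.rpow_sub_one ht0.ne', Real.rpow_neg ht0.le, mul_comm 2 β,
      Real.rpow_mul ht0.le, Real.rpow_mul hd.le]
    norm_num
    field_simp
  rw [setLIntegral_congr_fun measurableSet_Ioi (fun t ht => by rw [e t ht])]
  have hi : IntegrableOn (fun t : ℝ => t ^ (-(2*β) - 1)) (Ioi d) :=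
    integrableOn_Ioi_rpow_of_lt (by linarith) hd
  rw [← ofReal_integral_eq_lintegral_ofReal (hi.const_mul _)]
  · rw [integral_const_mul, integral_Ioi_rpow_of_lt (by linarith) hd]
    congr 1
    have : -(2 * β) - 1 + 1 = -(2 * β) := by ring
    rw [this, Real.rpow_neg hd.le]
    have : d ^ (2*β) ≠ 0 := (Real.rpow_pos_of_pos hd _).ne'
    field_simp
  · filter_upwards [ae_restrict_mem measurableSet_Ioi] with t ht
    have ht0 : 0 < t := hd.trans ht
    simp only [Pi.zero_apply]
    positivity

/-- Basic `L²(dt/t)` bound for two-sided power decay. -/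
lemma eLpNorm_nu_le {E : Type*} [NormedAddCommGroup E] {F : ℝ → E} {S : Set ℝ}
    (hS : MeasurableSet S) {M d α β : ℝ} (hM : 0 ≤ M) (hd : 0 < d) (hα : 0 < α) (hβ : 0 < β)
    (hF : ∀ t ∈ S, 0 < t → ‖F t‖ ≤ M * min ((t / d) ^ α) ((d / t) ^ β)) :
    eLpNorm F 2 (nu.restrict S) ≤ ENNReal.ofReal (M * Real.sqrt (1/(2*α) + 1/(2*β))) := by
  have key : ∫⁻ t in S, ‖F t‖ₑ ^ 2 ∂nu ≤ ENNReal.ofReal (M^2 * (1/(2*α) + 1/(2*β))) := by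
    rw [lintegral_nu_restrict hS]
    calc ∫⁻ t in (Ioi (0:ℝ) ∩ S), ENNReal.ofReal t⁻¹ * ‖F t‖ₑ ^ 2
        ≤ ∫⁻ t in (Ioi (0:ℝ) ∩ S), ENNReal.ofReal (M^2) *
          ENNReal.ofReal (t⁻¹ * (min ((t / d) ^ α) ((d / t) ^ β))^2) := by
          apply setLIntegral_mono' (measurableSet_Ioi.inter hS)
          rintro t ⟨ht, hts⟩
          have ht : 0 < t := ht
          have h1 := hF t hts ht
          rw [← ofReal_norm_eq_enorm, ← ENNReal.ofReal_pow (norm_nonneg _),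
            ← ENNReal.ofReal_mul (by positivity), ← ENNReal.ofReal_mul (by positivity)]
          apply ENNReal.ofReal_le_ofReal
          have := pow_le_pow_left₀ (norm_nonneg _) h1 2
          calc t⁻¹ * ‖F t‖^2 ≤ t⁻¹ * (M * min ((t / d) ^ α) ((d / t) ^ β))^2 := by gcongr
            _ = _ := by ring
      _ ≤ ∫⁻ t in Ioi (0:ℝ), ENNReal.ofReal (M^2) *
          ENNReal.ofReal (t⁻¹ * (min ((t / d) ^ α) ((d / t) ^ β))^2) :=
          lintegral_mono_set inter_subset_left
      _ = ENNReal.ofReal (M^2) * ∫⁻ t in Ioi (0:ℝ),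
          ENNReal.ofReal (t⁻¹ * (min ((t / d) ^ α) ((d / t) ^ β))^2) := by
          rw [lintegral_const_mul' _ _ ENNReal.ofReal_ne_top]
      _ ≤ ENNReal.ofReal (M^2) * (ENNReal.ofReal (1/(2*α)) + ENNReal.ofReal (1/(2*β))) := by
          gcongr
          rw [← Ioc_union_Ioi_eq_Ioi hd.le, ← lint_low hα hd, ← lint_high hβ hd]
          refine (lintegral_union_le _ _ _).trans ?_
          gcongr ?_ + ?_
          · apply setLIntegral_mono' measurableSet_Ioc
            intro t ht
            have ht0 : 0 < t := ht.1
            apply ENNReal.ofReal_le_ofReal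
            gcongr
            exact min_le_left _ _
          · apply setLIntegral_mono' measurableSet_Ioi
            intro t ht
            have ht0 : 0 < t := hd.trans ht
            apply ENNReal.ofReal_le_ofReal
            gcongr
            exact min_le_right _ _
      _ = _ := by
          rw [← ENNReal.ofReal_add (by positivity) (by positivity), ← ENNReal.ofReal_mul (by positivity)]
  rw [eLpNorm_two']
  refine (ENNReal.rpow_le_rpow key (by norm_num)).trans ?_
  rw [ENNReal.ofReal_rpow_of_nonneg (by positivity) (by norm_num), ← Real.sqrt_eq_rpow,
    Real.sqrt_mul (by positivity), Real.sqrt_sq hM]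

instance : SFinite nu := by unfold nu; infer_instance

lemma PsiKernel.measurable {C₁ C₂ δ γ : ℝ} (hγ : 0 < γ) {ψ : Rn n → ℝ}
    (hψ : PsiKernel n C₁ C₂ δ γ ψ) : Measurable ψ := by
  apply measurable_of_continuousOn_compl_singleton 0
  intro x hx
  apply ContinuousAt.continuousWithinAt
  have hx : 0 < ‖x‖ := norm_pos_iff.2 hx
  have h3 := hψ.2.2.2 x
  rw [Metric.continuousAt_iff']
  intro ε hε
  have lim : Filter.Tendsto (fun y : Rn n => C₂ * ‖y - x‖ ^ γ * (1 + ‖x‖) ^ (-((n : ℝ) + δ + γ)))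
      (nhds x) (nhds 0) := by
    have : Continuous (fun y : Rn n => C₂ * ‖y - x‖ ^ γ * (1 + ‖x‖) ^ (-((n : ℝ) + δ + γ))) := by
      refine (continuous_const.mul ?_).mul continuous_const
      exact (continuous_norm.comp (continuous_id.sub continuous_const)).rpow_const
        (fun _ => Or.inr hγ.le)
    have h := this.tendsto x
    simpa [Real.zero_rpow hγ.ne'] using h
  filter_upwards [lim.eventually_lt_const hε, Metric.ball_mem_nhds x (half_pos hx)] with y hy hy2
  have hy2 : 2 * ‖y - x‖ ≤ ‖x‖ := by
    rw [mem_ball, dist_eq_norm] at hy2; linarith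
  have := h3 (y - x) hy2
  rw [add_sub_cancel] at this
  rw [Real.dist_eq]
  exact this.trans_lt hy

lemma cvl_congr {ψ f g : Rn n → ℝ} (h : f =ᵐ[volume] g) (t : ℝ) (x : Rn n) :
    cvl ψ t f x = cvl ψ t g x := by
  unfold cvl
  apply integral_congr_ae
  filter_upwards [h] with y hy
  rw [hy]

lemma Gs_congr {ψ f g : Rn n → ℝ} (h : f =ᵐ[volume] g) (S : Set ℝ) (x : Rn n) :
    Gs ψ S f x = Gs ψ S g x := by
  unfold Gs; simp_rw [cvl_congr h]

lemma measurable_cvl {ψ f : Rn n → ℝ} (hψ : Measurable ψ) (hf : AEStronglyMeasurable f volume) :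
    Measurable (fun p : Rn n × ℝ => cvl ψ p.2 f p.1) := by
  have e : (fun p : Rn n × ℝ => cvl ψ p.2 f p.1) = fun p => cvl ψ p.2 (hf.mk f) p.1 := by
    ext p; exact cvl_congr hf.ae_eq_mk _ _
  rw [e]
  have hm : Measurable (hf.mk f) := hf.stronglyMeasurable_mk.measurable
  unfold cvl
  have : Measurable (fun q : (Rn n × ℝ) × Rn n =>
      (q.1.2 ^ n)⁻¹ * ψ (q.1.2⁻¹ • (q.1.1 - q.2)) * (hf.mk f) q.2) := by
    refine Measurable.mul (Measurable.mul (by fun_prop) (hψ.comp (by fun_prop))) (by fun_prop)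
  exact (this.stronglyMeasurable.integral_prod_right (ν := volume)).measurable

lemma measurable_cvl_t {ψ f : Rn n → ℝ} (hψ : Measurable ψ) (hf : AEStronglyMeasurable f volume)
    (x : Rn n) : Measurable (fun t : ℝ => cvl ψ t f x) :=
  (measurable_cvl hψ hf).comp (by fun_prop : Measurable fun t : ℝ => (x, t))

lemma measurable_cvl_x {ψ f : Rn n → ℝ} (hψ : Measurable ψ) (hf : AEStronglyMeasurable f volume)
    (t : ℝ) : Measurable (fun x => cvl ψ t f x) :=
  (measurable_cvl hψ hf).comp (by fun_prop : Measurable fun x : Rn n => (x, t))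

lemma measurable_Gs {ψ f : Rn n → ℝ} (hψ : Measurable ψ) (hf : AEStronglyMeasurable f volume)
    (S : Set ℝ) : Measurable (Gs ψ S f) := by
  unfold Gs
  simp_rw [eLpNorm_two']
  apply Measurable.pow_const
  exact Measurable.lintegral_prod_right' (f := fun p : Rn n × ℝ => ‖cvl ψ p.2 f p.1‖ₑ ^ 2)
    ((measurable_cvl hψ hf).enorm.pow_const 2)

section fourierPart
open scoped FourierTransform SchwartzMap

lemma plancherel {g : Rn n → ℂ} (h1 : Integrable g) (h2 : MemLp g 2) :
    eLpNorm (𝓕 g) 2 volume = eLpNorm g 2 volume := by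
  set G : Lp ℂ 2 (volume : Measure (Rn n)) := h2.toLp g with hG
  have hcont : Continuous (𝓕 g) :=
    VectorFourier.fourierIntegral_continuous Real.continuous_fourierChar
      (by exact continuous_inner) h1
  have hae : ∀ᵐ x, (𝓕 G : Lp ℂ 2 (volume : Measure (Rn n))) x = 𝓕 g x := by
    apply ae_eq_of_integral_contDiff_smul_eq
    · exact (Lp.memLp _).locallyIntegrable (by norm_num)
    · exact hcont.locallyIntegrable
    intro φ hφ hφc
    have hcd : ContDiff ℝ (⊤ : ℕ∞) (fun x => (φ x : ℂ)) := Complex.ofRealCLM.contDiff.comp hφ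
    have hcs : HasCompactSupport (fun x => (φ x : ℂ)) := hφc.comp_left (g := fun r : ℝ => (r : ℂ)) rfl
    set Φ : 𝓢(Rn n, ℂ) := hcs.toSchwartzMap hcd with hΦ
    have hΦx : ∀ x, Φ x = (φ x : ℂ) := fun x => rfl
    have e1 := congrArg (fun T => T Φ) (Lp.fourier_toTemperedDistribution_eq G)
    simp only [TemperedDistribution.fourier_apply, Lp.toTemperedDistribution_apply] at e1
    have e2 : ∫ x, (𝓕 Φ) x • G x = ∫ x, (𝓕 Φ) x • g x := by
      apply integral_congr_ae
      filter_upwards [h2.coeFn_toLp] with x hx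
      rw [hG, hx]
    have e3 : ∫ x, (𝓕 Φ) x • g x = ∫ x, Φ x • 𝓕 g x := by
      rw [SchwartzMap.fourier_coe]
      have := VectorFourier.integral_fourierIntegral_smul_eq_flip (L := innerₗ (Rn n))
        Real.continuous_fourierChar (by exact continuous_inner) (Φ.integrable (μ := volume)) h1
      rw [flip_innerₗ] at this
      exact this
    have e4 : ∀ u : Rn n → ℂ, ∫ x, φ x • u x = ∫ x, Φ x • u x := by
      intro u; congr 1
    rw [e4, e4, ← e1, e2, e3]
  calc eLpNorm (𝓕 g) 2 volume = eLpNorm (𝓕 G : Lp ℂ 2 (volume : Measure (Rn n))) 2 volume :=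
        (eLpNorm_congr_ae hae).symm
    _ = ‖(𝓕 G : Lp ℂ 2 (volume : Measure (Rn n)))‖ₑ := (Lp.enorm_def _).symm
    _ = ‖G‖ₑ := by
        rw [← ofReal_norm, ← ofReal_norm, Lp.norm_fourier_eq]
    _ = _ := by rw [hG, Lp.enorm_toLp]

lemma finrank_Rn : Module.finrank ℝ (Rn n) = n := by simp

lemma integrable_bracket {r : ℝ} (hr : (n:ℝ) < r) :
    Integrable (fun x : Rn n => (1 + ‖x‖) ^ (-r)) volume :=
  integrable_one_add_norm (by rw [finrank_Rn]; exact hr)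

/-- Fourier decay near zero -/
lemma fourier_low {C₁ C₂ δ γ : ℝ} (hδ : 0 < δ) {ψ : Rn n → ℝ}
    (hψ : PsiKernel n C₁ C₂ δ γ ψ) : ∃ α C : ℝ, 0 < α ∧ 0 ≤ C ∧
      ∀ ξ : Rn n, ‖𝓕 (fun x => (ψ x : ℂ)) ξ‖ ≤ C * ‖ξ‖ ^ α := by
  obtain ⟨h1, h0, h2, -⟩ := hψ
  set α := min (δ/2) 1 with hα
  have hα0 : 0 < α := lt_min (by linarith) one_pos
  have hα1 : α ≤ 1 := min_le_right _ _
  have hαδ : α ≤ δ/2 := min_le_left _ _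
  have hI : Integrable (fun x : Rn n => ‖ψ x‖ * (1 + ‖x‖) ^ α) := by
    refine ((integrable_bracket (n := n) (r := n + δ - α) (by linarith)).const_mul C₁).mono'
      (h1.1.norm.mul (Measurable.aestronglyMeasurable (Measurable.pow_const (by fun_prop) _))) (Filter.Eventually.of_forall fun x => ?_)
    have hp : 0 < 1 + ‖x‖ := by positivity
    rw [Real.norm_of_nonneg (by positivity)]
    calc ‖ψ x‖ * (1 + ‖x‖)^α ≤ C₁ * (1 + ‖x‖) ^ (-((n : ℝ) + δ)) * (1 + ‖x‖)^α := by
          gcongr; exact h2 x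
      _ = C₁ * (1 + ‖x‖) ^ (-((n:ℝ) + δ - α)) := by
          rw [mul_assoc, ← Real.rpow_add hp]; congr 2; ring
  refine ⟨α, 2 * (2 * Real.pi)^α * ∫ x, ‖ψ x‖ * (1 + ‖x‖) ^ α, hα0,
    mul_nonneg (by positivity) (integral_nonneg fun x => by positivity), fun ξ => ?_⟩
  have e : 𝓕 (fun x => (ψ x : ℂ)) ξ = ∫ v, ((Real.fourierChar (-inner ℝ v ξ) : ℂ) - 1) * (ψ v : ℂ) := by
    rw [Real.fourier_eq]
    have : ∫ v, (ψ v : ℂ) = 0 := by rw [integral_complex_ofReal, h0]; simp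
    simp_rw [sub_mul, one_mul]
    rw [integral_sub, this, sub_zero]
    · rfl
    · exact (Real.fourierIntegral_convergent_iff ξ).2 h1.ofReal
    · exact h1.ofReal
  rw [e]
  refine (norm_integral_le_of_norm_le (hI.const_mul (2 * (2 * Real.pi)^α * ‖ξ‖^α))
    (Filter.Eventually.of_forall fun v => ?_)).trans_eq ?_
  · rw [norm_mul, Complex.norm_real]
    set θ := 2 * Real.pi * (-inner ℝ v ξ) with hθ
    have e1 : (Real.fourierChar (-inner ℝ v ξ) : ℂ) = Complex.exp (Complex.I * (θ : ℝ)) := by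
      rw [Real.fourierChar_apply, mul_comm]
    have b1 : ‖(Real.fourierChar (-inner ℝ v ξ) : ℂ) - 1‖ ≤ |θ| := by
      rw [e1]; exact Real.norm_exp_I_mul_ofReal_sub_one_le
    have b2 : ‖(Real.fourierChar (-inner ℝ v ξ) : ℂ) - 1‖ ≤ 2 := by
      refine (norm_sub_le _ _).trans ?_
      rw [Circle.norm_coe]; norm_num
    have b3 : ‖(Real.fourierChar (-inner ℝ v ξ) : ℂ) - 1‖ ≤ 2 * |θ| ^ α := by
      rcases le_total |θ| 1 with h | h
      · have : |θ| ≤ |θ|^α := by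
          rcases (abs_nonneg θ).eq_or_lt with h' | h'
          · rw [← h', Real.zero_rpow hα0.ne']
          · conv_lhs => rw [← Real.rpow_one |θ|]
            exact Real.rpow_le_rpow_of_exponent_ge h' h hα1
        have : 0 ≤ |θ|^α := by positivity
        linarith
      · have : 1 ≤ |θ|^α := Real.one_le_rpow h hα0.le
        linarith
    have b4 : |θ| ≤ 2 * Real.pi * ‖ξ‖ * (1 + ‖v‖) := by
      rw [hθ, abs_mul, abs_neg, abs_of_nonneg (by positivity)]
      have := abs_real_inner_le_norm v ξ
      calc 2 * Real.pi * |inner ℝ v ξ| ≤ 2 * Real.pi * (‖v‖ * ‖ξ‖) := by gcongr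
        _ ≤ 2 * Real.pi * ((1 + ‖v‖) * ‖ξ‖) := by gcongr; linarith
        _ = _ := by ring
    calc _ ≤ 2 * (2 * Real.pi * ‖ξ‖ * (1 + ‖v‖)) ^ α * ‖ψ v‖ := by
          gcongr; exact b3.trans (by gcongr)
      _ = _ := by
        rw [Real.mul_rpow (by positivity) (by positivity), Real.mul_rpow (by positivity) (by positivity)]
        ring
  · rw [integral_const_mul]; ring

lemma vol_ball_toReal (hn : 1 ≤ n) (c : Rn n) {r : ℝ} (hr : 0 ≤ r) :
    (volume (ball c r)).toReal = r ^ n * (volume (ball (0 : Rn n) 1)).toReal := by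
  have : Nonempty (Fin n) := ⟨⟨0, hn⟩⟩
  have : Nontrivial (Rn n) := by
    unfold Rn; infer_instance
  rw [Measure.addHaar_ball _ _ hr, finrank_Rn, ENNReal.toReal_mul, ENNReal.toReal_ofReal (by positivity)]

lemma bracket_le_one {s : ℝ} (hs : 0 ≤ s) (x : Rn n) : (1 + ‖x‖) ^ (-s) ≤ 1 :=
  Real.rpow_le_one_of_one_le_of_nonpos (by linarith [norm_nonneg x]) (by linarith)

lemma fourier_high_aux {X C₁ C₂ J V P q a b : ℝ} (h : X ≤ C₂ * a * J + b * V * (2 * C₁))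
    (hC₁ : 0 ≤ C₁) (hC₂ : 0 ≤ C₂) (hJ : 0 ≤ J) (hV : 0 ≤ V) (hP : 0 ≤ P) (hq : 0 ≤ q)
    (ha : a ≤ q) (hb : b ≤ q) : X ≤ (P + (C₂ * J + 2 * C₁ * V)) * q := by
  calc _ ≤ _ := h
    _ ≤ C₂ * q * J + q * V * (2 * C₁) := by gcongr
    _ = (C₂ * J + 2 * C₁ * V) * q := by ring
    _ ≤ _ := mul_le_mul_of_nonneg_right (by linarith) hq

/-- Fourier decay at infinity -/
lemma fourier_high (hn : 1 ≤ n) {C₁ C₂ δ γ : ℝ} (hC₁ : 0 < C₁) (hC₂ : 0 < C₂)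
    (hδ : 0 < δ) (hγ : 0 < γ) {ψ : Rn n → ℝ}
    (hψ : PsiKernel n C₁ C₂ δ γ ψ) : ∃ β C : ℝ, 0 < β ∧ 0 ≤ C ∧
      ∀ ξ : Rn n, ξ ≠ 0 → ‖𝓕 (fun x => (ψ x : ℂ)) ξ‖ ≤ C * (1/‖ξ‖) ^ β := by
  obtain ⟨h1, h0, h2, h3⟩ := hψ
  set β := min γ 1 with hβ
  have hβ0 : 0 < β := lt_min hγ one_pos
  have hβ1 : β ≤ 1 := min_le_right _ _
  have hβγ : β ≤ γ := min_le_left _ _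
  set V := (volume (ball (0 : Rn n) 1)).toReal with hV
  have hV0 : 0 ≤ V := ENNReal.toReal_nonneg
  have hI := integrable_bracket (n := n) (r := n + δ + γ) (by linarith)
  set J := ∫ x : Rn n, (1 + ‖x‖) ^ (-((n:ℝ) + δ + γ)) with hJ
  have hJ0 : 0 ≤ J := integral_nonneg fun x => by positivity
  clear_value β J V
  have hP0 : 0 ≤ ∫ x, ‖ψ x‖ := integral_nonneg fun x => by positivity
  refine ⟨β, (∫ x, ‖ψ x‖) + (C₂ * J + 2 * C₁ * V), hβ0, add_nonneg hP0 (add_nonneg (mul_nonneg hC₂.le hJ0) (mul_nonneg (mul_nonneg zero_le_two hC₁.le) hV0)), fun ξ hξ => ?_⟩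
  have hξ0 : 0 < ‖ξ‖ := norm_pos_iff.2 hξ
  rcases le_total ‖ξ‖ 1 with hle | hge
  · have b : ‖𝓕 (fun x => (ψ x : ℂ)) ξ‖ ≤ ∫ x, ‖ψ x‖ := by
      have := VectorFourier.norm_fourierIntegral_le_integral_norm Real.fourierChar volume
        (innerₗ (Rn n)) (fun x => (ψ x : ℂ)) ξ
      simp only [Complex.norm_real] at this
      exact this
    have : 1 ≤ (1/‖ξ‖)^β := Real.one_le_rpow (by rw [le_div_iff₀ hξ0]; linarith) hβ0.le
    have hcc : 0 ≤ C₂ * J + 2 * C₁ * V := add_nonneg (mul_nonneg hC₂.le hJ0) (mul_nonneg (mul_nonneg zero_le_two hC₁.le) hV0)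
    calc _ ≤ _ := b
      _ ≤ ((∫ x, ‖ψ x‖) + (C₂ * J + 2 * C₁ * V)) * 1 := by linarith
      _ ≤ _ := by gcongr
  · set h : Rn n := (1 / (2 * ‖ξ‖ ^ 2) : ℝ) • ξ with hh
    have hnorm : ‖h‖ = 1 / (2 * ‖ξ‖) := by
      rw [hh, norm_smul, Real.norm_of_nonneg (by positivity)]; field_simp
    have h1c : Integrable (fun x => (ψ x : ℂ)) := h1.ofReal
    have e : ∫ v, Real.fourierChar (-inner ℝ v ξ) • (ψ v : ℂ) =
        (1 / (2 : ℂ)) • ∫ v, Real.fourierChar (-inner ℝ v ξ) • ((ψ v : ℂ) - (ψ (v + h) : ℂ)) := by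
      have := fourierIntegral_eq_half_sub_half_period_translate hξ h1c
      have e' : h = (1 / (2 * ‖ξ‖ ^ 2) : ℝ) • ξ := hh
      rw [e']
      exact this
    clear_value h
    have b : ‖𝓕 (fun x => (ψ x : ℂ)) ξ‖ ≤ ∫ v, ‖ψ (v + h) - ψ v‖ := by
      rw [Real.fourier_eq, e, norm_smul]
      have : ‖∫ v, Real.fourierChar (-inner ℝ v ξ) • ((ψ v : ℂ) - (ψ (v + h) : ℂ))‖
          ≤ ∫ v, ‖ψ (v + h) - ψ v‖ := by
        refine (norm_integral_le_integral_norm _).trans_eq ?_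
        congr 1; ext v
        rw [Circle.norm_smul, ← Complex.ofReal_sub, Complex.norm_real, norm_sub_rev]
      have hnn : 0 ≤ ∫ v, ‖ψ (v + h) - ψ v‖ := integral_nonneg fun x => by positivity
      refine (mul_le_mul_of_nonneg_left this (norm_nonneg _)).trans ?_
      have : ‖(1/2:ℂ)‖ = 1/2 := by simp
      rw [this]; linarith
    have b2 : ∫ v, ‖ψ (v + h) - ψ v‖ ≤ ∫ v, (C₂ * ‖h‖^γ * (1 + ‖v‖) ^ (-((n:ℝ) + δ + γ))
        + (ball (0 : Rn n) (2 * ‖h‖)).indicator (fun _ => 2 * C₁) v) := by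
      apply integral_mono_of_nonneg (Filter.Eventually.of_forall fun v => norm_nonneg _)
      · refine (hI.const_mul _).add ?_
        rw [integrable_indicator_iff measurableSet_ball]
        exact integrableOn_const (by exact measure_ball_lt_top.ne)
      · refine Filter.Eventually.of_forall fun v => ?_
        by_cases hv : 2 * ‖h‖ ≤ ‖v‖
        · have : (ball (0 : Rn n) (2 * ‖h‖)).indicator (fun _ => 2 * C₁) v = 0 := by
            apply indicator_of_notMem; simpa using hv
          simp only [this, add_zero]
          exact h3 v h hv
        · have : (ball (0 : Rn n) (2 * ‖h‖)).indicator (fun _ => 2 * C₁) v = 2 * C₁ := by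
            apply indicator_of_mem; simpa using hv
          simp only [this]
          have b1 := h2 v
          have b2 := h2 (v + h)
          have c1 := mul_le_mul_of_nonneg_left (bracket_le_one (s := n + δ) (by positivity) v) hC₁.le
          have c2 := mul_le_mul_of_nonneg_left (bracket_le_one (s := n + δ) (by positivity) (v + h)) hC₁.le
          have := norm_sub_le (ψ (v+h)) (ψ v)
          simp only [Real.norm_eq_abs] at this ⊢
          have : 0 ≤ C₂ * ‖h‖^γ * (1 + ‖v‖) ^ (-((n:ℝ) + δ + γ)) := by positivity
          linarith
    rw [integral_add (hI.const_mul _) (by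
        rw [integrable_indicator_iff measurableSet_ball]
        exact integrableOn_const (by exact measure_ball_lt_top.ne)), integral_const_mul,
      integral_indicator_const _ measurableSet_ball, smul_eq_mul, Measure.real,
      vol_ball_toReal hn _ (by positivity)] at b2
    have hq : 1/‖ξ‖ ≤ 1 := by rw [div_le_one hξ0]; exact hge
    have hq0 : 0 < 1/‖ξ‖ := by positivity
    have p1 : ‖h‖^γ ≤ (1/‖ξ‖)^β := by
      calc ‖h‖^γ ≤ (1/‖ξ‖)^γ := by
            apply Real.rpow_le_rpow (norm_nonneg _) _ hγ.le
            rw [hnorm]; gcongr; linarith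
        _ ≤ _ := Real.rpow_le_rpow_of_exponent_ge hq0 hq hβγ
    have p2 : (2 * ‖h‖)^n ≤ (1/‖ξ‖)^β := by
      have : 2 * ‖h‖ = 1/‖ξ‖ := by rw [hnorm]; field_simp
      rw [this, ← Real.rpow_natCast]
      apply Real.rpow_le_rpow_of_exponent_ge hq0 hq
      have : (1:ℝ) ≤ n := by exact_mod_cast hn
      linarith
    have hb0 : 0 ≤ (1/‖ξ‖)^β := by positivity
    rw [← hJ, ← hV] at b2
    refine fourier_high_aux (b.trans b2) hC₁.le hC₂.le hJ0 hV0 hP0 hb0 p1 p2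

/-- The dilated kernel. -/
def kt (ψ : Rn n → ℝ) (t : ℝ) (z : Rn n) : ℝ := (t ^ n)⁻¹ * ψ (t⁻¹ • z)

lemma integrable_kt {ψ : Rn n → ℝ} (h1 : Integrable ψ) {t : ℝ} (ht : 0 < t) :
    Integrable (kt ψ t) := by
  unfold kt
  exact ((integrable_comp_smul_iff volume ψ (inv_ne_zero ht.ne')).2 h1).const_mul _

lemma integral_kt {ψ : Rn n → ℝ} {t : ℝ} (ht : 0 < t) :
    ∫ z, kt ψ t z = ∫ z, ψ z := by
  unfold kt
  rw [integral_const_mul, Measure.integral_comp_inv_smul_of_nonneg _ _ ht.le, finrank_Rn, smul_eq_mul,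
    inv_mul_cancel_left₀ (by positivity)]

lemma fourier_kt {ψ : Rn n → ℝ} {t : ℝ} (ht : 0 < t) (ξ : Rn n) :
    𝓕 (fun z => (kt ψ t z : ℂ)) ξ = 𝓕 (fun x => (ψ x : ℂ)) (t • ξ) := by
  rw [Real.fourier_eq, Real.fourier_eq]
  have := Measure.integral_comp_inv_smul_of_nonneg (volume : Measure (Rn n))
    (fun v => Real.fourierChar (-inner ℝ v (t • ξ)) • (ψ v : ℂ)) ht.le
  rw [finrank_Rn] at this
  rw [← inv_smul_eq_iff₀ (by positivity)] at this
  rw [← this, ← integral_smul]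
  congr 1; ext v
  have e : inner ℝ (t⁻¹ • v) (t • ξ) = inner ℝ v ξ := by
    rw [inner_smul_left, inner_smul_right]; simp; field_simp
  rw [e, kt, smul_comm]
  congr 1
  rw [Complex.real_smul]; push_cast; ring

lemma kt_bound {C₁ δ : ℝ} (hC₁ : 0 < C₁) (hδ : 0 < δ) {ψ : Rn n → ℝ}
    (h2 : ∀ x : Rn n, |ψ x| ≤ C₁ * (1 + ‖x‖) ^ (-((n : ℝ) + δ))) {t : ℝ} (ht : 0 < t) (z : Rn n) :
    |kt ψ t z| ≤ (t^n)⁻¹ * C₁ := by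
  unfold kt
  rw [abs_mul, abs_of_nonneg (by positivity)]
  gcongr
  refine (h2 _).trans ?_
  exact mul_le_of_le_one_right hC₁.le (bracket_le_one (by positivity) _)

lemma cvl_eq_kt (ψ f : Rn n → ℝ) (t : ℝ) (x : Rn n) : cvl ψ t f x = ∫ y, kt ψ t (x - y) * f y := rfl

/-- Plancherel for `ψ_t * g`. -/
lemma lintegral_cvl_sq {C₁ C₂ δ γ : ℝ} (hC₁ : 0 < C₁) (hδ : 0 < δ) {ψ : Rn n → ℝ}
    (hψ : PsiKernel n C₁ C₂ δ γ ψ) {g : Rn n → ℝ} (hg : Integrable g) {t : ℝ} (ht : 0 < t) :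
    ∫⁻ x, ‖cvl ψ t g x‖ₑ ^ 2 =
      ∫⁻ ξ, ‖𝓕 (fun x => (ψ x : ℂ)) (t • ξ)‖ₑ ^ 2 * ‖𝓕 (fun x => (g x : ℂ)) ξ‖ₑ ^ 2 := by
  obtain ⟨h1, h0, h2, h3⟩ := hψ
  have hk : Integrable (fun z => (kt ψ t z : ℂ)) := (integrable_kt h1 ht).ofReal
  have hgc : Integrable (fun x => (g x : ℂ)) := hg.ofReal
  set u : Rn n → ℂ := convolution (fun z => (kt ψ t z : ℂ)) (fun x => (g x : ℂ))
    (ContinuousLinearMap.mul ℂ ℂ) volume with hu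
  have hux : ∀ x, u x = (cvl ψ t g x : ℂ) := by
    intro x
    rw [hu, convolution_mul_swap, cvl_eq_kt, ← integral_complex_ofReal]
    simp
  have hui : Integrable u := hk.integrable_convolution _ hgc
  have hub : ∀ x, ‖u x‖ ≤ (t^n)⁻¹ * C₁ * ∫ y, ‖g y‖ := by
    intro x
    rw [hux, Complex.norm_real, cvl_eq_kt, ← integral_const_mul]
    apply norm_integral_le_of_norm_le (hg.norm.const_mul _)
    refine Filter.Eventually.of_forall fun y => ?_
    rw [norm_mul]
    gcongr
    exact kt_bound hC₁ hδ h2 ht _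
  have hu2 : MemLp u 2 := by
    rw [memLp_two_iff_integrable_sq_norm hui.1]
    refine (hui.norm.const_mul ((t^n)⁻¹ * C₁ * ∫ y, ‖g y‖)).mono' (hui.1.norm.pow 2)
      (Filter.Eventually.of_forall fun x => ?_)
    rw [Real.norm_of_nonneg (by positivity), sq]
    gcongr
    exact hub x
  have hP := congrArg (· ^ 2) (plancherel hui hu2)
  simp only [eLpNorm_two_sq] at hP
  calc ∫⁻ x, ‖cvl ψ t g x‖ₑ ^ 2 = ∫⁻ x, ‖u x‖ₑ ^ 2 := by
        congr 1; ext x; rw [hux, ← ofReal_norm, ← ofReal_norm, Complex.norm_real]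
    _ = _ := hP.symm
    _ = _ := by
      congr 1; ext ξ
      rw [hu, Real.fourier_mul_convolution_eq hk hgc]
      have := fourier_kt (ψ := ψ) ht ξ
      rw [this, enorm_mul, mul_pow]

/-- `L²` boundedness of the `g`-function. -/
lemma L2_bound (hn : 1 ≤ n) {C₁ C₂ δ γ : ℝ} (hC₁ : 0 < C₁) (hC₂ : 0 < C₂)
    (hδ : 0 < δ) (hγ : 0 < γ) {ψ : Rn n → ℝ} (hψ : PsiKernel n C₁ C₂ δ γ ψ) :
    ∃ C : ℝ, 0 ≤ C ∧ ∀ g : Rn n → ℝ, Integrable g → MemLp g 2 →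
      ∫⁻ x, (Gs ψ univ g x) ^ 2 ≤ ENNReal.ofReal C * ∫⁻ x, ‖g x‖ₑ ^ 2 := by
  obtain ⟨α, A, hα, hA, hlow⟩ := fourier_low hδ hψ
  obtain ⟨β, B, hβ, hB, hhigh⟩ := fourier_high hn hC₁ hC₂ hδ hγ hψ
  set K := (max A B * Real.sqrt (1/(2*α) + 1/(2*β))) with hK
  refine ⟨K^2, by positivity, fun g hg hg2 => ?_⟩
  have hψm := hψ.measurable hγ
  have hψhat : Continuous (𝓕 (fun x => (ψ x : ℂ))) :=
    VectorFourier.fourierIntegral_continuous Real.continuous_fourierChar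
      (by exact continuous_inner) hψ.1.ofReal
  have hgc : Integrable (fun x => (g x : ℂ)) := hg.ofReal
  have hghat : Continuous (𝓕 (fun x => (g x : ℂ))) :=
    VectorFourier.fourierIntegral_continuous Real.continuous_fourierChar
      (by exact continuous_inner) hgc
  have step : ∀ ξ : Rn n, ξ ≠ 0 → ∫⁻ t, ‖𝓕 (fun x => (ψ x : ℂ)) (t • ξ)‖ₑ ^ 2 ∂nu ≤ ENNReal.ofReal (K^2) := by
    intro ξ hξ
    have hξ0 : 0 < ‖ξ‖ := norm_pos_iff.2 hξ
    have := eLpNorm_nu_le (F := fun t : ℝ => 𝓕 (fun x => (ψ x : ℂ)) (t • ξ)) (S := univ) .univ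
      (M := max A B) (d := 1/‖ξ‖) (α := α) (β := β) (by positivity) (by positivity) hα hβ (by
        intro t _ ht
        have e1 : t / (1/‖ξ‖) = ‖t • ξ‖ := by
          rw [norm_smul, Real.norm_of_nonneg ht.le]; field_simp
        have e2 : (1/‖ξ‖) / t = 1/‖t • ξ‖ := by
          rw [norm_smul, Real.norm_of_nonneg ht.le]; field_simp
        rw [e1, e2, mul_min_of_nonneg _ _ (by positivity)]
        apply le_min
        · refine (hlow _).trans ?_
          gcongr; exact le_max_left _ _
        · refine (hhigh _ (smul_ne_zero ht.ne' hξ)).trans ?_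
          gcongr; exact le_max_right _ _)
    rw [Measure.restrict_univ] at this
    have := pow_le_pow_left' this 2
    rwa [eLpNorm_two_sq, ← ENNReal.ofReal_pow (by positivity)] at this
  have nuae : ∀ᵐ t ∂nu, 0 < t := by
    have : ∀ᵐ t ∂(volume.restrict (Ioi (0:ℝ))), 0 < t := ae_restrict_mem measurableSet_Ioi
    exact (withDensity_absolutelyContinuous _ _).ae_le this
  have hnt : Nonempty (Fin n) := ⟨⟨0, hn⟩⟩
  have hnt : Nontrivial (Rn n) := by unfold Rn; infer_instance
  calc ∫⁻ x, (Gs ψ univ g x) ^ 2 = ∫⁻ x, ∫⁻ t, ‖cvl ψ t g x‖ₑ ^ 2 ∂nu := by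
        simp_rw [Gs, Measure.restrict_univ, eLpNorm_two_sq]
    _ = ∫⁻ t, (∫⁻ x, ‖cvl ψ t g x‖ₑ ^ 2) ∂nu := by
        rw [lintegral_lintegral_swap]
        exact ((measurable_cvl hψm hg.1).enorm.pow_const 2).aemeasurable
    _ = ∫⁻ t, (∫⁻ ξ, ‖𝓕 (fun x => (ψ x : ℂ)) (t • ξ)‖ₑ ^ 2 * ‖𝓕 (fun x => (g x : ℂ)) ξ‖ₑ ^ 2) ∂nu := by
        apply lintegral_congr_ae
        filter_upwards [nuae] with t ht
        exact lintegral_cvl_sq hC₁ hδ hψ hg ht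
    _ = ∫⁻ ξ, (∫⁻ t, ‖𝓕 (fun x => (ψ x : ℂ)) (t • ξ)‖ₑ ^ 2 * ‖𝓕 (fun x => (g x : ℂ)) ξ‖ₑ ^ 2 ∂nu) := by
        rw [lintegral_lintegral_swap]
        apply Measurable.aemeasurable
        refine Measurable.mul (f := fun p : ℝ × Rn n => ‖𝓕 (fun x => (ψ x : ℂ)) (p.1 • p.2)‖ₑ ^ 2)
          (g := fun p : ℝ × Rn n => ‖𝓕 (fun x => (g x : ℂ)) p.2‖ₑ ^ 2) ?_ ?_
        · exact ((hψhat.comp (by fun_prop : Continuous fun p : ℝ × Rn n => p.1 • p.2)).measurable).enorm.pow_const 2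
        · exact ((hghat.comp continuous_snd).measurable).enorm.pow_const 2
    _ = ∫⁻ ξ, (∫⁻ t, ‖𝓕 (fun x => (ψ x : ℂ)) (t • ξ)‖ₑ ^ 2 ∂nu) * ‖𝓕 (fun x => (g x : ℂ)) ξ‖ₑ ^ 2 := by
        congr 1; ext ξ
        rw [lintegral_mul_const]
        exact ((hψhat.comp (by fun_prop : Continuous fun t : ℝ => t • ξ)).measurable).enorm.pow_const 2
    _ ≤ ∫⁻ ξ, ENNReal.ofReal (K^2) * ‖𝓕 (fun x => (g x : ℂ)) ξ‖ₑ ^ 2 := by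
        apply lintegral_mono_ae
        have : ∀ᵐ ξ : Rn n, ξ ≠ 0 := by simp [ae_iff]
        filter_upwards [this] with ξ hξ
        gcongr
        exact step ξ hξ
    _ = ENNReal.ofReal (K^2) * ∫⁻ x, ‖g x‖ₑ ^ 2 := by
        rw [lintegral_const_mul' _ _ ENNReal.ofReal_ne_top]
        congr 1
        have hP := congrArg (· ^ 2) (plancherel (g := fun x => (g x : ℂ)) hgc hg2.ofReal)
        simp only [eLpNorm_two_sq] at hP
        rw [hP]
        congr 1; ext x; rw [← ofReal_norm, ← ofReal_norm, Complex.norm_real]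

end fourierPart

/-- The constant `∫ (1+|x|)^{-n-η}`. -/
def JJ (n : ℕ) (η : ℝ) : ℝ := ∫ x : Rn n, (1 + ‖x‖) ^ (-((n:ℝ) + η))

lemma JJ_nonneg (η : ℝ) : 0 ≤ JJ n η := integral_nonneg fun x => by positivity

lemma bracket_scale {r : ℝ} (hr : 0 < r) (s : ℝ) (z : Rn n) :
    (r + ‖z‖) ^ s = r ^ s * (1 + ‖r⁻¹ • z‖) ^ s := by
  rw [← Real.mul_rpow hr.le (by positivity), norm_smul, norm_inv, Real.norm_of_nonneg hr.le]
  congr 1; field_simp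

lemma integrable_bracket_r {η r : ℝ} (hη : 0 < η) (hr : 0 < r) (c : Rn n) :
    Integrable (fun y : Rn n => (r + ‖y - c‖) ^ (-((n:ℝ) + η))) := by
  simp_rw [bracket_scale hr]
  refine Integrable.const_mul ?_ _
  have h := integrable_bracket (n := n) (r := n + η) (by linarith)
  exact ((integrable_comp_smul_iff volume _ (inv_ne_zero hr.ne')).2 h).comp_sub_right c

lemma integral_bracket_r {η r : ℝ} (hr : 0 < r) (c : Rn n) :
    ∫ y : Rn n, (r + ‖y - c‖) ^ (-((n:ℝ) + η)) = r ^ (-η) * JJ n η := by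
  simp_rw [bracket_scale hr]
  rw [integral_const_mul, integral_sub_right_eq_self
    (fun y : Rn n => (1 + ‖r⁻¹ • y‖) ^ (-((n:ℝ) + η))),
    Measure.integral_comp_inv_smul_of_nonneg _ (fun y : Rn n => (1 + ‖y‖) ^ (-((n:ℝ) + η))) hr.le,
    finrank_Rn, smul_eq_mul, ← mul_assoc, ← Real.rpow_natCast, ← Real.rpow_add hr]
  congr 2; ring

lemma kt_le {C₁ δ : ℝ} {ψ : Rn n → ℝ}
    (h2 : ∀ x : Rn n, |ψ x| ≤ C₁ * (1 + ‖x‖) ^ (-((n : ℝ) + δ))) {t : ℝ} (ht : 0 < t) (z : Rn n) :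
    |kt ψ t z| ≤ C₁ * t ^ δ * (t + ‖z‖) ^ (-((n:ℝ) + δ)) := by
  unfold kt
  rw [abs_mul, abs_of_nonneg (by positivity), bracket_scale ht]
  calc (t^n)⁻¹ * |ψ (t⁻¹ • z)| ≤ (t^n)⁻¹ * (C₁ * (1 + ‖t⁻¹ • z‖) ^ (-((n : ℝ) + δ))) := by
        gcongr; exact h2 _
    _ = C₁ * (t^n)⁻¹ * (1 + ‖t⁻¹ • z‖) ^ (-((n : ℝ) + δ)) := by ring
    _ = C₁ * (t ^ δ * t ^ (-((n:ℝ) + δ))) * (1 + ‖t⁻¹ • z‖) ^ (-((n : ℝ) + δ)) := by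
        congr 2
        rw [← Real.rpow_add ht, ← Real.rpow_natCast, ← Real.rpow_neg ht.le]
        congr 1; ring
    _ = _ := by ring

lemma kt_sub_le {C₂ δ γ : ℝ} {ψ : Rn n → ℝ}
    (h3 : ∀ x h : Rn n, 2 * ‖h‖ ≤ ‖x‖ →
      |ψ (x + h) - ψ x| ≤ C₂ * ‖h‖ ^ γ * (1 + ‖x‖) ^ (-((n : ℝ) + δ + γ)))
    {t : ℝ} (ht : 0 < t) (z h : Rn n) (hz : 2 * ‖h‖ ≤ ‖z‖) :
    |kt ψ t (z + h) - kt ψ t z| ≤ C₂ * ‖h‖ ^ γ * t ^ δ * (t + ‖z‖) ^ (-((n:ℝ) + δ + γ)) := by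
  unfold kt
  rw [← mul_sub, abs_mul, abs_of_nonneg (by positivity), bracket_scale ht, smul_add]
  have hh : ‖t⁻¹ • h‖ = t⁻¹ * ‖h‖ := by rw [norm_smul, norm_inv, Real.norm_of_nonneg ht.le]
  have := h3 (t⁻¹ • z) (t⁻¹ • h) (by
    rw [hh, norm_smul, norm_inv, Real.norm_of_nonneg ht.le]
    have : 0 < t⁻¹ := by positivity
    nlinarith)
  calc _ ≤ (t^n)⁻¹ * (C₂ * ‖t⁻¹ • h‖ ^ γ * (1 + ‖t⁻¹ • z‖) ^ (-((n : ℝ) + δ + γ))) := by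
        gcongr
    _ = C₂ * ‖h‖^γ * ((t^n)⁻¹ * (t⁻¹)^γ) * (1 + ‖t⁻¹ • z‖) ^ (-((n : ℝ) + δ + γ)) := by
        rw [hh, Real.mul_rpow (by positivity) (by positivity)]; ring
    _ = C₂ * ‖h‖^γ * (t ^ δ * t ^ (-((n:ℝ) + δ + γ))) * (1 + ‖t⁻¹ • z‖) ^ (-((n : ℝ) + δ + γ)) := by
        congr 2
        rw [← Real.rpow_add ht, ← Real.rpow_natCast, ← Real.rpow_neg ht.le, ← Real.rpow_neg_one,
          ← Real.rpow_mul ht.le, ← Real.rpow_add ht]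
        congr 1; ring
    _ = _ := by ring

lemma measurable_kt {ψ : Rn n → ℝ} (hψ : Measurable ψ) (t : ℝ) : Measurable (kt ψ t) := by
  unfold kt; fun_prop

lemma integrable_kt_mul {C₁ δ : ℝ} (hC₁ : 0 < C₁) (hδ : 0 < δ) {ψ : Rn n → ℝ} (hψ : Measurable ψ)
    (h2 : ∀ x : Rn n, |ψ x| ≤ C₁ * (1 + ‖x‖) ^ (-((n : ℝ) + δ))) {t : ℝ} (ht : 0 < t)
    {g : Rn n → ℝ} (hg : Integrable g) (x : Rn n) :
    Integrable (fun y => kt ψ t (x - y) * g y) := by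
  refine hg.bdd_mul (c := (t^n)⁻¹ * C₁) ?_ ?_
  · exact ((measurable_kt hψ t).comp (by fun_prop)).aestronglyMeasurable
  · exact Filter.Eventually.of_forall fun y => kt_bound hC₁ hδ h2 ht _

/-- min-type bound -/
lemma min_bound {a b d t : ℝ} (hb : 0 < a + b) (hd : 0 < d) (ht : 0 < t) :
    t ^ a * (t + d) ^ (-(a + b)) ≤ d ^ (-b) * min ((t/d)^a) ((d/t)^b) := by
  rw [mul_min_of_nonneg _ _ (by positivity)]
  apply le_min
  · calc t ^ a * (t + d) ^ (-(a + b)) ≤ t ^ a * d ^ (-(a+b)) := by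
          gcongr ?_ * ?_
          exact Real.rpow_le_rpow_of_nonpos hd (by linarith) (by linarith)
      _ = _ := by
        rw [Real.div_rpow ht.le hd.le, neg_add, Real.rpow_add hd, Real.rpow_neg hd.le a]; ring
  · calc t ^ a * (t + d) ^ (-(a + b)) ≤ t ^ a * t ^ (-(a+b)) := by
          gcongr ?_ * ?_
          exact Real.rpow_le_rpow_of_nonpos ht (by linarith) (by linarith)
      _ = t ^ (-b) := by rw [← Real.rpow_add ht]; congr 1; ring
      _ = _ := by
        rw [Real.div_rpow hd.le ht.le, Real.rpow_neg hd.le, Real.rpow_neg ht.le]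
        have := Real.rpow_pos_of_pos hd b
        field_simp

/-- Off-support estimate -/
lemma cvl_atom_far {C₁ C₂ δ γ : ℝ} (hC₁ : 0 < C₁) (hC₂ : 0 < C₂)
    (hδ : 0 < δ) (hγ : 0 < γ) {ψ : Rn n → ℝ} (hψ : PsiKernel n C₁ C₂ δ γ ψ)
    {g : Rn n → ℝ} (hg : Integrable g) {c : Rn n} {R : ℝ}
    (hs : ∀ x, x ∉ ball c R → g x = 0) (h0 : ∫ y, g y = 0) {x : Rn n} (hR : 0 < R)
    (hx : 2 * R ≤ ‖x - c‖) {t : ℝ} (ht : 0 < t) :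
    ‖cvl ψ t g x‖ ≤ (C₂ * R^γ * (∫ y, ‖g y‖)) * (t ^ δ * (t + ‖x - c‖) ^ (-(δ + (n + γ)))) := by
  have hψm := hψ.measurable hγ
  obtain ⟨h1, -, h2, h3⟩ := hψ
  have e : cvl ψ t g x = ∫ y, (kt ψ t (x - y) - kt ψ t (x - c)) * g y := by
    rw [cvl_eq_kt]
    simp_rw [sub_mul]
    rw [integral_sub (integrable_kt_mul hC₁ hδ hψm h2 ht hg x) (hg.const_mul _), integral_const_mul, h0]
    simp
  rw [e, mul_right_comm, ← integral_const_mul]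
  apply norm_integral_le_of_norm_le (hg.norm.const_mul _)
  refine Filter.Eventually.of_forall fun y => ?_
  by_cases hy : y ∈ ball c R
  · rw [norm_mul]
    gcongr
    have hy' : ‖c - y‖ ≤ R := by rw [← dist_eq_norm, dist_comm]; exact (mem_ball.1 hy).le
    have := kt_sub_le h3 ht (x - c) (c - y) (by linarith)
    rw [sub_add_sub_cancel] at this
    refine this.trans ?_
    rw [mul_assoc _ (t^δ), show -((n:ℝ) + δ + γ) = -(δ + (n + γ)) by ring]
    gcongr
  · rw [hs y hy]; simp

lemma Gs_atom_far {C₁ C₂ δ γ : ℝ} (hC₁ : 0 < C₁) (hC₂ : 0 < C₂)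
    (hδ : 0 < δ) (hγ : 0 < γ) {ψ : Rn n → ℝ} (hψ : PsiKernel n C₁ C₂ δ γ ψ)
    {g : Rn n → ℝ} (hg : Integrable g) {c : Rn n} {R : ℝ}
    (hs : ∀ x, x ∉ ball c R → g x = 0) (h0 : ∫ y, g y = 0) {x : Rn n} (hR : 0 < R)
    (hx : 2 * R ≤ ‖x - c‖) :
    Gs ψ univ g x ≤ ENNReal.ofReal ((C₂ * R^γ * (∫ y, ‖g y‖)) * (2 ^ ((n:ℝ) + γ) *
      (R + ‖x - c‖) ^ (-((n:ℝ) + γ))) *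
      Real.sqrt (1/(2*δ) + 1/(2*(n+γ)))) := by
  have hd : 0 < ‖x - c‖ := by linarith
  have hi : 0 ≤ ∫ y, ‖g y‖ := integral_nonneg fun y => norm_nonneg _
  have := eLpNorm_nu_le (F := fun t => cvl ψ t g x) (S := univ) .univ
    (M := (C₂ * R^γ * (∫ y, ‖g y‖)) * ‖x - c‖ ^ (-((n:ℝ) + γ))) (d := ‖x - c‖) (α := δ) (β := n + γ)
    (by positivity) hd hδ (by positivity) (by
      intro t _ ht
      refine (cvl_atom_far hC₁ hC₂ hδ hγ hψ hg hs h0 hR hx ht).trans ?_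
      rw [mul_assoc _ (‖x - c‖ ^ _)]
      exact mul_le_mul_of_nonneg_left (min_bound (by positivity) hd ht) (by positivity))
  refine this.trans (ENNReal.ofReal_le_ofReal ?_)
  gcongr
  calc ‖x - c‖ ^ (-((n:ℝ) + γ)) ≤ (2⁻¹ * (R + ‖x - c‖)) ^ (-((n:ℝ) + γ)) := by
        apply Real.rpow_le_rpow_of_nonpos (by positivity) (by linarith) (by linarith [n.cast_nonneg (α := ℝ)])
    _ = _ := by
      rw [Real.mul_rpow (by positivity) (by positivity), Real.inv_rpow (by positivity), Real.rpow_neg (by positivity) , inv_inv]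

lemma ennreal_young (a : ℝ≥0∞) {H : ℝ} (hH : 0 < H) :
    a ≤ ENNReal.ofReal H + ENNReal.ofReal H⁻¹ * a ^ 2 := by
  rcases le_total a (ENNReal.ofReal H) with h | h
  · exact h.trans le_self_add
  · refine le_trans ?_ le_add_self
    calc a = ENNReal.ofReal H⁻¹ * ENNReal.ofReal H * a := by
          rw [← ENNReal.ofReal_mul (by positivity), inv_mul_cancel₀ hH.ne']; simp
      _ ≤ ENNReal.ofReal H⁻¹ * a * a := by gcongr
      _ = _ := by rw [mul_assoc, sq]

/-- `L¹` bound of `G` on atoms. -/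
lemma atom_bound (hn : 1 ≤ n) {C₁ C₂ δ γ : ℝ} (hC₁ : 0 < C₁) (hC₂ : 0 < C₂)
    (hδ : 0 < δ) (hγ : 0 < γ) {ψ : Rn n → ℝ} (hψ : PsiKernel n C₁ C₂ δ γ ψ) :
    ∃ C : ℝ, 0 ≤ C ∧ ∀ (g : Rn n → ℝ) (c : Rn n) (R H : ℝ), 0 < R → 0 < H → Integrable g →
      (∀ᵐ x, |g x| ≤ H) → (∀ x, x ∉ ball c R → g x = 0) → ∫ y, g y = 0 →
      ∫⁻ x, Gs ψ univ g x ≤ ENNReal.ofReal (C * H * R^n) := by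
  obtain ⟨C, hC, hL2⟩ := L2_bound hn hC₁ hC₂ hδ hγ hψ
  set V := (volume (ball (0 : Rn n) 1)).toReal with hV
  have hV0 : 0 ≤ V := ENNReal.toReal_nonneg
  have hJ := JJ_nonneg (n := n) γ
  set S := Real.sqrt (1/(2*δ) + 1/(2*(n+γ))) with hS
  have hS0 : 0 ≤ S := Real.sqrt_nonneg _
  refine ⟨(2^n * V + C * V) + C₂ * V * 2 ^ ((n:ℝ) + γ) * JJ n γ * S, by positivity,
    fun g c R H hR hH hg hgH hs h0 => ?_⟩
  have hball : ∀ {r : ℝ}, 0 ≤ r → volume (ball c r) = ENNReal.ofReal (r^n * V) := by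
    intro r hr
    rw [hV, ← vol_ball_toReal hn c hr, ENNReal.ofReal_toReal measure_ball_lt_top.ne]
  have hg1 : ∫ y, ‖g y‖ ≤ H * (R^n * V) := by
    have : ∫ y, ‖g y‖ ≤ ∫ y, (ball c R).indicator (fun _ => H) y := by
      apply integral_mono_ae hg.norm
      · rw [integrable_indicator_iff measurableSet_ball]
        exact integrableOn_const (by exact measure_ball_lt_top.ne)
      · filter_upwards [hgH] with y hy
        by_cases hyb : y ∈ ball c R
        · rw [indicator_of_mem hyb]; exact hy
        · rw [indicator_of_notMem hyb, hs y hyb]; simp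
    rwa [integral_indicator_const _ measurableSet_ball, Measure.real, vol_ball_toReal hn c hR.le,
      smul_eq_mul, mul_comm] at this
  have hg2 : ∫⁻ y, ‖g y‖ₑ ^ 2 ≤ ENNReal.ofReal (H^2 * (R^n * V)) := by
    have : ∫⁻ y, ‖g y‖ₑ ^ 2 ≤ ∫⁻ y, (ball c R).indicator (fun _ => ENNReal.ofReal (H^2)) y := by
      apply lintegral_mono_ae
      filter_upwards [hgH] with y hy
      by_cases hyb : y ∈ ball c R
      · rw [indicator_of_mem hyb, ← ofReal_norm, ← ENNReal.ofReal_pow (norm_nonneg _)]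
        gcongr; exact hy
      · rw [indicator_of_notMem hyb, hs y hyb]; simp
    rwa [lintegral_indicator_const measurableSet_ball, hball hR.le, ← ENNReal.ofReal_mul (by positivity)] at this
  have hgmem : MemLp g 2 := by
    refine ⟨hg.1, ?_⟩
    by_contra hcon
    have h1 := eLpNorm_two_sq volume g
    rw [not_lt_top_iff.1 hcon] at h1
    rw [← h1] at hg2
    exact absurd hg2 (by simp)
  have near : ∫⁻ x in ball c (2*R), Gs ψ univ g x ≤ ENNReal.ofReal (H * ((2*R)^n * V) + H⁻¹ * (C * (H^2 * (R^n*V)))) := by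
    calc _ ≤ ∫⁻ x in ball c (2*R), (ENNReal.ofReal H + ENNReal.ofReal H⁻¹ * Gs ψ univ g x ^ 2) :=
          lintegral_mono fun x => ennreal_young _ hH
      _ = ENNReal.ofReal H * volume (ball c (2*R)) + ENNReal.ofReal H⁻¹ * ∫⁻ x in ball c (2*R), Gs ψ univ g x ^ 2 := by
          rw [lintegral_add_left measurable_const, lintegral_const, Measure.restrict_apply_univ,
            lintegral_const_mul' _ _ ENNReal.ofReal_ne_top]
      _ ≤ ENNReal.ofReal H * ENNReal.ofReal ((2*R)^n * V) + ENNReal.ofReal H⁻¹ * (ENNReal.ofReal C * ENNReal.ofReal (H^2 * (R^n * V))) := by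
          rw [hball (by positivity)]
          gcongr
          refine (setLIntegral_le_lintegral _ _).trans ((hL2 g hg hgmem).trans ?_)
          gcongr
      _ = _ := by
          rw [ENNReal.ofReal_add (by positivity) (by positivity), ENNReal.ofReal_mul hH.le,
            ENNReal.ofReal_mul (p := H⁻¹) (by positivity), ENNReal.ofReal_mul hC]
  have far : ∫⁻ x in (ball c (2*R))ᶜ, Gs ψ univ g x ≤
      ENNReal.ofReal (C₂ * (H * (R^n * V)) * 2 ^ ((n:ℝ) + γ) * JJ n γ * S) := by
    have hgn : 0 ≤ ∫ y, ‖g y‖ := integral_nonneg fun y => norm_nonneg _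
    set M := (C₂ * R^γ * (∫ y, ‖g y‖)) * 2 ^ ((n:ℝ) + γ) * S with hM
    calc _ ≤ ∫⁻ x in (ball c (2*R))ᶜ, ENNReal.ofReal (M * (R + ‖x - c‖) ^ (-((n:ℝ) + γ))) := by
          apply setLIntegral_mono' measurableSet_ball.compl
          intro x hx
          refine (Gs_atom_far hC₁ hC₂ hδ hγ hψ hg hs h0 hR ?_).trans_eq ?_
          · rw [← dist_eq_norm]; simpa using hx
          · congr 1; rw [hM]; ring
      _ ≤ ∫⁻ x, ENNReal.ofReal (M * (R + ‖x - c‖) ^ (-((n:ℝ) + γ))) := setLIntegral_le_lintegral _ _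
      _ = ENNReal.ofReal (M * (R ^ (-γ) * JJ n γ)) := by
          rw [← ofReal_integral_eq_lintegral_ofReal ((integrable_bracket_r hγ hR c).const_mul _)
            (Filter.Eventually.of_forall fun x => by positivity), integral_const_mul, integral_bracket_r hR]
      _ ≤ _ := by
          apply ENNReal.ofReal_le_ofReal
          have : R^γ * R^(-γ) = 1 := by rw [← Real.rpow_add hR]; simp
          calc M * (R ^ (-γ) * JJ n γ) = C₂ * (R^γ * R^(-γ)) * (∫ y, ‖g y‖) * 2 ^ ((n:ℝ) + γ) * JJ n γ * S := by
                rw [hM]; ring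
            _ ≤ _ := by rw [this, mul_one]; gcongr
  rw [← lintegral_add_compl _ (measurableSet_ball (x := c) (ε := 2 * R))]
  refine (add_le_add near far).trans_eq ?_
  rw [← ENNReal.ofReal_add (by positivity) (by positivity)]
  congr 1
  rw [mul_pow]; field_simp

/-- Half-open cube. -/
def hc (a : Rn n) (s : ℝ) : Set (Rn n) := {x | ∀ i, a i ≤ x i ∧ x i < a i + s}

lemma measurableSet_hc (a : Rn n) (s : ℝ) : MeasurableSet (hc a s) := by
  have : hc a s = ⋂ i, ({x : Rn n | a i ≤ x i} ∩ {x | x i < a i + s}) := by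
    ext x; simp [hc]
  rw [this]
  refine MeasurableSet.iInter fun i => ?_
  have hm : Measurable fun x : Rn n => x i := by fun_prop
  exact (measurableSet_le measurable_const hm).inter (measurableSet_lt hm measurable_const)

lemma volume_hc (a : Rn n) {s : ℝ} (hs : 0 ≤ s) : volume (hc a s) = ENNReal.ofReal (s ^ n) := by
  have hv := EuclideanSpace.volume_preserving_symm_measurableEquiv_toLp (Fin n)
  have hpre : hc a s = (MeasurableEquiv.toLp 2 (Fin n → ℝ)).symm ⁻¹'
      (Set.pi univ fun i => Ico (a i) (a i + s)) := by
    ext x; simp [hc, Set.mem_pi]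
  rw [hpre, hv.measure_preimage (MeasurableSet.univ_pi fun i => measurableSet_Ico).nullMeasurableSet,
    Real.volume_pi_Ico]
  simp [ENNReal.ofReal_pow hs]

lemma volume_hc_toReal (a : Rn n) {s : ℝ} (hs : 0 ≤ s) : (volume (hc a s)).toReal = s ^ n := by
  rw [volume_hc a hs, ENNReal.toReal_ofReal (by positivity)]

lemma norm_le_sum (v : Rn n) : ‖v‖ ≤ ∑ i, |v i| := by
  rw [EuclideanSpace.norm_eq]
  apply Real.sqrt_le_iff.2
  refine ⟨Finset.sum_nonneg fun i _ => abs_nonneg _, ?_⟩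
  simp only [Real.norm_eq_abs]
  exact Finset.sum_sq_le_sq_sum_of_nonneg fun i _ => abs_nonneg _

lemma hc_subset_ball (hn : 1 ≤ n) {a : Rn n} {s : ℝ} {x : Rn n} (hx : x ∈ hc a s) :
    hc a s ⊆ ball x (n * s) := by
  intro y hy
  rw [mem_ball, dist_eq_norm]
  refine (norm_le_sum _).trans_lt ?_
  have : ∑ i : Fin n, |(y - x) i| < ∑ i : Fin n, s := by
    apply Finset.sum_lt_sum_of_nonempty ⟨⟨0, hn⟩, Finset.mem_univ _⟩
    intro i _
    have h1 := hx i
    have h2 := hy i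
    rw [PiLp.sub_apply, abs_lt]
    constructor <;> linarith
  simpa using this

lemma mem_hc_self (a : Rn n) {s : ℝ} (hs : 0 < s) : a ∈ hc a s := fun i => ⟨le_rfl, by linarith⟩

lemma intOn_ball {f : Rn n → ℝ} (hf : LocallyIntegrable f volume) (c : Rn n) (r : ℝ) :
    IntegrableOn f (ball c r) :=
  (hf.integrableOn_isCompact (isCompact_closedBall c r)).mono_set ball_subset_closedBall

lemma intOn_hc (hn : 1 ≤ n) {f : Rn n → ℝ} (hf : LocallyIntegrable f volume) (a : Rn n) (s : ℝ) :
    IntegrableOn f (hc a s) := by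
  by_cases hs : 0 < s
  · exact (intOn_ball hf a (n * s)).mono_set (hc_subset_ball hn (mem_hc_self a hs))
  · have : hc a s = ∅ := by
      ext x; simp only [mem_empty_iff_false, iff_false]
      intro h; have := h ⟨0, hn⟩; linarith
    rw [this]; exact integrableOn_empty

lemma avg_dev {f : Rn n → ℝ} {E : Set (Rn n)} (hfin : volume E ≠ ⊤)
    (h0 : volume E ≠ 0) (hf : IntegrableOn f E) (c : ℝ) :
    |avg f E - c| * (volume E).toReal ≤ ∫ x in E, |f x - c| := by
  have hm : 0 < (volume E).toReal := ENNReal.toReal_pos h0 hfin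
  have hcI : IntegrableOn (fun _ : Rn n => c) E := integrableOn_const hfin
  have e : (avg f E - c) * (volume E).toReal = ∫ x in E, (f x - c) := by
    rw [integral_sub hf hcI, setIntegral_const, avg, Measure.real, smul_eq_mul]
    field_simp
  rw [← abs_of_pos hm, ← abs_mul, e]
  exact abs_integral_le_integral_abs

lemma avg_osc {f : Rn n → ℝ} {E : Set (Rn n)} (hfin : volume E ≠ ⊤)
    (h0 : volume E ≠ 0) (hf : IntegrableOn f E) (c : ℝ) :
    ∫ x in E, |f x - avg f E| ≤ 2 * ∫ x in E, |f x - c| := by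
  have h1 := avg_dev hfin h0 hf c
  have hcI : ∀ c : ℝ, IntegrableOn (fun _ : Rn n => c) E := fun c => integrableOn_const hfin
  calc ∫ x in E, |f x - avg f E| ≤ ∫ x in E, (|f x - c| + |avg f E - c|) := by
        apply integral_mono (hf.sub (hcI _)).abs ((hf.sub (hcI _)).abs.add (hcI _))
        intro x
        have := abs_sub_le (f x) c (avg f E)
        rw [abs_sub_comm c] at this
        exact this
    _ = (∫ x in E, |f x - c|) + |avg f E - c| * (volume E).toReal := by
        have hfc : IntegrableOn (fun x => |f x - c|) E := (hf.sub (hcI c)).abs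
        rw [integral_add hfc (hcI _), setIntegral_const, Measure.real, smul_eq_mul]
        ring
    _ ≤ _ := by linarith

lemma wInt_mono {ω : Rn n → ℝ} (hω : IsWeight ω) {E F : Set (Rn n)} (h : E ⊆ F)
    (hF : IntegrableOn ω F) : wInt ω E ≤ wInt ω F :=
  setIntegral_mono_set hF (Filter.Eventually.of_forall hω.1) h.eventuallyLE

lemma wInt_pos {ω : Rn n → ℝ} (hω : IsWeight ω) {E : Set (Rn n)}
    (h0 : volume E ≠ 0) (hE : IntegrableOn ω E) : 0 < wInt ω E := by
  unfold wInt
  rw [setIntegral_pos_iff_support_of_nonneg_ae (Filter.Eventually.of_forall hω.1) hE]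
  have : volume (Function.support ω ∩ E) = volume E := by
    apply measure_congr
    filter_upwards [hω.2.2] with x hx
    have hmem : x ∈ Function.support ω := hx.ne'
    exact propext ⟨fun h => h.2, fun h => ⟨hmem, h⟩⟩
  rw [this]; exact pos_iff_ne_zero.2 h0

lemma A1_ae {ω : Rn n → ℝ} (hω : IsWeight ω) {A : ℝ} (hA : A1ballBound ω A) (c : Rn n) {r : ℝ}
    (hr : 0 < r) : ∀ᵐ y ∂(volume.restrict (ball c r)),
      wInt ω (ball c r) ≤ (volume (ball c r)).toReal * (A * ω y) := by
  have hb : Filter.IsBoundedUnder (· ≥ ·) (ae (volume.restrict (ball c r))) ω :=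
    Filter.isBoundedUnder_of ⟨0, hω.1⟩
  have hm : 0 < (volume (ball c r)).toReal :=
    ENNReal.toReal_pos (measure_ball_pos _ _ hr).ne' measure_ball_lt_top.ne
  filter_upwards [ae_essInf_le hb] with y hy
  have h := hA.2 c r hr
  unfold avg at h
  rw [inv_mul_le_iff₀ hm] at h
  refine h.trans ?_
  have := hA.1
  gcongr

/-- Integrated form on subsets. -/
lemma A1_sub {ω : Rn n → ℝ} (hω : IsWeight ω) {A : ℝ} (hA : A1ballBound ω A) (c : Rn n) {r : ℝ}
    (hr : 0 < r) {E : Set (Rn n)} (hE : E ⊆ ball c r) :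
    wInt ω (ball c r) * (volume E).toReal ≤ (volume (ball c r)).toReal * A * wInt ω E := by
  have hi := (intOn_ball hω.2.1 c r).mono_set hE
  have hfin : volume E ≠ ⊤ := (measure_mono hE |>.trans_lt measure_ball_lt_top).ne
  have h := ae_restrict_of_ae_restrict_of_subset hE (A1_ae hω hA c hr)
  have := integral_mono_ae (μ := volume.restrict E) (f := fun _ => wInt ω (ball c r))
    (g := fun y => (volume (ball c r)).toReal * (A * ω y)) (integrableOn_const hfin)
    ((hi.const_mul A).const_mul _) h
  rw [setIntegral_const, integral_const_mul, integral_const_mul, Measure.real, smul_eq_mul] at this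
  unfold wInt at *
  linarith

/-- Dimensional constant -/
def VV (n : ℕ) : ℝ := (volume (ball (0 : Rn n) 1)).toReal

lemma VV_pos : 0 < VV n :=
  ENNReal.toReal_pos (measure_ball_pos _ _ one_pos).ne' measure_ball_lt_top.ne

lemma vol_ball (hn : 1 ≤ n) (c : Rn n) {r : ℝ} (hr : 0 ≤ r) :
    (volume (ball c r)).toReal = r ^ n * VV n := vol_ball_toReal hn c hr

/-- A₁ on cubes. -/
lemma A1_hc (hn : 1 ≤ n) {ω : Rn n → ℝ} (hω : IsWeight ω) {A : ℝ} (hA : A1ballBound ω A) (a : Rn n)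
    {s : ℝ} (hs : 0 < s) : ∀ᵐ y ∂(volume.restrict (hc a s)),
      wInt ω (hc a s) ≤ (n^n * VV n * A) * s^n * ω y := by
  have hn0 : (0:ℝ) < n := by exact_mod_cast hn
  have hsub := hc_subset_ball hn (mem_hc_self a hs)
  filter_upwards [ae_restrict_of_ae_restrict_of_subset hsub (A1_ae hω hA a (r := n * s) (by positivity))] with y hy
  refine (wInt_mono hω hsub (intOn_ball hω.2.1 _ _)).trans (hy.trans_eq ?_)
  rw [vol_ball hn _ (by positivity), mul_pow]; ring

lemma wInt_ball_le_hc (hn : 1 ≤ n) {ω : Rn n → ℝ} (hω : IsWeight ω) {A : ℝ} (hA : A1ballBound ω A)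
    (a : Rn n) {s : ℝ} (hs : 0 < s) :
    wInt ω (ball a (n * s)) ≤ (n^n * VV n * A) * wInt ω (hc a s) := by
  have hn0 : (0:ℝ) < n := by exact_mod_cast hn
  have hsub := hc_subset_ball hn (mem_hc_self a hs)
  have := A1_sub hω hA a (r := n * s) (by positivity) hsub
  rw [vol_ball hn _ (by positivity), volume_hc_toReal _ hs.le, mul_pow] at this
  have hp : 0 < s^n := by positivity
  nlinarith

lemma osc_hc (hn : 1 ≤ n) {ω : Rn n → ℝ} (hω : IsWeight ω) {A : ℝ} (hA : A1ballBound ω A)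
    {f : Rn n → ℝ} (hf : LocallyIntegrable f volume) {N : ℝ} (hN : 0 < N)
    (hosc : ∀ c r, 0 < r → ∫ x in ball c r, |f x - avg f (ball c r)| ≤ N * wInt ω (ball c r))
    (a : Rn n) {s : ℝ} (hs : 0 < s) :
    ∫ x in hc a s, |f x - avg f (hc a s)| ≤ 2 * N * (n^n * VV n * A) * wInt ω (hc a s) := by
  have hn0 : (0:ℝ) < n := by exact_mod_cast hn
  have hsub := hc_subset_ball hn (mem_hc_self a hs)
  have hv := volume_hc a hs.le
  refine (avg_osc (by rw [hv]; exact ENNReal.ofReal_ne_top)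
    (by rw [hv]; simp; positivity) (intOn_hc hn hf a s) (avg f (ball a (n * s)))).trans ?_
  have h1 : ∫ x in hc a s, |f x - avg f (ball a (n * s))| ≤ ∫ x in ball a (n * s), |f x - avg f (ball a (n * s))| := by
    apply setIntegral_mono_set _ (Filter.Eventually.of_forall fun x => abs_nonneg _) hsub.eventuallyLE
    exact ((intOn_ball hf _ _).sub (integrableOn_const measure_ball_lt_top.ne)).abs
  have h2 := hosc a (n * s) (by positivity)
  have h3 := wInt_ball_le_hc hn hω hA a hs
  nlinarith

/-- Dyadic index of a point relative to the cube with corner `a`, side `s`. -/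
def idx (a : Rn n) (s : ℝ) (k : ℕ) (x : Rn n) : Fin n → ℤ := fun i => ⌊2^k * (x i - a i) / s⌋

/-- Dyadic cube corner. -/
def dcor (a : Rn n) (s : ℝ) (p : ℕ × (Fin n → ℤ)) : Rn n :=
  WithLp.toLp 2 (fun i => a i + s / 2^p.1 * p.2 i)

/-- Dyadic cube. -/
def dc (a : Rn n) (s : ℝ) (p : ℕ × (Fin n → ℤ)) : Set (Rn n) := hc (dcor a s p) (s / 2^p.1)

lemma mem_dc {a : Rn n} {s : ℝ} (hs : 0 < s) (p : ℕ × (Fin n → ℤ)) (x : Rn n) :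
    x ∈ dc a s p ↔ idx a s p.1 x = p.2 := by
  simp only [dc, hc, dcor, mem_ofPred_eq, funext_iff, idx]
  refine forall_congr' fun i => ?_
  rw [Int.floor_eq_iff, le_div_iff₀ hs, div_lt_iff₀ hs]
  have h2 : (0:ℝ) < 2^p.1 := by positivity
  have e1 : s / 2^p.1 * p.2 i = (p.2 i * s) / 2^p.1 := by ring
  have e2 : s / 2^p.1 = s / 2^p.1 := rfl
  constructor
  · rintro ⟨h1, h3⟩
    constructor
    · have : (p.2 i * s) / 2^p.1 ≤ x i - a i := by linarith
      rw [div_le_iff₀ h2] at this; linarith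
    · have : x i - a i < ((p.2 i + 1) * s) / 2^p.1 := by
        have : ((p.2 i + 1) * s) / 2^p.1 = s / 2^p.1 * p.2 i + s / 2^p.1 := by ring
        linarith
      rw [lt_div_iff₀ h2] at this; linarith
  · rintro ⟨h1, h3⟩
    constructor
    · have : (p.2 i * s) / 2^p.1 ≤ x i - a i := by rw [div_le_iff₀ h2]; linarith
      linarith
    · have : x i - a i < ((p.2 i + 1) * s) / 2^p.1 := by rw [lt_div_iff₀ h2]; linarith
      have : ((p.2 i + 1) * s) / 2^p.1 = s / 2^p.1 * p.2 i + s / 2^p.1 := by ring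
      linarith

lemma dc_zero (a : Rn n) (s : ℝ) : dc a s (0, 0) = hc a s := by
  unfold dc dcor
  simp

lemma idx_zero {a : Rn n} {s : ℝ} (hs : 0 < s) {x : Rn n} : x ∈ hc a s ↔ idx a s 0 x = 0 := by
  rw [← dc_zero, mem_dc hs]

lemma floor_half (z : ℝ) : ⌊z / 2⌋ = ⌊z⌋ / 2 := by
  rw [Int.floor_eq_iff]
  have h1 := Int.floor_le z
  have h2 := Int.lt_floor_add_one z
  have h3 := Int.ediv_mul_le ⌊z⌋ (b := 2) (by norm_num)
  have h4 : ⌊z⌋ + 1 ≤ (⌊z⌋ / 2 + 1) * 2 := by omega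
  have h3' : ((⌊z⌋ / 2 : ℤ) : ℝ) * 2 ≤ ⌊z⌋ := by exact_mod_cast h3
  have h4' : (⌊z⌋ : ℝ) + 1 ≤ (((⌊z⌋ / 2 : ℤ) : ℝ) + 1) * 2 := by exact_mod_cast h4
  constructor <;> linarith

lemma idx_succ (a : Rn n) (s : ℝ) (k : ℕ) (x : Rn n) (i : Fin n) :
    idx a s k x i = idx a s (k+1) x i / 2 := by
  unfold idx
  rw [← floor_half]
  congr 1
  rw [pow_succ]; ring

lemma idx_nested {a : Rn n} {s : ℝ} {k k' : ℕ} (h : k' ≤ k) {x y : Rn n}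
    (hxy : idx a s k x = idx a s k y) : idx a s k' x = idx a s k' y := by
  induction k, h using Nat.le_induction with
  | base => exact hxy
  | succ k hk ih =>
    apply ih
    ext i
    rw [idx_succ a s k x, idx_succ a s k y, hxy]

/-- average over shrinking dyadic cubes bounded ⇒ pointwise bound a.e. -/
lemma leb_bound (hn : 1 ≤ n) {f : Rn n → ℝ} (hf : LocallyIntegrable f volume) {a : Rn n} {s : ℝ}
    (hs : 0 < s) (q lam : ℝ) : ∀ᵐ x : Rn n,
      (∀ k, ∫ y in dc a s (k, idx a s k x), |f y - q| ≤ lam * (s/2^k)^n) → |f x - q| ≤ lam := by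
  have hn0 : (0:ℝ) < n := by exact_mod_cast hn
  filter_upwards [IsUnifLocDoublingMeasure.ae_tendsto_average_norm_sub (μ := volume) hf 1] with x hx hk
  have ht0 : Filter.Tendsto (fun k : ℕ => (n:ℝ) * (s / 2^k)) Filter.atTop (nhds 0) := by
    have : Filter.Tendsto (fun k : ℕ => (n:ℝ) * s * (1/2)^k) Filter.atTop (nhds 0) := by
      have := (tendsto_pow_atTop_nhds_zero_of_lt_one (r := (1/2:ℝ)) (by norm_num) (by norm_num)).const_mul ((n:ℝ) * s)
      simpa using this
    refine this.congr fun k => ?_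
    rw [one_div, inv_pow]; ring
  have ht : Filter.Tendsto (fun k : ℕ => (n:ℝ) * (s / 2^k)) Filter.atTop (nhdsWithin 0 (Ioi 0)) :=
    tendsto_nhdsWithin_iff.2 ⟨ht0, Filter.Eventually.of_forall fun k => by
      show (0:ℝ) < _; positivity⟩
  have h := hx (fun _ => x) _ ht (Filter.Eventually.of_forall fun k => by
    apply mem_closedBall_self; positivity)
  have key : ∀ k : ℕ, |f x - q| ≤ lam + (n^n * VV n) * ⨍ y in closedBall x (n * (s/2^k)), ‖f y - f x‖ := by
    intro k
    set r := s / 2^k with hr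
    have hr0 : 0 < r := by positivity
    set D := dc a s (k, idx a s k x) with hD
    have hxD : x ∈ D := (mem_dc hs _ _).2 rfl
    have hsub : D ⊆ closedBall x (n * r) := (hc_subset_ball hn hxD).trans ball_subset_closedBall
    have hDv : (volume D).toReal = r^n := volume_hc_toReal _ hr0.le
    have hDt : volume D ≠ ⊤ := by rw [hD, dc, volume_hc _ hr0.le]; exact ENNReal.ofReal_ne_top
    have hDi : IntegrableOn f D := intOn_hc hn hf _ _
    have hCv : (volume (closedBall x (n * r))).toReal = (n * r)^n * VV n := by
      have : Nonempty (Fin n) := ⟨⟨0, hn⟩⟩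
      rw [Measure.addHaar_closedBall_eq_addHaar_ball]
      exact vol_ball hn x (by positivity)
    have hCi : IntegrableOn (fun y => ‖f y - f x‖) (closedBall x (n * r)) :=
      ((hf.integrableOn_isCompact (isCompact_closedBall x _)).sub
        (integrableOn_const (isCompact_closedBall x _).measure_lt_top.ne)).norm
    have hq : ∀ q : ℝ, IntegrableOn (fun y => |f y - q|) D := fun q => (hDi.sub (integrableOn_const hDt)).abs
    have h1 : |f x - q| * r^n ≤ (∫ y in D, |f y - q|) + ∫ y in D, |f y - f x| := by
      rw [← integral_add (hq q) (hq (f x)), ← hDv]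
      have : |f x - q| * (volume D).toReal = ∫ y in D, |f x - q| := by
        rw [setIntegral_const, smul_eq_mul, Measure.real, mul_comm]
      rw [this]
      have hcst : IntegrableOn (fun _ : Rn n => |f x - q|) D := integrableOn_const hDt
      apply integral_mono hcst ((hq q).add (hq (f x)))
      intro y
      have := abs_sub_le (f x) (f y) q
      rw [abs_sub_comm (f x) (f y)] at this
      show |f x - q| ≤ |f y - q| + |f y - f x|
      linarith
    have h2 : ∫ y in D, |f y - f x| ≤ ∫ y in closedBall x (n * r), ‖f y - f x‖ :=
      setIntegral_mono_set hCi (Filter.Eventually.of_forall fun y => abs_nonneg _) hsub.eventuallyLE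
    have h3 : ∫ y in closedBall x (n * r), ‖f y - f x‖ =
        ((n * r)^n * VV n) * ⨍ y in closedBall x (n * r), ‖f y - f x‖ := by
      rw [setAverage_eq, Measure.real, hCv, smul_eq_mul, mul_inv_cancel_left₀]
      have := VV_pos (n := n)
      positivity
    have h4 := hk k
    rw [← hD, ← hr] at h4
    have hrn : 0 < r^n := by positivity
    rw [mul_pow] at h3
    set X := ⨍ y in closedBall x (n * r), ‖f y - f x‖
    have : |f x - q| * r^n ≤ (lam + (n^n * VV n) * X) * r^n := by
      calc _ ≤ _ := h1
        _ ≤ lam * r^n + (n^n * r^n * VV n) * X := by linarith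
        _ = _ := by ring
    exact le_of_mul_le_mul_right this hrn
  have hl := (h.const_mul (n^n * VV n)).const_add lam
  simp only [mul_zero, add_zero] at hl
  exact ge_of_tendsto' hl key

lemma measurableSet_dc (a : Rn n) (s : ℝ) (p : ℕ × (Fin n → ℤ)) : MeasurableSet (dc a s p) :=
  measurableSet_hc _ _

lemma stopping (hn : 1 ≤ n) {ω : Rn n → ℝ} (hω : IsWeight ω) {f : Rn n → ℝ}
    (hf : LocallyIntegrable f volume) {A M : ℝ} (hA0 : 0 < A) (hM : 0 < M)
    (hA : ∀ (a : Rn n) (s : ℝ), 0 < s → ∀ᵐ y ∂(volume.restrict (hc a s)),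
      wInt ω (hc a s) ≤ A * s^n * ω y)
    (hosc : ∀ (a : Rn n) (s : ℝ), 0 < s →
      ∫ x in hc a s, |f x - avg f (hc a s)| ≤ M * wInt ω (hc a s))
    (a : Rn n) {s : ℝ} (hs : 0 < s) :
    ∃ T : Set (ℕ × (Fin n → ℤ)), (∀ p ∈ T, dc a s p ⊆ hc a s) ∧ T.PairwiseDisjoint (dc a s) ∧
      (∀ p ∈ T, |avg f (dc a s p) - avg f (hc a s)| ≤ 2^n * (2 * M * wInt ω (hc a s) / s^n)) ∧
      (∀ᵐ x, x ∈ hc a s → x ∉ (⋃ p ∈ T, dc a s p) →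
        |f x - avg f (hc a s)| ≤ 2^n * (2 * M * wInt ω (hc a s) / s^n)) ∧
      wInt ω (⋃ p ∈ T, dc a s p) ≤ (1 - 1/(2*A)) * wInt ω (hc a s) := by
  set Q := hc a s with hQ
  set q := avg f Q with hq
  have hQm : MeasurableSet Q := measurableSet_hc _ _
  have hQv : (volume Q).toReal = s^n := volume_hc_toReal _ hs.le
  have hsn : 0 < s^n := by positivity
  have hQt : volume Q ≠ ⊤ := by rw [hQ, volume_hc _ hs.le]; exact ENNReal.ofReal_ne_top
  have hQ0 : volume Q ≠ 0 := by rw [hQ, volume_hc _ hs.le]; simpa using hsn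
  have hwi : IntegrableOn ω Q := intOn_hc hn hω.2.1 _ _
  have hw : 0 < wInt ω Q := wInt_pos hω hQ0 hwi
  set lam := 2 * M * wInt ω Q / s^n with hlam
  have hlam0 : 0 < lam := by positivity
  have hlams : lam * s^n = 2 * M * wInt ω Q := by rw [hlam]; field_simp
  have hfi : IntegrableOn (fun x => |f x - q|) Q :=
    ((intOn_hc hn hf a s).sub (integrableOn_const hQt)).abs
  set bad : ℕ × (Fin n → ℤ) → Prop := fun p => lam * (s/2^p.1)^n < ∫ y in dc a s p, |f y - q| with hbad
  set T : Set (ℕ × (Fin n → ℤ)) := {p | dc a s p ⊆ Q ∧ bad p ∧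
    ∀ x ∈ dc a s p, ∀ k' < p.1, ¬ bad (k', idx a s k' x)} with hT
  have hTQ : ∀ p ∈ T, dc a s p ⊆ Q := fun p hp => hp.1
  have hdisj : T.PairwiseDisjoint (dc a s) := by
    intro p hp p' hp' hne
    rw [Function.onFun, Set.disjoint_left]
    intro x hx hx'
    have e := (mem_dc hs _ _).1 hx
    have e' := (mem_dc hs _ _).1 hx'
    rcases lt_trichotomy p.1 p'.1 with h | h | h
    · apply hp'.2.2 x hx' p.1 h
      rw [e]; exact hp.2.1
    · apply hne
      ext1
      · exact h
      · rw [← e, ← e', h]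
    · apply hp.2.2 x hx p'.1 h
      rw [e']; exact hp'.2.1
  have hout : ∀ x ∈ Q, x ∉ (⋃ p ∈ T, dc a s p) → ∀ k, ¬ bad (k, idx a s k x) := by
    intro x hxQ hx
    by_contra hcon
    push Not at hcon
    classical
    have hk := Nat.find_spec hcon
    set k := Nat.find hcon
    apply hx
    simp only [mem_iUnion]
    refine ⟨(k, idx a s k x), ⟨?_, hk, ?_⟩, (mem_dc hs _ _).2 rfl⟩
    · intro y hy
      rw [hQ, idx_zero hs, idx_nested (Nat.zero_le k) ((mem_dc hs _ _).1 hy), ← idx_zero hs]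
      exact hxQ
    · intro y hy k' hk'
      rw [idx_nested (hk' : k' < k).le ((mem_dc hs _ _).1 hy)]
      exact Nat.find_min hcon hk'
  have hdpos : ∀ k : ℕ, 0 < s / 2^k := fun k => by positivity
  have hT3 : ∀ p ∈ T, |avg f (dc a s p) - q| ≤ 2^n * lam := by
    intro p hp
    have hxp : dcor a s p ∈ dc a s p := mem_hc_self _ (hdpos _)
    set x := dcor a s p
    have hpx := (mem_dc hs _ _).1 hxp
    rcases hk : p.1 with _ | k
    · exfalso
      have hx0 := (idx_zero hs).1 (hp.1 hxp)
      rw [hk, hx0] at hpx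
      have : p = (0, 0) := Prod.ext hk hpx.symm
      have hb := hp.2.1
      rw [hbad, this, dc_zero] at hb
      simp only [pow_zero, div_one] at hb
      have := hosc a s hs
      rw [← hQ] at this hb
      have : 0 < M * wInt ω Q := by positivity
      linarith
    · have hnb := hp.2.2 x hxp k (by omega)
      simp only [hbad, not_lt] at hnb
      have hsub : dc a s p ⊆ dc a s (k, idx a s k x) := by
        intro y hy
        rw [mem_dc hs]
        have := (mem_dc hs _ _).1 hy
        rw [← hpx] at this
        exact idx_nested (by omega) this
      have hpv : (volume (dc a s p)).toReal = (s/2^(k+1))^n := by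
        rw [← hk]; exact volume_hc_toReal _ (hdpos _).le
      have hpt : volume (dc a s p) ≠ ⊤ := by
        unfold dc; rw [volume_hc _ (hdpos _).le]; exact ENNReal.ofReal_ne_top
      have hp0 : volume (dc a s p) ≠ 0 := by
        intro h; rw [h] at hpv
        have : 0 < (s/2^(k+1))^n := by positivity
        rw [← hpv] at this; simp at this
      have h1 := avg_dev hpt hp0 (intOn_hc hn hf _ _) q
      have h2 : ∫ y in dc a s p, |f y - q| ≤ ∫ y in dc a s (k, idx a s k x), |f y - q| := by
        apply setIntegral_mono_set _ (Filter.Eventually.of_forall fun x => abs_nonneg _) hsub.eventuallyLE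
        refine ((intOn_hc hn hf _ _).sub (integrableOn_const ?_)).abs
        rw [volume_hc _ (hdpos _).le]; exact ENNReal.ofReal_ne_top
      rw [hpv] at h1
      have h3 : (s/2^k)^n = 2^n * (s/2^(k+1))^n := by
        rw [← mul_pow]; congr 1; rw [pow_succ]; field_simp
      rw [h3] at hnb
      have hpos : 0 < (s/2^(k+1))^n := by positivity
      refine le_of_mul_le_mul_right ?_ hpos
      linarith
  refine ⟨T, hTQ, hdisj, hT3, ?_, ?_⟩
  · filter_upwards [leb_bound hn hf hs q lam (a := a)] with x hx hxQ hxT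
    have h1 := hx fun k => by
      have := hout x hxQ hxT k
      simp only [hbad, not_lt] at this
      exact this
    have : (1:ℝ) ≤ 2^n := one_le_pow₀ (by norm_num)
    nlinarith
  · set U := ⋃ p ∈ T, dc a s p with hU
    have hUm : MeasurableSet U := MeasurableSet.biUnion T.to_countable fun p _ => measurableSet_dc _ _ _
    have hUQ : U ⊆ Q := iUnion₂_subset hTQ
    have hUt : volume U ≠ ⊤ := ((measure_mono hUQ).trans_lt hQt.lt_top).ne
    -- volume of U
    have hUv : lam * (volume U).toReal ≤ M * wInt ω Q := by
      have hpt : ∀ p : T, volume (dc a s p) ≠ ⊤ := fun p => ((measure_mono (hTQ p p.2)).trans_lt hQt.lt_top).ne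
      have hUi : U = ⋃ p : T, dc a s p := biUnion_eq_iUnion _ _
      have hd : Pairwise (Function.onFun Disjoint fun p : T => dc a s p) := by
        intro p p' hne
        exact hdisj p.2 p'.2 (fun h => hne (Subtype.ext h))
      have hm : ∀ p : T, MeasurableSet (dc a s p) := fun p => measurableSet_dc _ _ _
      have hs1 := hasSum_integral_iUnion (μ := volume) hm hd
        (f := fun x => |f x - q|) (by rw [← hUi]; exact hfi.mono_set hUQ)
      have hs2 := hasSum_integral_iUnion (μ := volume) hm hd
        (f := fun _ : Rn n => lam) (by rw [← hUi]; exact integrableOn_const hUt)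
      have := hasSum_le (fun p : T => ?_) hs2 hs1
      · rw [← hUi, setIntegral_const, Measure.real, smul_eq_mul] at this
        rw [mul_comm]
        refine this.trans (le_trans ?_ (hosc a s hs))
        exact setIntegral_mono_set hfi (Filter.Eventually.of_forall fun x => abs_nonneg _) hUQ.eventuallyLE
      · have hb := p.2.2.1
        rw [hbad] at hb
        rw [setIntegral_const, Measure.real, smul_eq_mul]
        have : (volume (dc a s p)).toReal = (s/2^p.1.1)^n := volume_hc_toReal _ (hdpos _).le
        rw [this, mul_comm]; exact hb.le
    have hUv' : (volume U).toReal ≤ s^n/2 := by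
      have : lam * (s^n/2) = M * wInt ω Q := by linarith
      rw [← this] at hUv
      exact le_of_mul_le_mul_left hUv hlam0
    have hdiff : (volume (Q \ U)).toReal = s^n - (volume U).toReal := by
      rw [measure_sdiff hUQ hUm.nullMeasurableSet hUt,
        ENNReal.toReal_sub_of_le (measure_mono hUQ) hQt, hQv]
    have hdt : volume (Q \ U) ≠ ⊤ := ((measure_mono sdiff_subset).trans_lt hQt.lt_top).ne
    have h1 := ae_restrict_of_ae_restrict_of_subset (sdiff_subset : Q \ U ⊆ Q) (hA a s hs)
    have h2 := integral_mono_ae (μ := volume.restrict (Q \ U)) (f := fun _ => wInt ω Q)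
      (g := fun y => A * s^n * ω y) (integrableOn_const hdt)
      ((hwi.mono_set sdiff_subset).const_mul _) h1
    rw [setIntegral_const, integral_const_mul, Measure.real, smul_eq_mul, hdiff] at h2
    have h3 : wInt ω U + ∫ x in Q \ U, ω x = wInt ω Q := by
      have := integral_inter_add_sdiff hUm hwi
      rw [inter_eq_self_of_subset_right hUQ] at this
      exact this
    have h4 : s^n/2 * wInt ω Q ≤ A * s^n * ∫ x in Q \ U, ω x := by
      refine le_trans ?_ h2
      gcongr; linarith
    have h5 : wInt ω Q / (2*A) ≤ ∫ x in Q \ U, ω x := by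
      rw [div_le_iff₀ (by positivity)]
      have : s^n * wInt ω Q ≤ s^n * ((∫ x in Q \ U, ω x) * (2*A)) := by linarith
      exact le_of_mul_le_mul_left this hsn
    have : (1 - 1/(2*A)) * wInt ω Q = wInt ω Q - wInt ω Q/(2*A) := by ring
    rw [this]; linarith

lemma nu_ae_pos : ∀ᵐ t ∂nu, 0 < t := by
  have : ∀ᵐ t ∂(volume.restrict (Ioi (0:ℝ))), 0 < t := ae_restrict_mem measurableSet_Ioi
  exact (withDensity_absolutelyContinuous _ _).ae_le this

lemma Gs_mono_set (ψ h : Rn n → ℝ) {S S' : Set ℝ} (hS : S ⊆ S') (x : Rn n) :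
    Gs ψ S h x ≤ Gs ψ S' h x :=
  eLpNorm_mono_measure _ (Measure.restrict_mono hS le_rfl)

lemma Gs_add_le {C₁ C₂ δ γ : ℝ} (hC₁ : 0 < C₁) (hδ : 0 < δ) (hγ : 0 < γ) {ψ : Rn n → ℝ}
    (hψ : PsiKernel n C₁ C₂ δ γ ψ) {g h : Rn n → ℝ} (hg : Integrable g) (hh : Integrable h)
    (S : Set ℝ) (x : Rn n) :
    Gs ψ S (fun y => g y + h y) x ≤ Gs ψ S g x + Gs ψ S h x := by
  have hψm := hψ.measurable hγ
  have e : eLpNorm (fun t => cvl ψ t (fun y => g y + h y) x) 2 (nu.restrict S) =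
      eLpNorm ((fun t => cvl ψ t g x) + (fun t => cvl ψ t h x)) 2 (nu.restrict S) := by
    apply eLpNorm_congr_ae
    filter_upwards [ae_restrict_of_ae nu_ae_pos] with t ht
    simp only [Pi.add_apply, cvl_eq_kt]
    rw [← integral_add (integrable_kt_mul hC₁ hδ hψm hψ.2.2.1 ht hg x)
      (integrable_kt_mul hC₁ hδ hψm hψ.2.2.1 ht hh x)]
    congr 1; ext y; ring
  unfold Gs
  rw [e]
  exact eLpNorm_add_le (measurable_cvl_t hψm hg.1 x).aestronglyMeasurable
    (measurable_cvl_t hψm hh.1 x).aestronglyMeasurable (by norm_num)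

lemma lint_Gs_add_le {C₁ C₂ δ γ : ℝ} (hC₁ : 0 < C₁) (hδ : 0 < δ) (hγ : 0 < γ) {ψ : Rn n → ℝ}
    (hψ : PsiKernel n C₁ C₂ δ γ ψ) {g h : Rn n → ℝ} (hg : Integrable g) (hh : Integrable h)
    (S : Set ℝ) :
    ∫⁻ x, Gs ψ S (fun y => g y + h y) x ≤ (∫⁻ x, Gs ψ S g x) + ∫⁻ x, Gs ψ S h x := by
  rw [← lintegral_add_left (measurable_Gs (hψ.measurable hγ) hg.1 S)]
  exact lintegral_mono fun x => Gs_add_le hC₁ hδ hγ hψ hg hh S x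

lemma Gs_zero (ψ : Rn n → ℝ) (S : Set ℝ) (x : Rn n) : Gs ψ S (fun _ => 0) x = 0 := by
  unfold Gs
  have : (fun t => cvl ψ t (fun _ => 0) x) = 0 := by
    ext t; simp [cvl]
  rw [this]; simp

lemma lint_Gs_sum_le {C₁ C₂ δ γ : ℝ} (hC₁ : 0 < C₁) (hδ : 0 < δ) (hγ : 0 < γ) {ψ : Rn n → ℝ}
    (hψ : PsiKernel n C₁ C₂ δ γ ψ) {ι : Type*} (F : Finset ι) {u : ι → Rn n → ℝ}
    (hu : ∀ i, Integrable (u i)) (S : Set ℝ) :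
    ∫⁻ x, Gs ψ S (fun y => ∑ i ∈ F, u i y) x ≤ ∑ i ∈ F, ∫⁻ x, Gs ψ S (u i) x := by
  classical
  induction F using Finset.induction_on with
  | empty => simp [Gs_zero]
  | insert i F hi ih =>
    simp only [Finset.sum_insert hi]
    refine (lint_Gs_add_le hC₁ hδ hγ hψ (hu i) (integrable_finsetSum F fun j _ => hu j) S).trans ?_
    gcongr

lemma trunc_bound {C₁ C₂ δ γ : ℝ} (hC₁ : 0 < C₁) (hδ : 0 < δ) {ψ : Rn n → ℝ}
    (hψ : PsiKernel n C₁ C₂ δ γ ψ) {ε R : ℝ} (hε : 0 < ε) (hR : 0 < R) :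
    ∃ C : ℝ≥0∞, C ≠ ⊤ ∧ ∀ h : Rn n → ℝ, Integrable h →
      ∫⁻ x, Gs ψ (Ioo ε R) h x ≤ C * ∫⁻ x, ‖h x‖ₑ := by
  set k : Rn n → ℝ := fun z => C₁ * R^δ * (ε + ‖z‖) ^ (-((n:ℝ) + δ)) with hk
  have hki : Integrable k := by
    have := (integrable_bracket_r (n := n) hδ hε 0).const_mul (C₁ * R^δ)
    simpa [hk] using this
  have hkm : Measurable k := by
    rw [hk]
    exact measurable_const.mul (Measurable.pow_const (by fun_prop) _)
  have hnu : nu (Ioo ε R) ≠ ⊤ := by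
    have : nu (Ioo ε R) ≤ ENNReal.ofReal ε⁻¹ * volume (Ioo ε R) := by
      rw [← setLIntegral_one, lintegral_nu_restrict measurableSet_Ioo, ← setLIntegral_const]
      refine (lintegral_mono_set inter_subset_right).trans ?_
      first
        | exact setLIntegral_mono' measurableSet_Ioo (fun t ht => by
            rw [mul_one]; gcongr; exact ht.1.le)
    refine (this.trans_lt ?_).ne
    exact ENNReal.mul_lt_top ENNReal.ofReal_lt_top (by simp)
  set c := nu (Ioo ε R) ^ (1/2:ℝ) with hc
  have hcT : c ≠ ⊤ := (ENNReal.rpow_lt_top_of_nonneg (by norm_num) hnu).ne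
  refine ⟨c * ∫⁻ z, ‖k z‖ₑ, ENNReal.mul_ne_top hcT hki.2.ne, fun h hh => ?_⟩
  have pt : ∀ x, Gs ψ (Ioo ε R) h x ≤ c * ∫⁻ y, ‖k (x - y)‖ₑ * ‖h y‖ₑ := by
    intro x
    have := eLpNorm_le_of_ae_enorm_bound (μ := nu.restrict (Ioo ε R)) (p := 2)
      (f := fun t => cvl ψ t h x) (C := ∫⁻ y, ‖k (x - y)‖ₑ * ‖h y‖ₑ) (by
        filter_upwards [ae_restrict_mem measurableSet_Ioo] with t ht
        rw [cvl_eq_kt]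
        refine (enorm_integral_le_lintegral_enorm _).trans ?_
        apply lintegral_mono
        intro y
        show ‖kt ψ t (x - y) * h y‖ₑ ≤ ‖k (x - y)‖ₑ * ‖h y‖ₑ
        rw [enorm_mul]
        gcongr
        rw [← ofReal_norm, ← ofReal_norm]
        apply ENNReal.ofReal_le_ofReal
        have ht0 : 0 < t := hε.trans ht.1
        have hk0 : 0 ≤ k (x - y) := by rw [hk]; positivity
        rw [Real.norm_of_nonneg hk0, Real.norm_eq_abs]
        refine (kt_le hψ.2.2.1 ht0 _).trans ?_
        show _ ≤ C₁ * R^δ * (ε + ‖x - y‖) ^ (-((n:ℝ) + δ))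
        have h1 : t^δ ≤ R^δ := Real.rpow_le_rpow ht0.le ht.2.le hδ.le
        have h2 : (t + ‖x - y‖) ^ (-((n:ℝ) + δ)) ≤ (ε + ‖x - y‖) ^ (-((n:ℝ) + δ)) :=
          Real.rpow_le_rpow_of_nonpos (by positivity) (by linarith [ht.1])
            (by linarith [n.cast_nonneg (α := ℝ)])
        gcongr)
    refine this.trans_eq ?_
    rw [smul_eq_mul, mul_comm, hc, Measure.restrict_apply_univ]
    norm_num
  calc _ ≤ ∫⁻ x, c * ∫⁻ y, ‖k (x - y)‖ₑ * ‖h y‖ₑ := lintegral_mono pt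
    _ = c * ∫⁻ x, ∫⁻ y, ‖k (x - y)‖ₑ * ‖h y‖ₑ := lintegral_const_mul' _ _ hcT
    _ = c * ∫⁻ y, ∫⁻ x, ‖k (x - y)‖ₑ * ‖h y‖ₑ := by
        congr 1
        apply lintegral_lintegral_swap
        refine AEMeasurable.mul (f := fun p : Rn n × Rn n => ‖k (p.1 - p.2)‖ₑ)
          (g := fun p : Rn n × Rn n => ‖h p.2‖ₑ) ?_ ?_
        · exact ((hkm.comp (measurable_fst.sub measurable_snd)).enorm).aemeasurable
        · exact hh.1.enorm.comp_snd
    _ = c * ∫⁻ y, (∫⁻ z, ‖k z‖ₑ) * ‖h y‖ₑ := by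
        congr 2; ext y
        rw [lintegral_mul_const' _ _ (by simp), lintegral_sub_right_eq_self (fun x => ‖k x‖ₑ) y]
    _ = _ := by rw [lintegral_const_mul' _ _ hki.2.ne, mul_assoc]

lemma lint_Gs_limit {γ C₁ C₂ δ : ℝ} (hγ : 0 < γ) {ψ : Rn n → ℝ}
    (hψ : PsiKernel n C₁ C₂ δ γ ψ) {h : Rn n → ℝ} (hh : Integrable h) {K : ℝ≥0∞}
    (hK : ∀ m : ℕ, ∫⁻ x, Gs ψ (Ioo (1/((m:ℝ)+1)) (m+1)) h x ≤ K) : ∫⁻ x, Gs ψ univ h x ≤ K := by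
  have hψm := hψ.measurable hγ
  set I : ℕ → Set ℝ := fun m => Ioo (1/((m:ℝ)+1)) (m+1) with hI
  have hmono : Monotone I := by
    intro m m' hmm
    have : (m:ℝ) ≤ m' := by exact_mod_cast hmm
    apply Ioo_subset_Ioo
    · gcongr
    · linarith
  have hun : ⋃ m, I m = Ioi 0 := by
    ext t
    simp only [mem_iUnion, hI, mem_Ioo, mem_Ioi]
    constructor
    · rintro ⟨m, h1, h2⟩
      exact lt_trans (by positivity) h1
    · intro ht
      obtain ⟨m, hm⟩ := exists_nat_gt (max t t⁻¹)
      have h1 := (le_max_left _ _).trans_lt hm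
      have h2 := (le_max_right _ _).trans_lt hm
      refine ⟨m, ?_, by linarith⟩
      rw [div_lt_comm₀ (by positivity) ht, one_div]; linarith
  have pt : ∀ x, Gs ψ univ h x ≤ ⨆ m, Gs ψ (I m) h x := by
    intro x
    have e : (Gs ψ univ h x)^2 = ⨆ m, (Gs ψ (I m) h x)^2 := by
      simp only [Gs, eLpNorm_two_sq]
      rw [← setLIntegral_iUnion_of_directed _ (hmono.directed_le), hun, Measure.restrict_univ]
      have hp : ∀ᵐ t ∂nu, t ∈ Ioi (0:ℝ) := nu_ae_pos
      rw [Measure.restrict_eq_self_of_ae_mem hp]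
    have : (Gs ψ univ h x)^2 ≤ (⨆ m, Gs ψ (I m) h x)^2 := by
      rw [e]
      apply iSup_le
      intro m
      gcongr
      exact le_iSup (fun m => Gs ψ (I m) h x) m
    exact (ENNReal.pow_le_pow_left_iff two_ne_zero).1 this
  calc _ ≤ ∫⁻ x, ⨆ m, Gs ψ (I m) h x := lintegral_mono pt
    _ = ⨆ m, ∫⁻ x, Gs ψ (I m) h x := by
        apply lintegral_iSup
        · intro m; exact measurable_Gs hψm hh.1 _
        · intro m m' hmm x; exact Gs_mono_set _ _ (hmono hmm) x
    _ ≤ K := iSup_le hK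

/-- The localized oscillation of `f` on `E`. -/
def ub (f : Rn n → ℝ) (E : Set (Rn n)) : Rn n → ℝ := E.indicator (fun x => f x - avg f E)

lemma integrable_ub {f : Rn n → ℝ} {E : Set (Rn n)} (hE : MeasurableSet E) (hfin : volume E ≠ ⊤)
    (hf : IntegrableOn f E) : Integrable (ub f E) := by
  unfold ub
  rw [integrable_indicator_iff hE]
  exact hf.sub (integrableOn_const hfin)

lemma integral_ub {f : Rn n → ℝ} {E : Set (Rn n)} (hE : MeasurableSet E) (hfin : volume E ≠ ⊤)
    (h0 : volume E ≠ 0) (hf : IntegrableOn f E) : ∫ x, ub f E x = 0 := by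
  unfold ub
  have hcI : IntegrableOn (fun _ : Rn n => avg f E) E := integrableOn_const hfin
  have hm : 0 < (volume E).toReal := ENNReal.toReal_pos h0 hfin
  rw [integral_indicator hE, integral_sub hf hcI, setIntegral_const, avg, Measure.real, smul_eq_mul]
  field_simp
  ring

lemma cz_step {C₁ C₂ δ γ : ℝ} (hC₁ : 0 < C₁)
    (hδ : 0 < δ) (hγ : 0 < γ) {ψ : Rn n → ℝ} (hψ : PsiKernel n C₁ C₂ δ γ ψ) {C : ℝ}
    (hatom : ∀ (g : Rn n → ℝ) (c : Rn n) (R H : ℝ), 0 < R → 0 < H → Integrable g →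
      (∀ᵐ x, |g x| ≤ H) → (∀ x, x ∉ ball c R → g x = 0) → ∫ y, g y = 0 →
      ∫⁻ x, Gs ψ univ g x ≤ ENNReal.ofReal (C * H * R^n))
    {S : Set ℝ} {D : ℝ≥0∞} (hD : D ≠ ⊤)
    (htr : ∀ h : Rn n → ℝ, Integrable h → ∫⁻ x, Gs ψ S h x ≤ D * ∫⁻ x, ‖h x‖ₑ)
    {ι : Type} [Countable ι] {P : ι → Set (Rn n)} {Q : Set (Rn n)} {f : Rn n → ℝ} {c : Rn n}
    {R H : ℝ} (hR : 0 < R) (hH : 0 < H) (hQ : MeasurableSet Q) (hQb : Q ⊆ ball c R)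
    (hQ0 : volume Q ≠ 0) (hf : IntegrableOn f Q)
    (hP : ∀ i, MeasurableSet (P i)) (hPd : Pairwise (fun i j => Disjoint (P i) (P j)))
    (hPQ : ∀ i, P i ⊆ Q) (hP0 : ∀ i, volume (P i) ≠ 0)
    (hsum : ∑' i, ∫⁻ x, ‖ub f (P i) x‖ₑ ≠ ⊤)
    (h1 : ∀ i, |avg f (P i) - avg f Q| ≤ H)
    (h2 : ∀ᵐ x, x ∈ Q → x ∉ ⋃ i, P i → |f x - avg f Q| ≤ H) :
    ∫⁻ x, Gs ψ S (ub f Q) x ≤ ENNReal.ofReal (C * H * R^n) + ∑' i, ∫⁻ x, Gs ψ S (ub f (P i)) x := by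
  classical
  have hQfin : volume Q ≠ ⊤ := (measure_mono hQb |>.trans_lt measure_ball_lt_top).ne
  have hPfin : ∀ i, volume (P i) ≠ ⊤ := fun i => ((measure_mono (hPQ i)).trans_lt hQfin.lt_top).ne
  have hui : ∀ i, Integrable (ub f (P i)) := fun i =>
    integrable_ub (hP i) (hPfin i) (hf.mono_set (hPQ i))
  have huQ : Integrable (ub f Q) := integrable_ub hQ hQfin hf
  set b : Rn n → ℝ := fun x => ∑' i, ub f (P i) x with hb
  have hin : ∀ i x, x ∈ P i → ∀ j, j ≠ i → ub f (P j) x = 0 := by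
    intro i x hx j hj
    unfold ub
    rw [indicator_of_notMem]
    intro hx'
    exact (hPd hj).le_bot ⟨hx', hx⟩
  have hout : ∀ x, x ∉ ⋃ i, P i → ∀ j, ub f (P j) x = 0 := by
    intro x hx j
    unfold ub
    rw [indicator_of_notMem]
    intro hx'
    exact hx (mem_iUnion.2 ⟨j, hx'⟩)
  have hsm : ∀ x, Summable (fun i => ub f (P i) x) := by
    intro x
    by_cases hx : x ∈ ⋃ i, P i
    · obtain ⟨i, hi⟩ := mem_iUnion.1 hx
      exact (hasSum_single i (hin i x hi)).summable
    · have : (fun i => ub f (P i) x) = fun _ => 0 := by ext i; exact hout x hx i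
      rw [this]; exact summable_zero
  have hbin : ∀ i x, x ∈ P i → b x = f x - avg f (P i) := by
    intro i x hx
    simp only [hb]
    rw [tsum_eq_single i (hin i x hx)]
    unfold ub
    rw [indicator_of_mem hx]
  have hbout : ∀ x, x ∉ ⋃ i, P i → b x = 0 := by
    intro x hx
    simp only [hb]
    have : (fun i => ub f (P i) x) = fun _ => 0 := by ext i; exact hout x hx i
    rw [this, tsum_zero]
  have hbe : ∫⁻ x, ‖b x‖ₑ ≤ ∑' i, ∫⁻ x, ‖ub f (P i) x‖ₑ := by
    rw [← lintegral_tsum (fun i => (hui i).1.enorm)]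
    exact lintegral_mono fun x => enorm_tsum_le_tsum_enorm
  have hbi : Integrable b := by
    refine ⟨(AEMeasurable.tsum fun i => (hui i).1.aemeasurable).aestronglyMeasurable, ?_⟩
    exact hbe.trans_lt hsum.lt_top
  have hb0 : ∫ x, b x = 0 := by
    rw [hb, integral_tsum (fun i => (hui i).1) hsum]
    simp [fun i => integral_ub (hP i) (hPfin i) (hP0 i) (hf.mono_set (hPQ i))]
  set g : Rn n → ℝ := fun x => ub f Q x - b x with hg
  have hgi : Integrable g := huQ.sub hbi
  have hg0 : ∫ x, g x = 0 := by
    rw [hg, integral_sub huQ hbi, hb0, integral_ub hQ hQfin hQ0 hf, sub_zero]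
  have hUQ : (⋃ i, P i) ⊆ Q := iUnion_subset hPQ
  have hgb : ∀ᵐ x, |g x| ≤ H := by
    filter_upwards [h2] with x hx
    by_cases hxU : x ∈ ⋃ i, P i
    · obtain ⟨i, hi⟩ := mem_iUnion.1 hxU
      have : g x = avg f (P i) - avg f Q := by
        simp only [hg]
        rw [hbin i x hi, ub, indicator_of_mem (hUQ hxU)]
        ring
      rw [this]; exact h1 i
    · by_cases hxQ : x ∈ Q
      · have : g x = f x - avg f Q := by
          simp only [hg]
          rw [hbout x hxU, ub, indicator_of_mem hxQ]
          ring
        rw [this]; exact hx hxQ hxU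
      · have : g x = 0 := by
          simp only [hg]
          rw [hbout x hxU, ub, indicator_of_notMem hxQ]
          ring
        rw [this]; simpa using hH.le
  have hgs : ∀ x, x ∉ ball c R → g x = 0 := by
    intro x hx
    have hxQ : x ∉ Q := fun h => hx (hQb h)
    simp only [hg]
    rw [hbout x (fun h => hxQ (hUQ h)), ub, indicator_of_notMem hxQ, sub_zero]
  have hga : ∫⁻ x, Gs ψ S g x ≤ ENNReal.ofReal (C * H * R^n) :=
    (lintegral_mono fun x => Gs_mono_set ψ g (subset_univ S) x).trans
      (hatom g c R H hR hH hgi hgb hgs hg0)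
  -- finite sums
  have hF : ∀ F : Finset ι, ∫⁻ x, Gs ψ S (ub f Q) x ≤ ENNReal.ofReal (C * H * R^n) +
      (∑' i, ∫⁻ x, Gs ψ S (ub f (P i)) x) + D * ∑' i : {i // i ∉ F}, ∫⁻ x, ‖ub f (P i) x‖ₑ := by
    intro F
    set v : Rn n → ℝ := fun x => b x - ∑ i ∈ F, ub f (P i) x with hv
    have hsi : Integrable (fun x => ∑ i ∈ F, ub f (P i) x) := integrable_finsetSum F fun j _ => hui j
    have hvi : Integrable v := hbi.sub hsi
    have e : ub f Q = fun x => (g x + ∑ i ∈ F, ub f (P i) x) + v x := by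
      ext x; simp only [hg, hv]; ring
    have hve : ∫⁻ x, ‖v x‖ₑ ≤ ∑' i : {i // i ∉ F}, ∫⁻ x, ‖ub f (P i) x‖ₑ := by
      rw [← lintegral_tsum (fun i : {i // i ∉ F} => (hui i).1.enorm)]
      apply lintegral_mono
      intro x
      have : v x = ∑' i : {i // i ∉ F}, ub f (P i) x := by
        have := (hsm x).sum_add_tsum_compl (s := F)
        simp only [hv, hb]
        rw [← this]
        simp
        rfl
      show ‖v x‖ₑ ≤ _
      rw [this]
      exact enorm_tsum_le_tsum_enorm
    calc ∫⁻ x, Gs ψ S (ub f Q) x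
        ≤ (∫⁻ x, Gs ψ S (fun y => g y + ∑ i ∈ F, ub f (P i) y) x) + ∫⁻ x, Gs ψ S v x := by
          conv_lhs => rw [e]
          exact lint_Gs_add_le hC₁ hδ hγ hψ (hgi.add hsi) hvi S
      _ ≤ ((∫⁻ x, Gs ψ S g x) + ∫⁻ x, Gs ψ S (fun y => ∑ i ∈ F, ub f (P i) y) x)
            + ∫⁻ x, Gs ψ S v x := by
          gcongr
          exact lint_Gs_add_le hC₁ hδ hγ hψ hgi hsi S
      _ ≤ _ := by
          refine add_le_add (add_le_add hga ?_) ((htr v hvi).trans (mul_le_mul_right hve D))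
          exact (lint_Gs_sum_le hC₁ hδ hγ hψ F hui S).trans (ENNReal.sum_le_tsum F)
  have hlim := ENNReal.tendsto_tsum_compl_atTop_zero hsum
  have hlim2 := (ENNReal.Tendsto.const_mul hlim (Or.inr hD)).const_add
    (ENNReal.ofReal (C * H * R^n) + (∑' i, ∫⁻ x, Gs ψ S (ub f (P i)) x))
  rw [mul_zero, add_zero] at hlim2
  exact ge_of_tendsto' hlim2 hF

lemma lint_ub {f : Rn n → ℝ} {E : Set (Rn n)} (hE : MeasurableSet E) (hfin : volume E ≠ ⊤)
    (hf : IntegrableOn f E) :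
    ∫⁻ x, ‖ub f E x‖ₑ = ENNReal.ofReal (∫ x in E, |f x - avg f E|) := by
  rw [← ofReal_integral_norm_eq_lintegral_enorm (integrable_ub hE hfin hf)]
  congr 1
  rw [← integral_indicator hE]
  congr 1
  ext x
  unfold ub
  by_cases h : x ∈ E <;> simp [h]

lemma local_bound (hn : 1 ≤ n) {C₁ C₂ δ γ : ℝ} (hC₁ : 0 < C₁) (hC₂ : 0 < C₂)
    (hδ : 0 < δ) (hγ : 0 < γ) {ψ : Rn n → ℝ} (hψ : PsiKernel n C₁ C₂ δ γ ψ) :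
    ∃ C0 : ℝ, 0 ≤ C0 ∧ ∀ (ω : Rn n → ℝ) (_ : IsWeight ω) (f : Rn n → ℝ)
    (_ : LocallyIntegrable f volume) (A M : ℝ) (_ : 0 < A) (_ : 0 < M)
    (_ : ∀ (a : Rn n) (s : ℝ), 0 < s → ∀ᵐ y ∂(volume.restrict (hc a s)),
      wInt ω (hc a s) ≤ A * s^n * ω y)
    (_ : ∀ (a : Rn n) (s : ℝ), 0 < s →
      ∫ x in hc a s, |f x - avg f (hc a s)| ≤ M * wInt ω (hc a s))
    (a : Rn n) (s : ℝ), 0 < s →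
      ∫⁻ x, Gs ψ univ (ub f (hc a s)) x ≤ ENNReal.ofReal (C0 * A * M * wInt ω (hc a s)) := by
  obtain ⟨C, hC, hatom⟩ := atom_bound hn hC₁ hC₂ hδ hγ hψ
  refine ⟨2 * (C * 2^n * 2 * n^n), by positivity, ?_⟩
  intro ω hω f hf A M hA0 hM hA hosc
  have hn0 : (0:ℝ) < n := by exact_mod_cast hn
  have hvT : ∀ (a : Rn n) (s : ℝ), 0 < s → volume (hc a s) ≠ ⊤ := fun a s hs => by
    rw [volume_hc a hs.le]; exact ENNReal.ofReal_ne_top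
  have hv0 : ∀ (a : Rn n) (s : ℝ), 0 < s → volume (hc a s) ≠ 0 := fun a s hs => by
    rw [volume_hc a hs.le]; simp; positivity
  have hw : ∀ (a : Rn n) (s : ℝ), 0 < s → 0 < wInt ω (hc a s) := fun a s hs =>
    wInt_pos hω (hv0 a s hs) (intOn_hc hn hω.2.1 a s)
  have hw0 : ∀ E, 0 ≤ wInt ω E := fun E => integral_nonneg fun x => hω.1 x
  set q : ℝ := 1 - 1/(2*A) with hq
  have hq0 : 0 ≤ q := by
    obtain ⟨T, -, -, -, -, h⟩ := stopping hn hω hf hA0 hM hA hosc 0 one_pos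
    by_contra hneg
    push Not at hneg
    have h3 := hw 0 1 one_pos
    have h4 := (hw0 _).trans h
    nlinarith [mul_neg_of_neg_of_pos hneg h3]
  have hq1 : q < 1 := by
    have : 0 < 1/(2*A) := by positivity
    rw [hq]; linarith
  set D : ℝ := (C * 2^n * 2 * n^n) * M with hD
  have hD0 : 0 ≤ D := by positivity
  intro a s hs
  apply lint_Gs_limit hγ hψ (integrable_ub (measurableSet_hc a s) (hvT a s hs) (intOn_hc hn hf a s))
  intro m
  set S := Ioo (1/((m:ℝ)+1)) (m+1) with hS
  obtain ⟨Ct, hCt, htr⟩ := trunc_bound hC₁ hδ hψ (ε := 1/((m:ℝ)+1)) (R := m+1)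
    (by positivity) (by positivity)
  rw [← hS] at htr
  have step : ∀ K : ℝ, 0 ≤ K → (∀ (a : Rn n) (s : ℝ), 0 < s →
      ∫⁻ x, Gs ψ S (ub f (hc a s)) x ≤ ENNReal.ofReal (K * wInt ω (hc a s))) →
      ∀ (a : Rn n) (s : ℝ), 0 < s →
      ∫⁻ x, Gs ψ S (ub f (hc a s)) x ≤ ENNReal.ofReal ((D + q * K) * wInt ω (hc a s)) := by
    intro K hK hKb a s hs
    obtain ⟨T, hTQ, hTd, hT1, hT2, hTw⟩ := stopping hn hω hf hA0 hM hA hosc a hs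
    have hsp : ∀ p : T, 0 < s / 2^p.1.1 := fun p => by positivity
    have hTd' : Pairwise (fun i j : T => Disjoint (dc a s i) (dc a s j)) := by
      intro i j hij
      exact hTd i.2 j.2 (fun h => hij (Subtype.ext h))
    have hUe : (⋃ p ∈ T, dc a s p) = ⋃ p : T, dc a s p := by
      rw [iUnion_subtype]
    have hUQ : (⋃ p : T, dc a s p) ⊆ hc a s := iUnion_subset fun p => hTQ p p.2
    have hsumw : HasSum (fun p : T => wInt ω (dc a s p)) (wInt ω (⋃ p : T, dc a s p)) :=
      hasSum_integral_iUnion (fun p => measurableSet_dc a s p) hTd'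
        ((intOn_hc hn hω.2.1 a s).mono_set hUQ)
    have htsum : ∀ L : ℝ, 0 ≤ L → ∑' p : T, ENNReal.ofReal (L * wInt ω (dc a s p)) =
        ENNReal.ofReal (L * wInt ω (⋃ p : T, dc a s p)) := by
      intro L hL
      rw [← ENNReal.ofReal_tsum_of_nonneg (fun p => mul_nonneg hL (hw0 _)) (hsumw.mul_left L).summable,
        (hsumw.mul_left L).tsum_eq]
    have hwQ := hw a s hs
    have key := cz_step hC₁ hδ hγ hψ hatom (S := S) hCt htr (P := fun p : T => dc a s p)
      (Q := hc a s) (f := f) (c := a) (R := n * s) (H := 2^n * (2 * M * wInt ω (hc a s) / s^n))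
      (by positivity) (by positivity) (measurableSet_hc a s)
      (hc_subset_ball hn (mem_hc_self a hs)) (hv0 a s hs) (intOn_hc hn hf a s)
      (fun p => measurableSet_dc a s p) hTd' (fun p => hTQ p p.2)
      (fun p => hv0 _ _ (hsp p))
      (by
        have hle : ∑' p : T, ∫⁻ x, ‖ub f (dc a s p) x‖ₑ ≤
            ∑' p : T, ENNReal.ofReal (M * wInt ω (dc a s p)) := by
          apply ENNReal.tsum_le_tsum
          intro p
          rw [lint_ub (measurableSet_dc a s p) (hvT _ _ (hsp p)) (intOn_hc hn hf _ _)]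
          exact ENNReal.ofReal_le_ofReal (hosc _ _ (hsp p))
        rw [htsum M hM.le] at hle
        exact (hle.trans_lt ENNReal.ofReal_lt_top).ne)
      (fun p => hT1 p p.2) (by rw [← hUe]; exact hT2)
    refine key.trans ?_
    have e1 : C * (2^n * (2 * M * wInt ω (hc a s) / s^n)) * ((n:ℝ) * s)^n = D * wInt ω (hc a s) := by
      rw [hD, mul_pow]; field_simp
    rw [e1]
    have h2 : ∑' p : T, ∫⁻ x, Gs ψ S (ub f (dc a s p)) x ≤
        ENNReal.ofReal (K * (q * wInt ω (hc a s))) := by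
      refine (ENNReal.tsum_le_tsum fun p => hKb _ _ (hsp p)).trans ?_
      refine (htsum K hK).le.trans ?_
      apply ENNReal.ofReal_le_ofReal
      apply mul_le_mul_of_nonneg_left _ hK
      rw [← hUe]; exact hTw
    refine (add_le_add le_rfl h2).trans_eq ?_
    rw [← ENNReal.ofReal_add (by positivity) (by positivity)]
    congr 1; ring
  set K0 : ℝ := Ct.toReal * M with hK0
  have hK00 : 0 ≤ K0 := by positivity
  have all : ∀ j : ℕ, ∀ (a : Rn n) (s : ℝ), 0 < s →
      ∫⁻ x, Gs ψ S (ub f (hc a s)) x ≤ ENNReal.ofReal ((2*A*D + q^j * K0) * wInt ω (hc a s)) := by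
    intro j
    induction j with
    | zero =>
      intro a s hs
      refine (htr _ (integrable_ub (measurableSet_hc a s) (hvT a s hs) (intOn_hc hn hf a s))).trans ?_
      rw [lint_ub (measurableSet_hc a s) (hvT _ _ hs) (intOn_hc hn hf _ _)]
      rw [← ENNReal.ofReal_toReal hCt, ← ENNReal.ofReal_mul (by positivity)]
      apply ENNReal.ofReal_le_ofReal
      have h1 := mul_le_mul_of_nonneg_left (hosc a s hs) (ENNReal.toReal_nonneg (a := Ct))
      have h3 : 0 ≤ 2*A*D*wInt ω (hc a s) := by have := hw a s hs; positivity
      rw [hK0]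
      calc _ ≤ _ := h1
        _ ≤ _ := by rw [pow_zero]; linarith
    | succ j ih =>
      intro a s hs
      refine (step _ (by positivity) ih a s hs).trans_eq ?_
      congr 2
      have hqA : 2*A*q = 2*A - 1 := by rw [hq]; field_simp
      rw [pow_succ]
      linear_combination D * hqA
  have lim : Filter.Tendsto (fun j : ℕ => ENNReal.ofReal ((2*A*D + q^j * K0) * wInt ω (hc a s)))
      Filter.atTop (nhds (ENNReal.ofReal ((2*A*D + 0 * K0) * wInt ω (hc a s)))) := by
    apply ENNReal.tendsto_ofReal
    exact (((tendsto_pow_atTop_nhds_zero_of_lt_one hq0 hq1).mul_const K0).const_add _).mul_const _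
  refine (ge_of_tendsto' lim (fun j => all j a s hs)).trans_eq ?_
  congr 1; rw [hD]; ring

/-- Standing hypotheses. -/
structure Hyp (ω f : Rn n → ℝ) (A N : ℝ) : Prop where
  hn : 1 ≤ n
  hω : IsWeight ω
  hA : A1ballBound ω A
  hf : LocallyIntegrable f volume
  hN : 0 < N
  hosc : ∀ c r, 0 < r → ∫ x in ball c r, |f x - avg f (ball c r)| ≤ N * wInt ω (ball c r)

lemma Hyp.wpos {ω f : Rn n → ℝ} {A N : ℝ} (H : Hyp ω f A N) (c : Rn n) {r : ℝ} (hr : 0 < r) :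
    0 < wInt ω (ball c r) :=
  wInt_pos H.hω (measure_ball_pos _ _ hr).ne' (intOn_ball H.hω.2.1 c r)

lemma Hyp.dbl {ω f : Rn n → ℝ} {A N : ℝ} (H : Hyp ω f A N) (c : Rn n) {r l : ℝ} (hr : 0 < r)
    (hl : 1 ≤ l) : wInt ω (ball c (l * r)) ≤ l^n * A * wInt ω (ball c r) := by
  have hl0 : 0 < l := by linarith
  have h := A1_sub H.hω H.hA c (r := l * r) (by positivity) (ball_subset_ball (x := c) (by nlinarith : r ≤ l * r))
  rw [vol_ball H.hn c hr.le, vol_ball H.hn c (by positivity), mul_pow] at h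
  have hV := VV_pos (n := n)
  have hp : 0 < r^n * VV n := by positivity
  have : wInt ω (ball c (l * r)) * (r^n * VV n) ≤ (l^n * A * wInt ω (ball c r)) * (r^n * VV n) := by
    linarith
  exact le_of_mul_le_mul_right this hp

lemma Hyp.intC {ω f : Rn n → ℝ} {A N : ℝ} (H : Hyp ω f A N) (c : Rn n) (r k : ℝ) :
    IntegrableOn (fun x => |f x - k|) (ball c r) := by
  have hcI : IntegrableOn (fun _ : Rn n => k) (ball c r) := integrableOn_const measure_ball_lt_top.ne
  exact ((intOn_ball H.hf c r).sub hcI).abs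

lemma Hyp.avg_step {ω f : Rn n → ℝ} {A N : ℝ} (H : Hyp ω f A N) (c : Rn n) {r : ℝ} (hr : 0 < r)
    (k : ℕ) : |avg f (ball c (2^k * r)) - avg f (ball c r)| ≤
      k * (N * 2^n * A * wInt ω (ball c r) / (r^n * VV n)) := by
  have hV := VV_pos (n := n)
  induction k with
  | zero => simp
  | succ k ih =>
    have hk : (0:ℝ) < 2^k * r := by positivity
    have h1 := avg_dev measure_ball_lt_top.ne (measure_ball_pos volume c hk).ne'
      (intOn_ball H.hf c (2^k*r)) (avg f (ball c (2^(k+1) * r)))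
    have h2 : ∫ x in ball c (2^k*r), |f x - avg f (ball c (2^(k+1) * r))| ≤
        ∫ x in ball c (2^(k+1)*r), |f x - avg f (ball c (2^(k+1) * r))| := by
      apply setIntegral_mono_set (H.intC _ _ _) (Filter.Eventually.of_forall fun x => abs_nonneg _)
      apply HasSubset.Subset.eventuallyLE
      apply ball_subset_ball
      rw [pow_succ]; nlinarith
    have h3 := H.hosc c (2^(k+1)*r) (by positivity)
    have h4 := H.dbl c (l := 2^(k+1)) hr (one_le_pow₀ (by norm_num))
    have h5 := mul_le_mul_of_nonneg_left h4 H.hN.le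
    rw [vol_ball H.hn c hk.le] at h1
    have h6 : |avg f (ball c (2^k * r)) - avg f (ball c (2^(k+1) * r))| ≤
        N * 2^n * A * wInt ω (ball c r) / (r^n * VV n) := by
      rw [le_div_iff₀ (by positivity)]
      have hp : (0:ℝ) < (2^k)^n := by positivity
      have : |avg f (ball c (2^k * r)) - avg f (ball c (2^(k+1) * r))| * (r^n * VV n) * (2^k)^n ≤
        (N * 2^n * A * wInt ω (ball c r)) * (2^k)^n := by
        have e : ((2:ℝ)^(k+1))^n = (2^k)^n * 2^n := by rw [pow_succ, mul_pow]
        rw [e] at h5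
        rw [mul_pow] at h1
        linarith
      exact le_of_mul_le_mul_right this hp
    have h7 := abs_sub_le (avg f (ball c (2^(k+1) * r))) (avg f (ball c (2^k * r))) (avg f (ball c r))
    rw [abs_sub_comm (avg f (ball c (2^(k+1) * r))) (avg f (ball c (2^k * r)))] at h7
    push_cast
    linarith

lemma Hyp.int_k {ω f : Rn n → ℝ} {A N : ℝ} (H : Hyp ω f A N) (c : Rn n) {r : ℝ} (hr : 0 < r)
    (k : ℕ) : ∫ x in ball c (2^k * r), |f x - avg f (ball c r)| ≤
      (2^k)^n * (k+1) * (N * 2^n * A * wInt ω (ball c r)) := by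
  have hV := VV_pos (n := n)
  have hk : (0:ℝ) < 2^k * r := by positivity
  have hcI : IntegrableOn (fun _ : Rn n => |avg f (ball c (2^k * r)) - avg f (ball c r)|)
    (ball c (2^k*r)) := integrableOn_const measure_ball_lt_top.ne
  have h1 : ∫ x in ball c (2^k * r), |f x - avg f (ball c r)| ≤
      ∫ x in ball c (2^k * r), (|f x - avg f (ball c (2^k * r))| +
        |avg f (ball c (2^k * r)) - avg f (ball c r)|) := by
    apply integral_mono (H.intC _ _ _) ((H.intC _ _ _).add hcI)
    intro x
    exact abs_sub_le _ _ _
  rw [integral_add (H.intC _ _ _) hcI, setIntegral_const, smul_eq_mul, Measure.real,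
    vol_ball H.hn c hk.le] at h1
  have h2 := H.avg_step c hr k
  have h3 := H.hosc c _ hk
  have h4 := H.dbl c (l := 2^k) hr (one_le_pow₀ (by norm_num))
  have h5 := mul_le_mul_of_nonneg_left h4 H.hN.le
  have h6 : (2^k*r)^n * VV n * |avg f (ball c (2^k * r)) - avg f (ball c r)| ≤
      (2^k)^n * k * (N * 2^n * A * wInt ω (ball c r)) := by
    refine (mul_le_mul_of_nonneg_left h2 (by positivity)).trans_eq ?_
    rw [mul_pow]; field_simp
  have hw := H.wpos c hr
  have hA := H.hA.1
  have hN := H.hN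
  have h7 : N * ((2^k)^n * A * wInt ω (ball c r)) ≤ (2^k)^n * (N * 2^n * A * wInt ω (ball c r)) := by
    have : (0:ℝ) ≤ N * ((2^k)^n * A * wInt ω (ball c r)) := by positivity
    have h2n : (1:ℝ) ≤ 2^n := one_le_pow₀ (by norm_num)
    nlinarith
  linarith

lemma exists_k {c y : Rn n} {r : ℝ} (hr : 0 < r) :
    ∃ k : ℕ, y ∈ ball c (2^k * r) ∧ 2^k * r / 2 ≤ r + ‖y - c‖ := by
  have hex : ∃ k : ℕ, ‖y - c‖ < 2^k * r := by
    obtain ⟨k, hk⟩ := pow_unbounded_of_one_lt (‖y - c‖ / r) (one_lt_two)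
    exact ⟨k, by rwa [div_lt_iff₀ hr] at hk⟩
  classical
  refine ⟨Nat.find hex, by rw [mem_ball, dist_eq_norm]; exact Nat.find_spec hex, ?_⟩
  rcases Nat.eq_zero_or_pos (Nat.find hex) with h | h
  · rw [h]; have := norm_nonneg (y - c); simp; linarith
  · obtain ⟨j, hj⟩ := Nat.exists_eq_succ_of_ne_zero h.ne'
    have := Nat.find_min hex (m := j) (by omega)
    rw [hj, Nat.succ_eq_add_one, pow_succ]
    push Not at this
    linarith

/-- Tail constant. -/
def TC (n : ℕ) (η : ℝ) : ℝ := 2^((n:ℝ)+η) * 2^n * ∑' k : ℕ, ((k:ℝ)+1) * ((2:ℝ)^(-η))^k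

lemma TC_nonneg (n : ℕ) (η : ℝ) : 0 ≤ TC n η := by
  unfold TC
  have : 0 ≤ ∑' k : ℕ, ((k:ℝ)+1) * ((2:ℝ)^(-η))^k := tsum_nonneg fun k => by positivity
  positivity

lemma TC_summable {η : ℝ} (hη : 0 < η) : Summable (fun k : ℕ => ((k:ℝ)+1) * ((2:ℝ)^(-η))^k) := by
  have hx : ‖(2:ℝ)^(-η)‖ < 1 := by
    rw [Real.norm_of_nonneg (by positivity)]
    exact Real.rpow_lt_one_of_one_lt_of_neg (by norm_num) (by linarith)
  have h1 := summable_pow_mul_geometric_of_norm_lt_one 1 hx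
  have h0 := summable_pow_mul_geometric_of_norm_lt_one 0 hx
  refine (h1.add h0).congr fun k => ?_
  simp; ring

lemma Hyp.tail_lint {ω f : Rn n → ℝ} {A N : ℝ} (H : Hyp ω f A N) {η : ℝ} (hη : 0 < η) (c : Rn n)
    {r : ℝ} (hr : 0 < r) :
    ∫⁻ y, ‖(f y - avg f (ball c r)) * (r + ‖y - c‖)^(-((n:ℝ)+η))‖ₑ ≤
      ENNReal.ofReal (TC n η * (A * N) * r^(-η) * (wInt ω (ball c r) / r^n)) := by
  set b := avg f (ball c r) with hb
  set w := wInt ω (ball c r) with hw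
  have hw0 : 0 < w := H.wpos c hr
  have hA := H.hA.1
  have hN := H.hN
  have hp : -((n:ℝ)+η) ≤ 0 := by have := n.cast_nonneg (α := ℝ); linarith
  set a : ℕ → ℝ := fun k => (2^k * r / 2)^(-((n:ℝ)+η)) with ha
  have ha0 : ∀ k, 0 ≤ a k := fun k => by simp only [ha]; positivity
  have hfm : AEMeasurable (fun y => ‖f y - b‖ₑ) :=
    (H.hf.aestronglyMeasurable.sub aestronglyMeasurable_const).enorm
  have hB : ∀ k : ℕ, MeasurableSet (ball c (2^k * r)) := fun k => measurableSet_ball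
  have pt : ∀ y, ‖(f y - b) * (r + ‖y - c‖)^(-((n:ℝ)+η))‖ₑ ≤
      ∑' k : ℕ, (ball c (2^k * r)).indicator (fun y => ENNReal.ofReal (a k) * ‖f y - b‖ₑ) y := by
    intro y
    obtain ⟨k, hk1, hk2⟩ := exists_k (c := c) (y := y) hr
    refine le_trans ?_ (ENNReal.le_tsum k)
    rw [indicator_of_mem hk1, enorm_mul, mul_comm]
    gcongr
    rw [Real.enorm_eq_ofReal (by positivity)]
    apply ENNReal.ofReal_le_ofReal
    exact Real.rpow_le_rpow_of_nonpos (by positivity) hk2 hp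
  have term : ∀ k : ℕ, ∫⁻ y, (ball c (2^k * r)).indicator (fun y => ENNReal.ofReal (a k) * ‖f y - b‖ₑ) y
      ≤ ENNReal.ofReal (a k * ((2^k)^n * (k+1) * (N * 2^n * A * w))) := by
    intro k
    rw [lintegral_indicator (hB k), lintegral_const_mul' _ _ ENNReal.ofReal_ne_top,
      ENNReal.ofReal_mul (ha0 k)]
    gcongr
    have hi : IntegrableOn (fun x => f x - b) (ball c (2^k * r)) :=
      (intOn_ball H.hf c _).sub (integrableOn_const measure_ball_lt_top.ne)
    rw [← ofReal_integral_norm_eq_lintegral_enorm hi]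
    exact ENNReal.ofReal_le_ofReal (H.int_k c hr k)
  have ek : ∀ k : ℕ, a k * ((2^k)^n * (k+1) * (N * 2^n * A * w)) =
      (2^((n:ℝ)+η) * 2^n * (A * N) * r^(-η) * (w / r^n)) * (((k:ℝ)+1) * ((2:ℝ)^(-η))^k) := by
    intro k
    simp only [ha]
    have e1 : (2^k * r / 2 : ℝ)^(-((n:ℝ)+η)) =
        (((2^k)^n)⁻¹ * ((2:ℝ)^(-η))^k) * ((r^n)⁻¹ * r^(-η)) * 2^((n:ℝ)+η) := by
      rw [Real.div_rpow (by positivity) (by norm_num), Real.mul_rpow (by positivity) hr.le,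
        Real.rpow_neg (by norm_num : (0:ℝ) ≤ 2), div_inv_eq_mul]
      congr 2
      · rw [neg_add, Real.rpow_add (by positivity), Real.rpow_neg (by positivity), Real.rpow_natCast]
        congr 1
        rw [← Real.rpow_natCast, ← Real.rpow_natCast, ← Real.rpow_mul (by norm_num),
          ← Real.rpow_mul (by norm_num), mul_comm]
      · rw [neg_add, Real.rpow_add hr, Real.rpow_neg hr.le, Real.rpow_natCast]
    rw [e1]
    field_simp
  calc _ ≤ ∫⁻ y, ∑' k : ℕ, (ball c (2^k * r)).indicator
            (fun y => ENNReal.ofReal (a k) * ‖f y - b‖ₑ) y := lintegral_mono pt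
    _ = ∑' k : ℕ, ∫⁻ y, (ball c (2^k * r)).indicator (fun y => ENNReal.ofReal (a k) * ‖f y - b‖ₑ) y :=
        lintegral_tsum fun k => (hfm.const_mul _).indicator (hB k)
    _ ≤ ∑' k : ℕ, ENNReal.ofReal (a k * ((2^k)^n * (k+1) * (N * 2^n * A * w))) :=
        ENNReal.tsum_le_tsum term
    _ = _ := by
        simp only [ek]
        rw [← ENNReal.ofReal_tsum_of_nonneg (fun k => by positivity) ((TC_summable hη).mul_left _),
          tsum_mul_left, TC]
        congr 1; ring

lemma Hyp.tail_int {ω f : Rn n → ℝ} {A N : ℝ} (H : Hyp ω f A N) {η : ℝ} (hη : 0 < η) (c : Rn n)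
    {r : ℝ} (hr : 0 < r) :
    Integrable (fun y => (f y - avg f (ball c r)) * (r + ‖y - c‖)^(-((n:ℝ)+η))) := by
  refine ⟨?_, (H.tail_lint hη c hr).trans_lt ENNReal.ofReal_lt_top⟩
  refine (H.hf.aestronglyMeasurable.sub aestronglyMeasurable_const).mul ?_
  exact (Measurable.pow_const (by fun_prop) _).aestronglyMeasurable

lemma Hyp.tail_le {ω f : Rn n → ℝ} {A N : ℝ} (H : Hyp ω f A N) {η : ℝ} (hη : 0 < η) (c : Rn n)
    {r : ℝ} (hr : 0 < r) :
    ∫ y, |f y - avg f (ball c r)| * (r + ‖y - c‖)^(-((n:ℝ)+η)) ≤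
      TC n η * (A * N) * r^(-η) * (wInt ω (ball c r) / r^n) := by
  have hw0 := H.wpos c hr
  have hA := H.hA.1
  have hN := H.hN
  have hT := TC_nonneg n η
  have h := H.tail_lint hη c hr
  rw [← ofReal_integral_norm_eq_lintegral_enorm (H.tail_int hη c hr)] at h
  rw [ENNReal.ofReal_le_ofReal_iff (by positivity)] at h
  refine le_of_eq_of_le ?_ h
  congr 1; ext y
  rw [norm_mul, Real.norm_eq_abs, Real.norm_of_nonneg (by positivity)]

lemma bracket_cmp {t r p κ : ℝ} (hκ : 0 < κ) (hr : 0 < r) (hp : 0 ≤ p) {x y c : Rn n}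
    (h : κ * (r + ‖y - c‖) ≤ t + ‖x - y‖) :
    (t + ‖x - y‖)^(-p) ≤ κ^(-p) * (r + ‖y - c‖)^(-p) := by
  rw [← Real.mul_rpow hκ.le (by positivity)]
  exact Real.rpow_le_rpow_of_nonpos (by positivity) h (by linarith)

lemma dist_aux {r : ℝ} {x y c : Rn n} (hx : x ∈ ball c r) : ‖y - c‖ ≤ ‖x - y‖ + r := by
  rw [mem_ball, dist_eq_norm] at hx
  have : y - c = -(x - y) + (x - c) := by abel
  have h2 := norm_add_le (-(x - y)) (x - c)
  rw [norm_neg] at h2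
  rw [this]; linarith

lemma Hyp.kt_int {ω f : Rn n → ℝ} {A N : ℝ} (H : Hyp ω f A N) {C₁ C₂ δ γ : ℝ} (hC₁ : 0 < C₁)
    (hδ : 0 < δ) (hγ : 0 < γ) {ψ : Rn n → ℝ} (hψ : PsiKernel n C₁ C₂ δ γ ψ) {t : ℝ} (ht : 0 < t)
    {c : Rn n} {r : ℝ} (hr : 0 < r) {x : Rn n} (hx : x ∈ ball c r) :
    Integrable (fun y => kt ψ t (x - y) * (f y - avg f (ball c r))) := by
  have hψm := hψ.measurable hγ
  set κ := min (1/2) (t / (2*r)) with hκ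
  have hκ0 : 0 < κ := by rw [hκ]; positivity
  have hcmp : ∀ y, κ * (r + ‖y - c‖) ≤ t + ‖x - y‖ := by
    intro y
    have h1 := dist_aux (y := y) hx
    have h2 : κ * ‖x - y‖ ≤ 1/2 * ‖x - y‖ := mul_le_mul_of_nonneg_right (min_le_left _ _) (norm_nonneg _)
    have h3 : κ * (2*r) ≤ t / (2*r) * (2*r) := mul_le_mul_of_nonneg_right (min_le_right _ _) (by positivity)
    have h4 : t / (2*r) * (2*r) = t := by field_simp
    have h5 := norm_nonneg (x - y)
    have h6 := mul_le_mul_of_nonneg_left h1 hκ0.le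
    nlinarith
  have hp : 0 ≤ (n:ℝ) + δ := by positivity
  refine Integrable.mono' ((H.tail_int hδ c hr).norm.const_mul (C₁ * t^δ * κ^(-((n:ℝ)+δ)))) ?_ ?_
  · refine AEStronglyMeasurable.mul ?_ (H.hf.aestronglyMeasurable.sub aestronglyMeasurable_const)
    exact ((measurable_kt hψm t).comp (by fun_prop)).aestronglyMeasurable
  · refine Filter.Eventually.of_forall fun y => ?_
    rw [norm_mul, norm_mul, Real.norm_eq_abs, Real.norm_of_nonneg (r := (r + ‖y - c‖) ^ _) (by positivity)]
    have h1 := kt_le hψ.2.2.1 ht (x - y)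
    have h2 := bracket_cmp hκ0 hr hp (hcmp y)
    calc _ ≤ (C₁ * t^δ * (κ^(-((n:ℝ)+δ)) * (r + ‖y - c‖)^(-((n:ℝ)+δ)))) * ‖f y - avg f (ball c r)‖ := by
          apply mul_le_mul_of_nonneg_right _ (norm_nonneg _)
          exact h1.trans (mul_le_mul_of_nonneg_left h2 (by positivity))
      _ = _ := by ring

lemma Hyp.cvl_eq {ω f : Rn n → ℝ} {A N : ℝ} (H : Hyp ω f A N) {C₁ C₂ δ γ : ℝ} (hC₁ : 0 < C₁)
    (hδ : 0 < δ) (hγ : 0 < γ) {ψ : Rn n → ℝ} (hψ : PsiKernel n C₁ C₂ δ γ ψ) {t : ℝ} (ht : 0 < t)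
    {c : Rn n} {r : ℝ} (hr : 0 < r) {x : Rn n} (hx : x ∈ ball c r) :
    cvl ψ t f x = ∫ y, kt ψ t (x - y) * (f y - avg f (ball c r)) := by
  have h1 := H.kt_int hC₁ hδ hγ hψ ht hr hx
  have h2 : Integrable (fun y => kt ψ t (x - y) * avg f (ball c r)) :=
    ((integrable_kt hψ.1 ht).comp_sub_left x).mul_const _
  have h3 : ∫ y, kt ψ t (x - y) * avg f (ball c r) = 0 := by
    rw [integral_mul_const, integral_sub_left_eq_self (kt ψ t) volume x, integral_kt ht, hψ.2.1, zero_mul]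
  rw [cvl_eq_kt, ← add_zero (∫ y, kt ψ t (x - y) * (f y - avg f (ball c r))), ← h3, ← integral_add h1 h2]
  congr 1; ext y; ring

lemma kdiff {C₁ C₂ δ γ : ℝ} (hn : 1 ≤ n) (hC₁ : 0 < C₁) (hC₂ : 0 < C₂)
    (hδ : 0 < δ) (hγ : 0 < γ) {ψ : Rn n → ℝ} (hψ : PsiKernel n C₁ C₂ δ γ ψ) {t r : ℝ} (hr : 0 < r)
    (htr : r ≤ t) {c x x' : Rn n} (hx : x ∈ ball c r) (hx' : x' ∈ ball c r) (y : Rn n) :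
    |kt ψ t (x - y) - kt ψ t (x' - y)| ≤
      (2 * C₁ * 6^((n:ℝ)+γ/2) + C₂ * 2^γ * (1/2:ℝ)^(-((n:ℝ)+γ/2))) * (r/t)^(min (γ/2) 1) * r^(γ/2) *
        (r + ‖y - c‖)^(-((n:ℝ)+γ/2)) := by
  have ht : 0 < t := hr.trans_le htr
  set z := x' - y with hz
  set h := x - x' with hh
  have hzh : x - y = z + h := by rw [hz, hh]; abel
  have hhn : ‖h‖ ≤ 2*r := by
    rw [hh, ← dist_eq_norm]
    have := dist_triangle_right x x' c
    rw [mem_ball] at hx hx'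
    linarith
  have hyc := dist_aux (y := y) hx'
  rw [← hz] at hyc
  have hrt1 : r/t ≤ 1 := by rw [div_le_one ht]; exact htr
  have hrt0 : 0 < r/t := by positivity
  set Y := (r + ‖y - c‖)^(-((n:ℝ)+γ/2)) with hY
  have hY0 : 0 < Y := by rw [hY]; positivity
  set β := min (γ/2) 1 with hβ
  have hp : 0 ≤ (n:ℝ) + γ/2 := by positivity
  have hb1 : (r/t)^(γ/2) ≤ (r/t)^β := Real.rpow_le_rpow_of_exponent_ge hrt0 hrt1 (min_le_left _ _)
  have hb2 : (r/t)^(n:ℝ) ≤ (r/t)^β := Real.rpow_le_rpow_of_exponent_ge hrt0 hrt1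
    ((min_le_right _ _).trans (by exact_mod_cast hn))
  rw [hzh]
  by_cases hzr : 4 * r ≤ ‖z‖
  · have h1 := kt_sub_le hψ.2.2.2 ht z h (by linarith)
    have h2 : ‖h‖^γ ≤ (2*r)^γ := Real.rpow_le_rpow (norm_nonneg _) hhn hγ.le
    have e : (t + ‖z‖)^(-((n:ℝ)+δ+γ)) = (t + ‖z‖)^(-δ) * (t+‖z‖)^(-(γ/2)) * (t + ‖z‖)^(-((n:ℝ)+γ/2)) := by
      rw [← Real.rpow_add (by positivity), ← Real.rpow_add (by positivity)]
      congr 1; ring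
    have h3 : (t + ‖z‖)^(-δ) ≤ t^(-δ) :=
      Real.rpow_le_rpow_of_nonpos ht (by linarith [norm_nonneg z]) (by linarith)
    have h4 : (t + ‖z‖)^(-(γ/2)) ≤ t^(-(γ/2)) :=
      Real.rpow_le_rpow_of_nonpos ht (by linarith [norm_nonneg z]) (by linarith)
    have h5 : (t + ‖z‖)^(-((n:ℝ)+γ/2)) ≤ (1/2:ℝ)^(-((n:ℝ)+γ/2)) * Y :=
      bracket_cmp (by norm_num) hr hp (by rw [← hz]; linarith [norm_nonneg z])
    have e2 : (2*r)^γ = 2^γ * (r^(γ/2) * r^(γ/2)) := by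
      rw [Real.mul_rpow (by norm_num) hr.le, ← Real.rpow_add hr]; congr 2; ring
    have e3 : (r/t)^(γ/2) = r^(γ/2) * t^(-(γ/2)) := by
      rw [Real.div_rpow hr.le ht.le, Real.rpow_neg ht.le, div_eq_mul_inv]
    have e4 : t^δ * t^(-δ) = 1 := by rw [← Real.rpow_add ht]; simp
    set q := (1/2:ℝ)^(-((n:ℝ)+γ/2)) with hq
    have hq0 : 0 < q := by rw [hq]; positivity
    calc _ ≤ C₂ * ‖h‖^γ * t^δ * (t + ‖z‖)^(-((n:ℝ)+δ+γ)) := h1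
      _ ≤ C₂ * (2*r)^γ * t^δ * (t^(-δ) * t^(-(γ/2)) * (q * Y)) := by
          rw [e]; gcongr
      _ = C₂ * 2^γ * q * (r/t)^(γ/2) * r^(γ/2) * Y := by
          rw [e2, e3]; linear_combination (C₂ * (2^γ * (r^(γ/2) * r^(γ/2))) * t^(-(γ/2)) * (q*Y)) * e4
      _ ≤ C₂ * 2^γ * q * (r/t)^β * r^(γ/2) * Y := by gcongr
      _ ≤ _ := by
          gcongr
          have : 0 ≤ 2 * C₁ * 6^((n:ℝ)+γ/2) := by positivity
          linarith
  · push Not at hzr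
    have h1 := kt_bound hC₁ hδ hψ.2.2.1 ht (z + h)
    have h2 := kt_bound hC₁ hδ hψ.2.2.1 ht z
    have h3 : 1 ≤ (6*r)^((n:ℝ)+γ/2) * Y := by
      have : (6*r)^(-((n:ℝ)+γ/2)) ≤ Y :=
        Real.rpow_le_rpow_of_nonpos (by positivity) (by linarith) (by linarith)
      rw [Real.rpow_neg (by positivity)] at this
      rwa [inv_le_iff_one_le_mul₀' (by positivity)] at this
    have e1 : (6*r)^((n:ℝ)+γ/2) = 6^((n:ℝ)+γ/2) * (r^n * r^(γ/2)) := by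
      rw [Real.mul_rpow (by norm_num) hr.le, Real.rpow_add hr, Real.rpow_natCast]
    have e2 : (r/t)^(n:ℝ) = r^n * (t^n)⁻¹ := by
      rw [Real.rpow_natCast, div_pow, div_eq_mul_inv]
    calc _ ≤ |kt ψ t (z+h)| + |kt ψ t z| := abs_sub _ _
      _ ≤ 2 * ((t^n)⁻¹ * C₁) * 1 := by linarith
      _ ≤ 2 * ((t^n)⁻¹ * C₁) * ((6*r)^((n:ℝ)+γ/2) * Y) := by gcongr
      _ = 2 * C₁ * 6^((n:ℝ)+γ/2) * (r/t)^(n:ℝ) * r^(γ/2) * Y := by rw [e1, e2]; ring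
      _ ≤ 2 * C₁ * 6^((n:ℝ)+γ/2) * (r/t)^β * r^(γ/2) * Y := by gcongr
      _ ≤ _ := by
          gcongr
          have : 0 ≤ C₂ * 2^γ * (1/2:ℝ)^(-((n:ℝ)+γ/2)) := by positivity
          linarith

lemma Ginf_bound {C₁ C₂ δ γ : ℝ} (hC₁ : 0 < C₁) (hC₂ : 0 < C₂)
    (hδ : 0 < δ) (hγ : 0 < γ) {ψ : Rn n → ℝ} (hψ : PsiKernel n C₁ C₂ δ γ ψ) :
    ∃ C : ℝ, 0 ≤ C ∧ ∀ (ω f : Rn n → ℝ) (A N : ℝ), Hyp ω f A N → ∀ (c : Rn n) (r : ℝ), 0 < r →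
      ∀ x ∈ ball c r, ∀ x' ∈ ball c r, Gs ψ (Ioi r) f x ≤ Gs ψ (Ioi r) f x' +
        ENNReal.ofReal (C * (A * N) * (wInt ω (ball c r) / r^n)) := by
  set β := min (γ/2) 1 with hβ
  have hβ0 : 0 < β := by rw [hβ]; positivity
  set c3 := (2 * C₁ * 6^((n:ℝ)+γ/2) + C₂ * 2^γ * (1/2:ℝ)^(-((n:ℝ)+γ/2))) with hc3
  have hc30 : 0 ≤ c3 := by rw [hc3]; positivity
  have hT := TC_nonneg n (γ/2)
  refine ⟨c3 * TC n (γ/2) * Real.sqrt (1/(2*β) + 1/(2*β)), by positivity, ?_⟩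
  intro ω f A N H c r hr x hx x' hx'
  have hψm := hψ.measurable hγ
  have hfm := H.hf.aestronglyMeasurable
  have hw0 := H.wpos c hr
  have hA := H.hA.1
  have hN := H.hN
  set W := wInt ω (ball c r) / r^n with hW
  have hW0 : 0 < W := by rw [hW]; positivity
  have hη : 0 < γ/2 := by positivity
  have hd : ∀ t ∈ Ioi r, 0 < t → ‖cvl ψ t f x - cvl ψ t f x'‖ ≤
      (c3 * TC n (γ/2) * (A*N) * W) * min ((t/r)^β) ((r/t)^β) := by
    intro t htr ht
    have htr : r < t := htr
    have hmin : min ((t/r)^β) ((r/t)^β) = (r/t)^β := by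
      apply min_eq_right
      calc (r/t)^β ≤ 1 := Real.rpow_le_one (by positivity) (by rw [div_le_one ht]; exact htr.le) hβ0.le
        _ ≤ _ := Real.one_le_rpow (by rw [one_le_div hr]; exact htr.le) hβ0.le
    rw [hmin, H.cvl_eq hC₁ hδ hγ hψ ht hr hx, H.cvl_eq hC₁ hδ hγ hψ ht hr hx',
      ← integral_sub (H.kt_int hC₁ hδ hγ hψ ht hr hx) (H.kt_int hC₁ hδ hγ hψ ht hr hx')]
    have hTl := (H.tail_int hη c hr).norm
    have hb : ∀ y, ‖kt ψ t (x - y) * (f y - avg f (ball c r)) - kt ψ t (x' - y) * (f y - avg f (ball c r))‖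
        ≤ (c3 * (r/t)^β * r^(γ/2)) * ‖(f y - avg f (ball c r)) * (r + ‖y - c‖)^(-((n:ℝ)+γ/2))‖ := by
      intro y
      rw [← sub_mul, norm_mul, norm_mul, Real.norm_eq_abs, Real.norm_of_nonneg (r := (r + ‖y - c‖) ^ _) (by positivity)]
      have := mul_le_mul_of_nonneg_right (kdiff H.hn hC₁ hC₂ hδ hγ hψ hr htr.le hx hx' y)
        (norm_nonneg (f y - avg f (ball c r)))
      refine this.trans_eq ?_
      ring
    have h1 := norm_integral_le_of_norm_le (hTl.const_mul (c3 * (r/t)^β * r^(γ/2)))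
      (Filter.Eventually.of_forall hb)
    refine h1.trans ?_
    rw [integral_const_mul]
    have h2 := H.tail_le hη c hr
    have e : ∀ y, ‖(f y - avg f (ball c r)) * (r + ‖y - c‖)^(-((n:ℝ)+γ/2))‖ =
        |f y - avg f (ball c r)| * (r + ‖y - c‖)^(-((n:ℝ)+γ/2)) := by
      intro y
      rw [norm_mul, Real.norm_eq_abs, Real.norm_of_nonneg (r := (r + ‖y - c‖) ^ _) (by positivity)]
    simp only [e]
    refine (mul_le_mul_of_nonneg_left h2 (by positivity)).trans_eq ?_
    have e4 : r^(γ/2) * r^(-(γ/2)) = 1 := by rw [← Real.rpow_add hr]; simp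
    rw [← hW]
    linear_combination (c3 * (r/t)^β * TC n (γ/2) * (A*N) * W) * e4
  have h1 := eLpNorm_nu_le measurableSet_Ioi (by positivity) hr hβ0 hβ0 hd
  unfold Gs
  have e : (fun t => cvl ψ t f x) = (fun t => cvl ψ t f x') + (fun t => cvl ψ t f x - cvl ψ t f x') := by
    ext t; simp
  rw [e]
  refine (eLpNorm_add_le (measurable_cvl_t hψm hfm x').aestronglyMeasurable
    ((measurable_cvl_t hψm hfm x).sub (measurable_cvl_t hψm hfm x')).aestronglyMeasurable
    (by norm_num)).trans ?_
  gcongr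
  refine h1.trans_eq ?_
  congr 1; ring

/-- The cube of side `4r` around `c`. -/
def bigQ (c : Rn n) (r : ℝ) : Set (Rn n) := hc (WithLp.toLp 2 (fun i => c i - 2*r)) (4*r)

lemma mem_bigQ {c : Rn n} {r : ℝ} (hr : 0 < r) : c ∈ bigQ c r := by
  intro i
  simp only
  constructor <;> linarith

lemma far_bigQ {c y : Rn n} {r : ℝ} (hy : y ∉ bigQ c r) : 2*r ≤ ‖y - c‖ := by
  by_contra h
  push Not at h
  apply hy
  intro i
  have h1 : |(y - c) i| ≤ ‖y - c‖ := by
    have := PiLp.norm_apply_le (p := 2) (y - c) i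
    rwa [Real.norm_eq_abs] at this
  have h2 := abs_lt.1 (h1.trans_lt h)
  rw [PiLp.sub_apply] at h2
  simp only
  constructor <;> linarith [h2.1, h2.2]

lemma bigQ_sub (hn : 1 ≤ n) {c : Rn n} {r : ℝ} (hr : 0 < r) : bigQ c r ⊆ ball c ((4*n) * r) := by
  have := hc_subset_ball hn (mem_bigQ (c := c) hr)
  have e : (4*n) * r = n * (4 * r) := by ring
  rw [e]; exact this

lemma Hyp.d_bound {ω f : Rn n → ℝ} {A N : ℝ} (H : Hyp ω f A N) (c : Rn n) {r : ℝ} (hr : 0 < r) :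
    |avg f (bigQ c r) - avg f (ball c r)| ≤
      ((2^(4*n))^n * ((4*n:ℕ)+1) * 2^n) * (A * N) * (wInt ω (ball c r) / r^n) := by
  have hv : volume (bigQ c r) = ENNReal.ofReal ((4*r)^n) := volume_hc _ (by positivity)
  have h1 := avg_dev (f := f) (E := bigQ c r) (by rw [hv]; exact ENNReal.ofReal_ne_top)
    (by rw [hv]; simp; positivity) (intOn_hc H.hn H.hf _ _) (avg f (ball c r))
  have hsub : bigQ c r ⊆ ball c (2^(4*n) * r) := by
    refine (bigQ_sub H.hn hr).trans (ball_subset_ball ?_)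
    have : ((4*n:ℕ):ℝ) ≤ 2^(4*n) := by exact_mod_cast (Nat.lt_two_pow_self).le
    push_cast at this
    gcongr
  have h2 : ∫ x in bigQ c r, |f x - avg f (ball c r)| ≤
      ∫ x in ball c (2^(4*n)*r), |f x - avg f (ball c r)| :=
    setIntegral_mono_set (H.intC _ _ _) (Filter.Eventually.of_forall fun x => abs_nonneg _)
      hsub.eventuallyLE
  have h3 := H.int_k c hr (4*n)
  rw [hv, ENNReal.toReal_ofReal (by positivity)] at h1
  have hw := H.wpos c hr
  have hr4 : r^n ≤ (4*r)^n := pow_le_pow_left₀ hr.le (by linarith) n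
  have h4 : |avg f (bigQ c r) - avg f (ball c r)| * r^n ≤
      (2^(4*n))^n * ((4*n:ℕ)+1) * (N * 2^n * A * wInt ω (ball c r)) :=
    (mul_le_mul_of_nonneg_left hr4 (abs_nonneg _)).trans (h1.trans (h2.trans h3))
  have hrn : 0 < r^n := by positivity
  rw [← mul_div_assoc, le_div_iff₀ hrn]
  refine h4.trans_eq ?_
  ring

lemma G0_pt {C₁ C₂ δ γ : ℝ} (hC₁ : 0 < C₁)
    (hδ : 0 < δ) (hγ : 0 < γ) {ψ : Rn n → ℝ} (hψ : PsiKernel n C₁ C₂ δ γ ψ) :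
    ∃ C : ℝ, 0 ≤ C ∧ ∀ (ω f : Rn n → ℝ) (A N : ℝ), Hyp ω f A N → ∀ (c : Rn n) (r : ℝ), 0 < r →
      ∀ x ∈ ball c r, Gs ψ (Ioc 0 r) f x ≤ Gs ψ univ (ub f (bigQ c r)) x +
        ENNReal.ofReal (C * (A * N) * (wInt ω (ball c r) / r^n)) := by
  have hT := TC_nonneg n δ
  have hJ := JJ_nonneg (n := n) δ
  set kd : ℝ := ((2^(4*n))^n * ((4*n:ℕ)+1) * 2^n) with hkd
  have hkd0 : 0 ≤ kd := by rw [hkd]; positivity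
  set k3 : ℝ := (1/3:ℝ)^(-((n:ℝ)+δ)) with hk3
  have hk30 : 0 ≤ k3 := by rw [hk3]; positivity
  refine ⟨C₁ * k3 * (TC n δ + kd * JJ n δ) * Real.sqrt (1/(2*δ) + 1/(2*δ)), by positivity, ?_⟩
  intro ω f A N H c r hr x hx
  have hψm := hψ.measurable hγ
  have hfm := H.hf.aestronglyMeasurable
  have hw0 := H.wpos c hr
  have hA := H.hA.1
  have hN := H.hN
  have hdb := H.d_bound c hr
  rw [← hkd] at hdb
  set Q := bigQ c r with hQ
  set W := wInt ω (ball c r) / r^n with hW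
  have hW0 : 0 < W := by rw [hW]; positivity
  set b := avg f (ball c r) with hb
  set d := avg f Q - b with hd
  have hQm : MeasurableSet Q := measurableSet_hc _ _
  have hQv : volume Q = ENNReal.ofReal ((4*r)^n) := volume_hc _ (by positivity)
  have hui : Integrable (ub f Q) := integrable_ub hQm (by rw [hQv]; exact ENNReal.ofReal_ne_top)
    (intOn_hc H.hn H.hf _ _)
  set v : Rn n → ℝ := Qᶜ.indicator (fun y => f y - avg f Q) with hv
  have hdec : ∀ y, v y = (f y - b) - ub f Q y - d := by
    intro y
    simp only [hv, ub, hd]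
    by_cases hy : y ∈ Q
    · rw [indicator_of_notMem (by simpa using hy), indicator_of_mem hy]; ring
    · rw [indicator_of_mem (by simpa using hy), indicator_of_notMem hy]; ring
  have hp : 0 ≤ (n:ℝ) + δ := by positivity
  -- integrability
  have hi1 : ∀ t, 0 < t → Integrable (fun y => kt ψ t (x - y) * (f y - b)) := fun t ht =>
    H.kt_int hC₁ hδ hγ hψ ht hr hx
  have hi2 : ∀ t, 0 < t → Integrable (fun y => kt ψ t (x - y) * ub f Q y) := fun t ht =>
    integrable_kt_mul hC₁ hδ hψm hψ.2.2.1 ht hui x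
  have hi3 : ∀ t, 0 < t → Integrable (fun y => kt ψ t (x - y) * d) := fun t ht =>
    ((integrable_kt hψ.1 ht).comp_sub_left x).mul_const _
  have h30 : ∀ t, 0 < t → ∫ y, kt ψ t (x - y) * d = 0 := fun t ht => by
    rw [integral_mul_const, integral_sub_left_eq_self (kt ψ t) volume x, integral_kt ht, hψ.2.1, zero_mul]
  have hdiff : ∀ t, 0 < t → cvl ψ t f x - cvl ψ t (ub f Q) x = ∫ y, kt ψ t (x - y) * v y := by
    intro t ht
    rw [H.cvl_eq hC₁ hδ hγ hψ ht hr hx, cvl_eq_kt, ← hb,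
      ← sub_zero (_ - ∫ y, kt ψ t (x - y) * ub f Q y), ← h30 t ht,
      ← integral_sub (hi1 t ht) (hi2 t ht)]
    have hi4 : Integrable (fun y => kt ψ t (x - y) * (f y - b) - kt ψ t (x - y) * ub f Q y) :=
      (hi1 t ht).sub (hi2 t ht)
    rw [← integral_sub hi4 (hi3 t ht)]
    congr 1; ext y
    rw [hdec y]; ring
  have hbd : ∀ t ∈ Ioc 0 r, 0 < t → ‖cvl ψ t f x - cvl ψ t (ub f Q) x‖ ≤
      (C₁ * k3 * (TC n δ + kd * JJ n δ) * (A*N) * W) * min ((t/r)^δ) ((r/t)^δ) := by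
    intro t htr ht
    have hmin : min ((t/r)^δ) ((r/t)^δ) = (t/r)^δ := by
      apply min_eq_left
      calc (t/r)^δ ≤ 1 := Real.rpow_le_one (by positivity) (by rw [div_le_one hr]; exact htr.2) hδ.le
        _ ≤ _ := Real.one_le_rpow (by rw [one_le_div ht]; exact htr.2) hδ.le
    rw [hmin, hdiff t ht]
    have hTl := (H.tail_int hδ c hr).norm
    have hTl2 := (integrable_bracket_r (n := n) hδ hr c).const_mul |d|
    have hpt : ∀ y, ‖kt ψ t (x - y) * v y‖ ≤ (C₁ * t^δ * k3) *
        (‖(f y - b) * (r + ‖y - c‖)^(-((n:ℝ)+δ))‖ + |d| * (r + ‖y - c‖)^(-((n:ℝ)+δ))) := by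
      intro y
      by_cases hy : y ∈ Q
      · have : v y = 0 := by rw [hv, indicator_of_notMem (by simpa using hy)]
        rw [this]; simp only [mul_zero, norm_zero]; positivity
      · have hvy : v y = (f y - b) - d := by
          rw [hdec y, ub, indicator_of_notMem hy]; ring
        have hfar := far_bigQ hy
        have hxy := dist_aux (y := y) hx
        have h1 := kt_le hψ.2.2.1 ht (x - y)
        have h2 : (t + ‖x - y‖)^(-((n:ℝ)+δ)) ≤ k3 * (r + ‖y - c‖)^(-((n:ℝ)+δ)) :=
          bracket_cmp (by norm_num) hr hp (by linarith)
        have h3 : |v y| ≤ |f y - b| + |d| := by rw [hvy]; exact abs_sub _ _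
        rw [norm_mul, norm_mul, Real.norm_eq_abs, Real.norm_eq_abs, Real.norm_eq_abs,
          Real.norm_of_nonneg (r := (r + ‖y - c‖) ^ _) (by positivity)]
        calc |kt ψ t (x - y)| * |v y| ≤ (C₁ * t^δ * (k3 * (r + ‖y - c‖)^(-((n:ℝ)+δ)))) * (|f y - b| + |d|) := by
              apply mul_le_mul _ h3 (abs_nonneg _) (by positivity)
              exact h1.trans (mul_le_mul_of_nonneg_left h2 (by positivity))
          _ = _ := by ring
    have h1 := norm_integral_le_of_norm_le ((hTl.add hTl2).const_mul (C₁ * t^δ * k3))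
      (Filter.Eventually.of_forall hpt)
    refine h1.trans ?_
    rw [integral_const_mul, integral_add' hTl hTl2, integral_const_mul, integral_bracket_r hr c]
    have h2 := H.tail_le hδ c hr
    have e : ∀ y, ‖(f y - avg f (ball c r)) * (r + ‖y - c‖)^(-((n:ℝ)+δ))‖ =
        |f y - b| * (r + ‖y - c‖)^(-((n:ℝ)+δ)) := by
      intro y
      rw [norm_mul, Real.norm_eq_abs, Real.norm_of_nonneg (r := (r + ‖y - c‖) ^ _) (by positivity)]
    simp only [e]
    have h4 : |d| * (r^(-δ) * JJ n δ) ≤ kd * (A*N) * W * (r^(-δ) * JJ n δ) :=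
      mul_le_mul_of_nonneg_right hdb (by positivity)
    have e4 : (t/r)^δ = t^δ * r^(-δ) := by
      rw [Real.div_rpow ht.le hr.le, Real.rpow_neg hr.le, div_eq_mul_inv]
    refine (mul_le_mul_of_nonneg_left (add_le_add h2 h4) (by positivity)).trans_eq ?_
    rw [e4, ← hW]
    ring
  have h1 := eLpNorm_nu_le measurableSet_Ioc (by positivity) hr hδ hδ hbd
  have h2 : Gs ψ (Ioc 0 r) f x ≤ Gs ψ (Ioc 0 r) (ub f Q) x +
      ENNReal.ofReal ((C₁ * k3 * (TC n δ + kd * JJ n δ) * (A*N) * W) * Real.sqrt (1/(2*δ) + 1/(2*δ))) := by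
    unfold Gs
    have e : (fun t => cvl ψ t f x) = (fun t => cvl ψ t (ub f Q) x) +
        (fun t => cvl ψ t f x - cvl ψ t (ub f Q) x) := by
      ext t; simp
    rw [e]
    refine (eLpNorm_add_le (measurable_cvl_t hψm hui.1 x).aestronglyMeasurable
      ((measurable_cvl_t hψm hfm x).sub (measurable_cvl_t hψm hui.1 x)).aestronglyMeasurable
      (by norm_num)).trans ?_
    exact add_le_add le_rfl h1
  refine h2.trans (add_le_add (Gs_mono_set _ _ (subset_univ _) x) (le_of_eq ?_))
  congr 1; ring

lemma G0_bound (hn : 1 ≤ n) {C₁ C₂ δ γ : ℝ} (hC₁ : 0 < C₁) (hC₂ : 0 < C₂)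
    (hδ : 0 < δ) (hγ : 0 < γ) {ψ : Rn n → ℝ} (hψ : PsiKernel n C₁ C₂ δ γ ψ) (A : ℝ) :
    ∃ C : ℝ, 0 ≤ C ∧ ∀ (ω f : Rn n → ℝ) (N : ℝ), Hyp ω f A N → ∀ (c : Rn n) (r : ℝ), 0 < r →
      ∫⁻ x in ball c r, Gs ψ (Ioc 0 r) f x ≤ ENNReal.ofReal (C * N * wInt ω (ball c r)) := by
  by_cases hA : 0 < A
  swap
  · exact ⟨0, le_rfl, fun ω f N H => absurd H.hA.1 hA⟩
  obtain ⟨C0, hC0, hloc⟩ := local_bound hn hC₁ hC₂ hδ hγ hψ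
  obtain ⟨C5, hC5, hpt⟩ := G0_pt hC₁ hδ hγ hψ
  have hV := VV_pos (n := n)
  have hn0 : (0:ℝ) < n := by exact_mod_cast hn
  have hn1 : (1:ℝ) ≤ n := by exact_mod_cast hn
  set A' := n^n * VV n * A with hA'
  have hA'0 : 0 < A' := by rw [hA']; positivity
  refine ⟨C0 * A' * (2 * A') * ((4*n)^n * A) + C5 * A * VV n, by positivity, ?_⟩
  intro ω f N H c r hr
  have hN := H.hN
  have hw0 := H.wpos c hr
  have h1 := hloc ω H.hω f H.hf A' (2 * N * A') hA'0 (by positivity)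
    (fun a s hs => A1_hc hn H.hω H.hA a hs)
    (fun a s hs => osc_hc hn H.hω H.hA H.hf hN H.hosc a hs)
    (WithLp.toLp 2 (fun i => c i - 2*r)) (4*r) (by positivity)
  have hwQ : wInt ω (bigQ c r) ≤ (4*n)^n * A * wInt ω (ball c r) :=
    (wInt_mono H.hω (bigQ_sub hn hr) (intOn_ball H.hω.2.1 _ _)).trans (H.dbl c hr (by linarith))
  have hrn : 0 < r^n := by positivity
  set K := C5 * (A * N) * (wInt ω (ball c r) / r^n) with hK
  have hK0 : 0 ≤ K := by positivity
  calc _ ≤ ∫⁻ x in ball c r, (Gs ψ univ (ub f (bigQ c r)) x + ENNReal.ofReal K) :=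
        setLIntegral_mono' measurableSet_ball fun x hx => hpt ω f A N H c r hr x hx
    _ = (∫⁻ x in ball c r, Gs ψ univ (ub f (bigQ c r)) x) + ENNReal.ofReal K * volume (ball c r) := by
        rw [lintegral_add_right _ measurable_const, setLIntegral_const]
    _ ≤ ENNReal.ofReal (C0 * A' * (2 * N * A') * ((4*n)^n * A * wInt ω (ball c r))) +
        ENNReal.ofReal (K * (r^n * VV n)) := by
        refine add_le_add (((setLIntegral_le_lintegral _ _).trans h1).trans ?_) (le_of_eq ?_)
        · apply ENNReal.ofReal_le_ofReal
          exact mul_le_mul_of_nonneg_left hwQ (by positivity)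
        · rw [ENNReal.ofReal_mul hK0, ← vol_ball hn c hr.le,
            ENNReal.ofReal_toReal measure_ball_lt_top.ne]
    _ = _ := by
        rw [← ENNReal.ofReal_add (by positivity) (by positivity)]
        congr 1
        rw [hK]; field_simp

lemma Gs_split (ψ f : Rn n → ℝ) {r : ℝ} (hr : 0 < r) (x : Rn n) :
    Gfun ψ f x ≤ Gs ψ (Ioc 0 r) f x + Gs ψ (Ioi r) f x := by
  rw [Gfun_eq]
  have hp : ∀ᵐ t ∂nu, t ∈ Ioi (0:ℝ) := nu_ae_pos
  have e : nu.restrict univ = nu.restrict (Ioc 0 r) + nu.restrict (Ioi r) := by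
    have hd : Disjoint (Ioc 0 r) (Ioi r) := Set.disjoint_left.2 fun t h1 h2 => not_lt.2 h1.2 h2
    rw [Measure.restrict_univ, ← Measure.restrict_union hd measurableSet_Ioi,
      Ioc_union_Ioi_eq_Ioi hr.le, Measure.restrict_eq_self_of_ae_mem hp]
  have h2 : (Gs ψ univ f x)^2 ≤ (Gs ψ (Ioc 0 r) f x + Gs ψ (Ioi r) f x)^2 := by
    have : (Gs ψ univ f x)^2 = (Gs ψ (Ioc 0 r) f x)^2 + (Gs ψ (Ioi r) f x)^2 := by
      unfold Gs
      rw [eLpNorm_two_sq, eLpNorm_two_sq, eLpNorm_two_sq, e, lintegral_add_measure]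
    rw [this, add_sq]
    gcongr
    exact le_self_add
  exact (ENNReal.pow_le_pow_left_iff two_ne_zero).1 h2

lemma Gs_Ioi_le (ψ f : Rn n → ℝ) (r : ℝ) (x : Rn n) : Gs ψ (Ioi r) f x ≤ Gfun ψ f x := by
  rw [Gfun_eq]; exact Gs_mono_set _ _ (subset_univ _) x

lemma essInf_ge {B : Set (Rn n)} (hB : volume B ≠ 0) {g : Rn n → ℝ} (hg : ∀ x, 0 ≤ g x) {a : ℝ}
    (h : ∀ᵐ x ∂(volume.restrict B), a ≤ g x) : a ≤ essInf g (volume.restrict B) := by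
  have : Filter.NeBot (ae (volume.restrict B)) := by
    rw [ae_neBot]; simpa [Measure.restrict_eq_zero] using hB
  unfold essInf
  refine Filter.le_liminf_of_le ?_ h
  -- cobounded: some upper bound holds frequently
  obtain ⟨M, hM⟩ : ∃ M : ℝ, ∃ᶠ x in ae (volume.restrict B), g x ≤ M := by
    by_contra hcon
    push Not at hcon
    have h1 : ∀ k : ℕ, ∀ᵐ x ∂(volume.restrict B), (k:ℝ) < g x := by
      intro k
      have := hcon k
      simpa [Filter.not_frequently] using this
    have h2 := ae_all_iff.2 h1
    obtain ⟨x, hx⟩ := h2.exists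
    obtain ⟨k, hk⟩ := exists_nat_gt (g x)
    exact absurd (hx k) (by linarith)
  exact Filter.IsCoboundedUnder.of_frequently_le hM

lemma ofReal_integral_le {B : Set (Rn n)} (h : Rn n → ℝ) :
    ENNReal.ofReal (∫ x in B, h x) ≤ ∫⁻ x in B, ENNReal.ofReal (h x) := by
  by_cases hi : Integrable h (volume.restrict B)
  · rw [integral_eq_lintegral_pos_part_sub_lintegral_neg_part hi]
    refine (ENNReal.ofReal_le_ofReal (sub_le_self _ ENNReal.toReal_nonneg)).trans ?_
    exact ENNReal.ofReal_toReal_le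
  · rw [integral_undef hi]; simp

theorem bmo_blo_of_Gfun (n : ℕ) (hn : 1 ≤ n) (C₁ C₂ δ γ : ℝ)
    (hC₁ : 0 < C₁) (hC₂ : 0 < C₂) (hδ : 0 < δ) (hγ : 0 < γ)
    (ψ : Rn n → ℝ) (hψ : PsiKernel n C₁ C₂ δ γ ψ)
    (ω : Rn n → ℝ) (hω : IsWeight ω) (hA1 : IsA1ball ω) :
    ∃ C : ℝ, 0 < C ∧ ∀ f : Rn n → ℝ, LocallyIntegrable f volume →
      bmoNorm ω f < ⊤ →
      ∀ x₀ : Rn n, Gfun ψ f x₀ < ⊤ →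
        (∀ᵐ x ∂(volume : Measure (Rn n)), Gfun ψ f x < ⊤) ∧
        bloNorm ω (fun x => (Gfun ψ f x).toReal) ≤ ENNReal.ofReal C * bmoNorm ω f := by
  obtain ⟨A, hA⟩ := hA1
  have hA0 : 0 < A := hA.1
  obtain ⟨K0, hK0, hG0⟩ := G0_bound hn hC₁ hC₂ hδ hγ hψ A
  obtain ⟨K1, hK1, hG1⟩ := Ginf_bound hC₁ hC₂ hδ hγ hψ
  have hV := VV_pos (n := n)
  refine ⟨K0 + K1 * A * VV n + 1, by positivity, ?_⟩
  intro f hf hbmo x₀ hx₀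
  have hψm := hψ.measurable hγ
  have hfm : AEStronglyMeasurable f volume := hf.aestronglyMeasurable
  have hH : ∀ N : ℝ, (bmoNorm ω f).toReal < N → Hyp ω f A N := by
    intro N hN
    refine ⟨hn, hω, hA, hf, lt_of_le_of_lt ENNReal.toReal_nonneg hN, ?_⟩
    intro c r hr
    have hw : 0 < wInt ω (ball c r) :=
      wInt_pos hω (measure_ball_pos _ _ hr).ne' (intOn_ball hω.2.1 c r)
    have h1 : ENNReal.ofReal (bmoAvg ω f (ball c r)) ≤ bmoNorm ω f := by
      unfold bmoNorm
      exact le_iSup_of_le c (le_iSup_of_le r (le_iSup_of_le hr le_rfl))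
    have h2 : bmoAvg ω f (ball c r) ≤ N :=
      ((ENNReal.ofReal_le_iff_le_toReal hbmo.ne).1 h1).trans hN.le
    unfold bmoAvg at h2
    rw [inv_mul_le_iff₀ hw] at h2
    linarith
  have hfin : ∀ᵐ x ∂(volume : Measure (Rn n)), Gfun ψ f x < ⊤ := by
    have H := hH _ (lt_add_one (bmoNorm ω f).toReal)
    have hk : ∀ k : ℕ, ∀ᵐ x ∂(volume : Measure (Rn n)), x ∈ ball x₀ ((k:ℝ)+1) → Gfun ψ f x < ⊤ := by
      intro k
      have hr : (0:ℝ) < k + 1 := by positivity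
      have h1 := hG0 ω f _ H x₀ _ hr
      have h2 := ae_lt_top (measurable_Gs hψm hfm (Ioc 0 ((k:ℝ)+1))) (h1.trans_lt ENNReal.ofReal_lt_top).ne
      rw [ae_restrict_iff' measurableSet_ball] at h2
      filter_upwards [h2] with x hx hxb
      have h3 := hG1 ω f A _ H x₀ _ hr x hxb x₀ (mem_ball_self hr)
      refine (Gs_split ψ f hr x).trans_lt (ENNReal.add_lt_top.2 ⟨hx hxb, ?_⟩)
      exact h3.trans_lt (ENNReal.add_lt_top.2 ⟨(Gs_Ioi_le ψ f _ x₀).trans_lt hx₀, ENNReal.ofReal_lt_top⟩)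
    filter_upwards [ae_all_iff.2 hk] with x hx
    obtain ⟨k, hk⟩ := exists_nat_gt (dist x x₀)
    exact hx k (by rw [mem_ball]; linarith)
  refine ⟨hfin, ?_⟩
  have main : ∀ N : ℝ, (bmoNorm ω f).toReal < N →
      bloNorm ω (fun x => (Gfun ψ f x).toReal) ≤ ENNReal.ofReal ((K0 + K1 * A * VV n + 1) * N) := by
    intro N hNb
    have H := hH N hNb
    have hN := H.hN
    unfold bloNorm
    refine iSup_le fun c => iSup_le fun r => iSup_le fun hr => ?_
    apply ENNReal.ofReal_le_ofReal
    have hw := H.wpos c hr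
    have hrn : 0 < r^n := by positivity
    unfold bloAvg
    rw [inv_mul_le_iff₀ hw]
    set B := ball c r with hB
    set K : ℝ := K1 * (A * N) * (wInt ω B / r^n) with hK
    have hKnn : 0 ≤ K := by rw [hK]; positivity
    set m := essInf (fun x => (Gfun ψ f x).toReal) (volume.restrict B) with hm
    have hpt : ∀ᵐ x ∂(volume.restrict B),
        ENNReal.ofReal ((Gfun ψ f x).toReal - m) ≤ Gs ψ (Ioc 0 r) f x + ENNReal.ofReal K := by
      filter_upwards [ae_restrict_mem measurableSet_ball, ae_restrict_of_ae hfin] with x hx hxf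
      have hx1 : Gs ψ (Ioi r) f x < ⊤ := (Gs_Ioi_le ψ f r x).trans_lt hxf
      have hlow : (Gs ψ (Ioi r) f x).toReal - K ≤ m := by
        apply essInf_ge (measure_ball_pos _ _ hr).ne' (fun _ => ENNReal.toReal_nonneg)
        filter_upwards [ae_restrict_mem measurableSet_ball, ae_restrict_of_ae hfin] with y hy hyf
        have h3 := (hG1 ω f A N H c r hr x hx y hy).trans
          (add_le_add (Gs_Ioi_le ψ f r y) le_rfl)
        have h4 := ENNReal.toReal_mono (ENNReal.add_lt_top.2 ⟨hyf, ENNReal.ofReal_lt_top⟩).ne h3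
        rw [ENNReal.toReal_add hyf.ne ENNReal.ofReal_ne_top, ENNReal.toReal_ofReal hKnn] at h4
        linarith
      by_cases h0 : Gs ψ (Ioc 0 r) f x = ⊤
      · rw [h0]; simp
      · have h5 := ENNReal.toReal_mono (ENNReal.add_lt_top.2 ⟨lt_top_iff_ne_top.2 h0, hx1⟩).ne
          (Gs_split ψ f hr x)
        rw [ENNReal.toReal_add h0 hx1.ne] at h5
        calc ENNReal.ofReal ((Gfun ψ f x).toReal - m)
            ≤ ENNReal.ofReal ((Gs ψ (Ioc 0 r) f x).toReal + K) :=
              ENNReal.ofReal_le_ofReal (by linarith)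
          _ = _ := by rw [ENNReal.ofReal_add ENNReal.toReal_nonneg hKnn, ENNReal.ofReal_toReal h0]
    have hvol : volume B = ENNReal.ofReal (r^n * VV n) := by
      rw [← vol_ball hn c hr.le, ENNReal.ofReal_toReal measure_ball_lt_top.ne]
    have hle : ENNReal.ofReal (∫ x in B, ((Gfun ψ f x).toReal - m)) ≤
        ENNReal.ofReal (K0 * N * wInt ω B + K * (r^n * VV n)) := by
      calc _ ≤ ∫⁻ x in B, ENNReal.ofReal ((Gfun ψ f x).toReal - m) := ofReal_integral_le _
        _ ≤ ∫⁻ x in B, (Gs ψ (Ioc 0 r) f x + ENNReal.ofReal K) := lintegral_mono_ae hpt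
        _ = (∫⁻ x in B, Gs ψ (Ioc 0 r) f x) + ENNReal.ofReal K * volume B := by
            rw [lintegral_add_right _ measurable_const, setLIntegral_const]
        _ ≤ ENNReal.ofReal (K0 * N * wInt ω B) + ENNReal.ofReal K * ENNReal.ofReal (r^n * VV n) := by
            rw [hvol]; exact add_le_add (hG0 ω f N H c r hr) le_rfl
        _ = _ := by
            rw [← ENNReal.ofReal_mul hKnn, ← ENNReal.ofReal_add (by positivity) (by positivity)]
    have h6 := (ENNReal.ofReal_le_ofReal_iff (by positivity)).1 hle
    refine h6.trans ?_
    have e : K * (r^n * VV n) = K1 * A * VV n * N * wInt ω B := by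
      rw [hK]; field_simp
    rw [e]
    have : 0 ≤ N * wInt ω B := by positivity
    nlinarith
  have hrhs : ENNReal.ofReal (K0 + K1 * A * VV n + 1) * bmoNorm ω f =
      ENNReal.ofReal ((K0 + K1 * A * VV n + 1) * (bmoNorm ω f).toReal) := by
    rw [ENNReal.ofReal_mul (by positivity), ENNReal.ofReal_toReal hbmo.ne]
  rw [hrhs]
  have hcont : Filter.Tendsto (fun N : ℝ => ENNReal.ofReal ((K0 + K1 * A * VV n + 1) * N))
      (nhdsWithin (bmoNorm ω f).toReal (Ioi (bmoNorm ω f).toReal))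
      (nhds (ENNReal.ofReal ((K0 + K1 * A * VV n + 1) * (bmoNorm ω f).toReal))) := by
    have : Continuous (fun N : ℝ => ENNReal.ofReal ((K0 + K1 * A * VV n + 1) * N)) :=
      ENNReal.continuous_ofReal.comp (continuous_const.mul continuous_id)
    exact this.continuousAt.tendsto.mono_left nhdsWithin_le_nhds
  exact ge_of_tendsto hcont (by filter_upwards [self_mem_nhdsWithin] with N hN using main N hN)

end LPW
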